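/- arXiv:math/0004175 — 3 statements merged into one kernel-verified Lean document; each statement's English description precedes it below -/
import Mathlib

section
/- Fix k ≤ m ≤ n and a k-assignment matrix σ, and let P_σ be the set of nonnegative m×n matrices X with min_k(X) = σ·X. Then every element of P_σ is a nonnegative real linear combination of matrices of the following two kinds: (1) matrices e_{ij} (the matrix with a single 1 in position (i,j) and 0 elsewhere) such that σ·e_{ij} = 0, and (2) matrices V_{IJ} with |I| + |J| < k that belong to P_σ, where for I ⊆ {1,…,m} and J ⊆ {1,…,n}, V_{IJ} is the 0-1 matrix obtained from the all-ones m×n matrix by setting to zero all entries in the rows indexed by I and the columns indexed by J. -/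
/-- A `k`-assignment of an `m × n` matrix (indexed by naturals, rows `< m`, columns `< n`):
a set of `k` positions, no two in the same row or column. -/
def IsAssign (m n k : ℕ) (S : Finset (ℕ × ℕ)) : Prop :=
  S.card = k ∧ (∀ p ∈ S, p.1 < m ∧ p.2 < n) ∧
    ∀ p ∈ S, ∀ q ∈ S, p ≠ q → p.1 ≠ q.1 ∧ p.2 ≠ q.2

/-- The value of a set of positions in the matrix `X`. -/
def aval (X : ℕ → ℕ → ℝ) (S : Finset (ℕ × ℕ)) : ℝ := ∑ p ∈ S, X p.1 p.2

/-- `S` is a `k`-assignment achieving the minimum value `min_k(X)`. -/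
def MinAssign (m n k : ℕ) (X : ℕ → ℕ → ℝ) (S : Finset (ℕ × ℕ)) : Prop :=
  IsAssign m n k S ∧ ∀ T, IsAssign m n k T → aval X S ≤ aval X T

/-- The 0-1 matrix obtained from the all-ones matrix by zeroing out the rows indexed by `I`
and the columns indexed by `J`. -/
def V (I J : Finset ℕ) : ℕ → ℕ → ℝ := fun i j => if i ∈ I ∨ j ∈ J then 0 else 1

/-- The total weight of the walk from `a` to `b` through the intermediate vertices `l`. -/
def walkCost {W : Type*} (w : W → W → ℝ) : W → List W → W → ℝ
  | a, [], b => w a b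
  | a, c :: l, b => w a c + walkCost w c l b

theorem walkCost_append {W : Type*} (w : W → W → ℝ) (l₁ l₂ : List W) (a b c : W) :
    walkCost w a (l₁ ++ c :: l₂) b = walkCost w a l₁ c + walkCost w c l₂ b := by
  induction l₁ generalizing a with
  | nil => rfl
  | cons d l ih => simp only [List.cons_append, walkCost, ih]; ring

/-- A simple walk closes up to a permutation of the same weight, up to its last edge. -/
theorem exists_perm_walkCost {W : Type*} [Fintype W] [DecidableEq W] (w : W → W → ℝ)
    (hw : ∀ a, w a a = 0) (l : List W) (a : W) (hl : (a :: l).Nodup) :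
    ∃ (π : Equiv.Perm W) (e : W), e ∈ a :: l ∧ π e = a ∧ (∀ i, i ∉ a :: l → π i = i) ∧
      ∀ b, walkCost w a l b = ∑ i, w i (π i) - w e a + w e b := by
  induction l generalizing a with
  | nil => exact ⟨1, a, by simp, rfl, by simp, by simp [walkCost, hw]⟩
  | cons c l ih =>
    obtain ⟨hal, hcl⟩ := List.nodup_cons.1 hl
    obtain ⟨π, e, he, hec, hfix, hcost⟩ := ih c hcl
    have hπa : π a = a := hfix a hal
    have hae : a ≠ e := fun h => hal (h ▸ he)
    refine ⟨Equiv.swap a c * π, e, List.mem_cons_of_mem _ he, by simp [hec], ?_, ?_⟩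
    · intro i hi
      have h := hfix i fun h => hi (List.mem_cons_of_mem _ h)
      rw [Equiv.Perm.mul_apply, h, Equiv.swap_apply_of_ne_of_ne]
      · rintro rfl; simp at hi
      · rintro rfl; simp at hi
    · intro b
      have hsum : ∑ i, (w i ((Equiv.swap a c * π) i) - w i (π i)) =
          w a c + (w e a - w e c) := by
        rw [Fintype.sum_eq_add a e hae]
        · simp [hπa, hec, hw]
        · rintro i ⟨hia, hie⟩
          rw [Equiv.Perm.mul_apply, Equiv.swap_apply_of_ne_of_ne, sub_self]
          · exact fun h => hia (π.injective (h.trans hπa.symm))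
          · exact fun h => hie (π.injective (h.trans hec.symm))
      rw [Finset.sum_sub_distrib] at hsum
      simp only [walkCost, hcost b]
      linarith

theorem walkCost_self_nonneg {W : Type*} [Fintype W] [DecidableEq W] (w : W → W → ℝ)
    (hw : ∀ a, w a a = 0) (hperm : ∀ π : Equiv.Perm W, 0 ≤ ∑ i, w i (π i))
    (l : List W) (a : W) : 0 ≤ walkCost w a l a := by
  induction hn : l.length using Nat.strong_induction_on generalizing l a with
  | _ N ih =>
    by_cases hnd : (a :: l).Nodup
    · obtain ⟨π, e, -, -, -, hcost⟩ := exists_perm_walkCost w hw l a hnd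
      have := hperm π
      rw [hcost a]
      linarith
    · by_cases hal : a ∈ l
      · obtain ⟨l₁, l₂, rfl⟩ := List.append_of_mem hal
        rw [walkCost_append]
        simp only [List.length_append, List.length_cons] at hn
        exact add_nonneg (ih _ (by omega) l₁ a rfl) (ih _ (by omega) l₂ a rfl)
      · have hl : ¬ l.Nodup := fun h => hnd (List.nodup_cons.2 ⟨hal, h⟩)
        obtain ⟨c, hc⟩ : ∃ c, ¬ List.count c l ≤ 1 := by
          simpa [List.nodup_iff_count_le_one] using hl
        obtain ⟨l₁, l', rfl⟩ := List.append_of_mem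
          (List.count_pos_iff.1 (by omega : 0 < List.count c l))
        by_cases hcl : c ∈ l'
        · obtain ⟨l₂, l₃, rfl⟩ := List.append_of_mem hcl
          simp only [List.length_append, List.length_cons] at hn
          have h₁ := ih _ (by omega) l₂ c rfl
          have h₂ := ih (l₁ ++ c :: l₃).length (by simp; omega) (l₁ ++ c :: l₃) a rfl
          rw [walkCost_append] at h₂ ⊢
          rw [walkCost_append]
          linarith
        · have hcl₁ : c ∈ l₁ := by
            by_contra h
            simp [List.count_append, List.count_eq_zero_of_not_mem h,
              List.count_eq_zero_of_not_mem hcl] at hc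
          obtain ⟨l₂, l₃, rfl⟩ := List.append_of_mem hcl₁
          simp only [List.length_append, List.length_cons] at hn
          have h₁ := ih _ (by omega) l₃ c rfl
          have h₂ := ih (l₂ ++ c :: l').length (by simp; omega) (l₂ ++ c :: l') a rfl
          rw [walkCost_append] at h₂
          rw [walkCost_append, walkCost_append]
          linarith

/-- If the identity is a minimum weight permutation, then the weights admit a potential. -/
theorem exists_potential {W : Type*} [Fintype W] [DecidableEq W] (w : W → W → ℝ)
    (hw : ∀ a, w a a = 0) (hperm : ∀ π : Equiv.Perm W, 0 ≤ ∑ i, w i (π i)) :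
    ∃ p : W → ℝ, ∀ a b, p b ≤ p a + w a b := by
  rcases isEmpty_or_nonempty W with _ | ⟨⟨r⟩⟩
  · exact ⟨fun _ => 0, fun a => isEmptyElim a⟩
  refine ⟨fun b => ⨅ l : List W, walkCost w r l b, fun a b => ?_⟩
  have hbdd : BddBelow (Set.range fun l : List W => walkCost w r l b) := by
    refine ⟨-w b r, ?_⟩
    rintro _ ⟨l, rfl⟩
    have := walkCost_self_nonneg w hw hperm (l ++ [b]) r
    rw [walkCost_append] at this
    simp only [walkCost] at this
    linarith
  rw [← sub_le_iff_le_add]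
  refine le_ciInf fun l => ?_
  have := ciInf_le hbdd (l ++ [a])
  rw [walkCost_append] at this
  simp only [walkCost] at this
  simp only
  linarith

/-- The entry of `X` at a position of the padded matrix: `none` indexes the padding, where all
entries are zero. -/
def padEntry (X : ℕ → ℕ → ℝ) : Option ℕ → Option ℕ → ℝ
  | some i, some j => X i j
  | _, _ => 0

theorem padEntry_none_right (X : ℕ → ℕ → ℝ) (r : Option ℕ) : padEntry X r none = 0 := by
  cases r <;> rfl

/-- A permutation of the padded matrix contains a `k`-assignment of no larger value. -/
theorem exists_assign_le_padEntry {W : Type*} [Fintype W] [DecidableEq W] (m n k : ℕ)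
    (X : ℕ → ℕ → ℝ) (hX : ∀ i < m, ∀ j < n, 0 ≤ X i j) (row col : W → Option ℕ)
    (hrow : ∀ a i, row a = some i → i < m) (hcol : ∀ a j, col a = some j → j < n)
    (hrow_inj : ∀ a b i, row a = some i → row b = some i → a = b)
    (hcol_inj : ∀ a b j, col a = some j → col b = some j → a = b)
    (hcard : k + (Finset.univ.filter fun a => row a = none).card +
      (Finset.univ.filter fun a => col a = none).card ≤ Fintype.card W)
    (π : Equiv.Perm W) :
    ∃ T, IsAssign m n k T ∧ aval X T ≤ ∑ a, padEntry X (row a) (col (π a)) := by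
  classical
  set A : Finset W := Finset.univ.filter fun a => row a ≠ none ∧ col (π a) ≠ none with hA
  set f : W → ℕ × ℕ := fun a => ((row a).getD 0, (col (π a)).getD 0) with hf
  have hspec : ∀ a ∈ A, row a = some (f a).1 ∧ col (π a) = some (f a).2 := by
    intro a ha
    obtain ⟨h₁, h₂⟩ := (Finset.mem_filter.1 ha).2
    obtain ⟨i, hi⟩ := Option.ne_none_iff_exists'.1 h₁
    obtain ⟨j, hj⟩ := Option.ne_none_iff_exists'.1 h₂
    simp [hf, hi, hj]
  have hcolcard : (Finset.univ.filter fun a => col (π a) = none).card =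
      (Finset.univ.filter fun a => col a = none).card :=
    Finset.card_equiv π (by simp)
  have hAk : k ≤ A.card := by
    have hcover : (Finset.univ : Finset W) ⊆ A ∪ (Finset.univ.filter fun a => row a = none) ∪
        Finset.univ.filter fun a => col (π a) = none := by
      intro a _
      simp only [hA, Finset.mem_union, Finset.mem_filter, Finset.mem_univ, true_and]
      tauto
    have h₁ := Finset.card_le_card hcover
    have h₂ := Finset.card_union_le (A ∪ Finset.univ.filter fun a => row a = none)
      (Finset.univ.filter fun a => col (π a) = none)
    have h₃ := Finset.card_union_le A (Finset.univ.filter fun a => row a = none)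
    rw [Finset.card_univ] at h₁
    omega
  obtain ⟨B, hBA, hBk⟩ := Finset.exists_subset_card_eq hAk
  have hfst : ∀ a ∈ B, ∀ b ∈ B, (f a).1 = (f b).1 → a = b := fun a ha b hb h =>
    hrow_inj a b _ (hspec a (hBA ha)).1 (h ▸ (hspec b (hBA hb)).1)
  have hsnd : ∀ a ∈ B, ∀ b ∈ B, (f a).2 = (f b).2 → a = b := fun a ha b hb h =>
    π.injective (hcol_inj _ _ _ (hspec a (hBA ha)).2 (h ▸ (hspec b (hBA hb)).2))
  have hinj : Set.InjOn f B := fun a ha b hb h => hfst a ha b hb (congrArg Prod.fst h)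
  refine ⟨B.image f, ⟨by rw [Finset.card_image_of_injOn hinj, hBk], ?_, ?_⟩, ?_⟩
  · intro p hp
    obtain ⟨a, ha, rfl⟩ := Finset.mem_image.1 hp
    exact ⟨hrow a _ (hspec a (hBA ha)).1, hcol _ _ (hspec a (hBA ha)).2⟩
  · intro p hp q hq hpq
    obtain ⟨a, ha, rfl⟩ := Finset.mem_image.1 hp
    obtain ⟨b, hb, rfl⟩ := Finset.mem_image.1 hq
    exact ⟨fun h => hpq (congrArg f (hfst a ha b hb h)),
      fun h => hpq (congrArg f (hsnd a ha b hb h))⟩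
  · rw [aval, Finset.sum_image hinj]
    calc ∑ a ∈ B, X (f a).1 (f a).2 = ∑ a ∈ B, padEntry X (row a) (col (π a)) := by
          refine Finset.sum_congr rfl fun a ha => ?_
          rw [(hspec a (hBA ha)).1, (hspec a (hBA ha)).2]
          rfl
      _ ≤ ∑ a, padEntry X (row a) (col (π a)) := by
          refine Finset.sum_le_sum_of_subset_of_nonneg (Finset.subset_univ _) fun a _ _ => ?_
          rcases hr : row a with _ | i
          · exact le_rfl
          · rcases hc : col (π a) with _ | j
            · exact le_rfl
            · exact hX i (hrow a i hr) j (hcol _ j hc)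

/-- A function on the vertices of an injective partial labelling descends to the labels. -/
theorem exists_label_function {W : Type*} (label : W → Option ℕ)
    (hinj : ∀ a b i, label a = some i → label b = some i → a = b) (g : W → ℝ) :
    ∃ f : ℕ → ℝ, ∀ a i, label a = some i → f i = g a := by
  classical
  refine ⟨fun i => if h : ∃ a, label a = some i then g h.choose else 0, fun a i ha => ?_⟩
  have h : ∃ a, label a = some i := ⟨a, ha⟩
  simp only [dif_pos h, hinj _ _ _ h.choose_spec ha]

theorem IsAssign.fst_injOn {m n k : ℕ} {S : Finset (ℕ × ℕ)} (hS : IsAssign m n k S) :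
    Set.InjOn Prod.fst (S : Set (ℕ × ℕ)) := fun p hp q hq h => by
  by_contra hpq
  exact (hS.2.2 p hp q hq hpq).1 h

theorem IsAssign.snd_injOn {m n k : ℕ} {S : Finset (ℕ × ℕ)} (hS : IsAssign m n k S) :
    Set.InjOn Prod.snd (S : Set (ℕ × ℕ)) := fun p hp q hq h => by
  by_contra hpq
  exact (hS.2.2 p hp q hq hpq).2 h

theorem IsAssign.image_fst_subset {m n k : ℕ} {S : Finset (ℕ × ℕ)} (hS : IsAssign m n k S) :
    S.image Prod.fst ⊆ Finset.range m := by
  intro i hi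
  obtain ⟨p, hp, rfl⟩ := Finset.mem_image.1 hi
  exact Finset.mem_range.2 (hS.2.1 p hp).1

theorem IsAssign.image_snd_subset {m n k : ℕ} {S : Finset (ℕ × ℕ)} (hS : IsAssign m n k S) :
    S.image Prod.snd ⊆ Finset.range n := by
  intro i hi
  obtain ⟨p, hp, rfl⟩ := Finset.mem_image.1 hi
  exact Finset.mem_range.2 (hS.2.1 p hp).2

/-- Optimal dual variables with complementary slackness for the minimum `k`-assignment
problem. -/
theorem MinAssign.exists_dual {m n k : ℕ} {S : Finset (ℕ × ℕ)} {X : ℕ → ℕ → ℝ} (hk : 0 < k)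
    (hkm : k ≤ m) (hmn : m ≤ n) (hX : ∀ i < m, ∀ j < n, 0 ≤ X i j) (h : MinAssign m n k X S) :
    ∃ (c : ℝ) (u v : ℕ → ℝ), (∀ i < m, 0 ≤ u i) ∧ (∀ j < n, 0 ≤ v j) ∧
      (∀ i < m, ∀ j < n, c - u i - v j ≤ X i j) ∧
      (∀ p ∈ S, X p.1 p.2 = c - u p.1 - v p.2) ∧
      (∀ i < m, i ∉ S.image Prod.fst → u i = 0) ∧
      (∀ j < n, j ∉ S.image Prod.snd → v j = 0) := by
  classical
  obtain ⟨hS, hmin⟩ := h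
  set Q := Finset.range m \ S.image Prod.fst with hQ
  set D := Finset.range n \ S.image Prod.snd with hD
  have hQcard : Q.card = m - k := by
    rw [hQ, Finset.card_sdiff_of_subset hS.image_fst_subset,
      Finset.card_image_of_injOn hS.fst_injOn, hS.1, Finset.card_range]
  have hDcard : D.card = n - k := by
    rw [hD, Finset.card_sdiff_of_subset hS.image_snd_subset,
      Finset.card_image_of_injOn hS.snd_injOn, hS.1, Finset.card_range]
  let row : S ⊕ (Q ⊕ D) → Option ℕ :=
    Sum.elim (fun s => some s.1.1) (Sum.elim (fun q => some q.1) fun _ => none)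
  let col : S ⊕ (Q ⊕ D) → Option ℕ :=
    Sum.elim (fun s => some s.1.2) (Sum.elim (fun _ => none) fun d => some d.1)
  have hrow : ∀ a i, row a = some i → i < m := by
    rintro (⟨s, hs⟩ | ⟨q, hq⟩ | d) i hi
    · cases hi; exact (hS.2.1 s hs).1
    · cases hi; exact Finset.mem_range.1 (Finset.mem_sdiff.1 hq).1
    · cases hi
  have hcol : ∀ a j, col a = some j → j < n := by
    rintro (⟨s, hs⟩ | q | ⟨d, hd⟩) i hi
    · cases hi; exact (hS.2.1 s hs).2
    · cases hi
    · cases hi; exact Finset.mem_range.1 (Finset.mem_sdiff.1 hd).1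
  have hrow_inj : ∀ a b i, row a = some i → row b = some i → a = b := by
    rintro (⟨s, hs⟩ | ⟨q, hq⟩ | d) (⟨s', hs'⟩ | ⟨q', hq'⟩ | d') i hi hi' <;>
      simp only [row, Sum.elim_inl, Sum.elim_inr, Option.some.injEq, reduceCtorEq] at hi hi'
    · congr; exact hS.fst_injOn hs hs' (hi.trans hi'.symm)
    · exact absurd (Finset.mem_image.2 ⟨s, hs, hi.trans hi'.symm⟩) (Finset.mem_sdiff.1 hq').2
    · exact absurd (Finset.mem_image.2 ⟨s', hs', hi'.trans hi.symm⟩) (Finset.mem_sdiff.1 hq).2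
    · congr; exact hi.trans hi'.symm
  have hcol_inj : ∀ a b i, col a = some i → col b = some i → a = b := by
    rintro (⟨s, hs⟩ | q | ⟨d, hd⟩) (⟨s', hs'⟩ | q' | ⟨d', hd'⟩) i hi hi' <;>
      simp only [col, Sum.elim_inl, Sum.elim_inr, Option.some.injEq, reduceCtorEq] at hi hi'
    · congr; exact hS.snd_injOn hs hs' (hi.trans hi'.symm)
    · exact absurd (Finset.mem_image.2 ⟨s, hs, hi.trans hi'.symm⟩) (Finset.mem_sdiff.1 hd').2
    · exact absurd (Finset.mem_image.2 ⟨s', hs', hi'.trans hi.symm⟩) (Finset.mem_sdiff.1 hd).2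
    · congr; exact hi.trans hi'.symm
  have hcard : k + (Finset.univ.filter fun a => row a = none).card +
      (Finset.univ.filter fun a => col a = none).card ≤ Fintype.card (S ⊕ (Q ⊕ D)) := by
    have h₁ : (Finset.univ.filter fun a => row a = none).card ≤ D.card := by
      rw [← Fintype.card_coe D, ← Finset.card_univ]
      refine (Finset.card_le_card (t := Finset.univ.image fun d : D => Sum.inr (Sum.inr d)) ?_).trans
        Finset.card_image_le
      rintro (s | q | d) ha
      · simp [row] at ha
      · simp [row] at ha
      · simp
    have h₂ : (Finset.univ.filter fun a => col a = none).card ≤ Q.card := by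
      rw [← Fintype.card_coe Q, ← Finset.card_univ]
      refine (Finset.card_le_card (t := Finset.univ.image fun q : Q => Sum.inr (Sum.inl q)) ?_).trans
        Finset.card_image_le
      rintro (s | q | d) ha
      · simp [col] at ha
      · simp
      · simp [col] at ha
    simp only [Fintype.card_sum, Fintype.card_coe, hS.1]
    omega
  set C : S ⊕ (Q ⊕ D) → S ⊕ (Q ⊕ D) → ℝ := fun a b => padEntry X (row a) (col b) with hC
  have hdiag : ∑ a, C a a = aval X S := by
    rw [Fintype.sum_sum_type, Fintype.sum_sum_type]
    simp only [hC, row, col, Sum.elim_inl, Sum.elim_inr, padEntry, Finset.sum_const_zero, add_zero]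
    exact Finset.sum_coe_sort S fun s => X s.1 s.2
  obtain ⟨p, hp⟩ := exists_potential (fun a b => C a b - C a a) (fun a => sub_self _) fun π => by
    obtain ⟨T, hT, hle⟩ := exists_assign_le_padEntry m n k X hX row col hrow hcol hrow_inj
      hcol_inj hcard π
    rw [Finset.sum_sub_distrib, hdiag, sub_nonneg]
    exact (hmin T hT).trans hle
  obtain ⟨R, hR⟩ := exists_label_function row hrow_inj fun a => C a a - p a
  obtain ⟨K, hK⟩ := exists_label_function col hcol_inj p
  have hrow_surj : ∀ i < m, ∃ a, row a = some i := by
    intro i hi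
    by_cases hi' : i ∈ S.image Prod.fst
    · obtain ⟨s, hs, rfl⟩ := Finset.mem_image.1 hi'
      exact ⟨Sum.inl ⟨s, hs⟩, rfl⟩
    · exact ⟨Sum.inr (Sum.inl ⟨i, Finset.mem_sdiff.2 ⟨Finset.mem_range.2 hi, hi'⟩⟩), rfl⟩
  have hcol_surj : ∀ j < n, ∃ a, col a = some j := by
    intro j hj
    by_cases hj' : j ∈ S.image Prod.snd
    · obtain ⟨s, hs, rfl⟩ := Finset.mem_image.1 hj'
      exact ⟨Sum.inl ⟨s, hs⟩, rfl⟩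
    · exact ⟨Sum.inr (Sum.inr ⟨j, Finset.mem_sdiff.2 ⟨Finset.mem_range.2 hj, hj'⟩⟩), rfl⟩
  obtain ⟨i₀, hi₀, hRmax⟩ := (Finset.range m).exists_max_image R ⟨0, by simp; omega⟩
  obtain ⟨j₀, hj₀, hKmax⟩ := (Finset.range n).exists_max_image K ⟨0, by simp; omega⟩
  rw [Finset.mem_range] at hi₀ hj₀
  refine ⟨R i₀ + K j₀, fun i => R i₀ - R i, fun j => K j₀ - K j, ?_, ?_, ?_, ?_, ?_, ?_⟩
  · exact fun i hi => sub_nonneg.2 (hRmax i (Finset.mem_range.2 hi))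
  · exact fun j hj => sub_nonneg.2 (hKmax j (Finset.mem_range.2 hj))
  · intro i hi j hj
    obtain ⟨a, ha⟩ := hrow_surj i hi
    obtain ⟨b, hb⟩ := hcol_surj j hj
    have h₁ : C a b = X i j := by simp only [hC, ha, hb, padEntry]
    have := hp a b
    simp only
    rw [hR a i ha, hK b j hb]
    linarith
  · intro s hs
    have h₁ : C (Sum.inl ⟨s, hs⟩) (Sum.inl ⟨s, hs⟩) = X s.1 s.2 := rfl
    simp only
    rw [hR (Sum.inl ⟨s, hs⟩) s.1 rfl, hK (Sum.inl ⟨s, hs⟩) s.2 rfl, h₁]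
    ring
  · intro i hi hi'
    obtain ⟨a, ha⟩ := hrow_surj i₀ hi₀
    let b : S ⊕ (Q ⊕ D) :=
      Sum.inr (Sum.inl ⟨i, Finset.mem_sdiff.2 ⟨Finset.mem_range.2 hi, hi'⟩⟩)
    have h₁ : C a b = 0 := padEntry_none_right X _
    have h₂ : C b b = 0 := padEntry_none_right X _
    have h₃ := hp a b
    have h₄ := hRmax i (Finset.mem_range.2 hi)
    have h₅ := hR b i rfl
    have h₆ := hR a i₀ ha
    linarith
  · intro j hj hj'
    obtain ⟨b, hb⟩ := hcol_surj j₀ hj₀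
    let a : S ⊕ (Q ⊕ D) :=
      Sum.inr (Sum.inr ⟨j, Finset.mem_sdiff.2 ⟨Finset.mem_range.2 hj, hj'⟩⟩)
    have h₁ : C a b = 0 := rfl
    have h₂ : C a a = 0 := rfl
    have h₃ := hp a b
    have h₄ := hKmax j (Finset.mem_range.2 hj)
    have h₅ := hK a j rfl
    have h₆ := hK b j₀ hb
    linarith

theorem aval_V (I J : Finset ℕ) (T : Finset (ℕ × ℕ)) :
    aval (V I J) T = T.card - ((T.filter fun p => p.1 ∈ I ∨ p.2 ∈ J).card : ℝ) := by
  rw [eq_sub_iff_add_eq, aval, Finset.card_filter, Finset.card_eq_sum_ones]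
  push_cast
  rw [← Finset.sum_add_distrib]
  refine Finset.sum_congr rfl fun p _ => ?_
  rw [V]
  split_ifs <;> norm_num

theorem IsAssign.le_aval_V {m n k : ℕ} {T : Finset (ℕ × ℕ)} (hT : IsAssign m n k T)
    (I J : Finset ℕ) : (k : ℝ) - I.card - J.card ≤ aval (V I J) T := by
  have h : (T.filter fun p => p.1 ∈ I ∨ p.2 ∈ J).card ≤ I.card + J.card := by
    rw [Finset.filter_or]
    refine (Finset.card_union_le _ _).trans (add_le_add ?_ ?_)
    · refine Finset.card_le_card_of_injOn Prod.fst (fun p hp => (Finset.mem_filter.1 hp).2) ?_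
      exact hT.fst_injOn.mono fun p hp => (Finset.mem_filter.1 hp).1
    · refine Finset.card_le_card_of_injOn Prod.snd (fun p hp => (Finset.mem_filter.1 hp).2) ?_
      exact hT.snd_injOn.mono fun p hp => (Finset.mem_filter.1 hp).1
  have h' : ((T.filter fun p => p.1 ∈ I ∨ p.2 ∈ J).card : ℝ) ≤ I.card + J.card := by
    exact_mod_cast h
  rw [aval_V, hT.1]
  linarith

/-- If `I` and `J` are covered by the assignment and no position meets both, the lower bound
`k - |I| - |J|` is attained. -/
theorem IsAssign.aval_V_eq {m n k : ℕ} {S : Finset (ℕ × ℕ)} (hS : IsAssign m n k S)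
    {I J : Finset ℕ} (hI : I ⊆ S.image Prod.fst) (hJ : J ⊆ S.image Prod.snd)
    (hIJ : ∀ p ∈ S, p.1 ∈ I → p.2 ∉ J) :
    aval (V I J) S = (k : ℝ) - I.card - J.card := by
  have h₁ : I.card ≤ (S.filter fun p => p.1 ∈ I).card := by
    refine (Finset.card_le_card fun i hi => ?_).trans (Finset.card_image_le (f := Prod.fst))
    obtain ⟨p, hp, rfl⟩ := Finset.mem_image.1 (hI hi)
    exact Finset.mem_image_of_mem _ (Finset.mem_filter.2 ⟨hp, hi⟩)
  have h₂ : J.card ≤ (S.filter fun p => p.2 ∈ J).card := by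
    refine (Finset.card_le_card fun j hj => ?_).trans (Finset.card_image_le (f := Prod.snd))
    obtain ⟨p, hp, rfl⟩ := Finset.mem_image.1 (hJ hj)
    exact Finset.mem_image_of_mem _ (Finset.mem_filter.2 ⟨hp, hj⟩)
  have h₃ : (S.filter fun p => p.1 ∈ I ∨ p.2 ∈ J).card =
      (S.filter fun p => p.1 ∈ I).card + (S.filter fun p => p.2 ∈ J).card := by
    rw [Finset.filter_or, Finset.card_union_of_disjoint]
    exact Finset.disjoint_filter.2 hIJ
  have h₄ : ((I.card + J.card : ℕ) : ℝ) ≤ (S.filter fun p => p.1 ∈ I ∨ p.2 ∈ J).card := by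
    exact_mod_cast h₃ ▸ add_le_add h₁ h₂
  refine le_antisymm ?_ (hS.le_aval_V I J)
  rw [aval_V, hS.1]
  push_cast at h₄
  linarith

/-- The layer-cake decomposition of the matrix `max (c - u i - v j) 0` into matrices `V I J`. -/
theorem exists_V_decomposition (m n : ℕ) (c : ℝ) (u v : ℕ → ℝ) (hu : ∀ i < m, 0 ≤ u i)
    (hv : ∀ j < n, 0 ≤ v j) :
    ∃ β : Finset ℕ → Finset ℕ → ℝ, (∀ I J, 0 ≤ β I J) ∧
      (∀ I J, β I J ≠ 0 → ∃ t, 0 ≤ t ∧ t ≤ c ∧ I = (Finset.range m).filter (fun i => t < u i) ∧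
        J = (Finset.range n).filter (fun j => c - t < v j)) ∧
      ∀ i < m, ∀ j < n, ∑ I ∈ (Finset.range m).powerset, ∑ J ∈ (Finset.range n).powerset,
        β I J * V I J i j = max (c - u i - v j) 0 := by
  classical
  set F : ℝ → Finset ℕ := fun t => (Finset.range m).filter (fun i => t < u i) with hF
  set G : ℝ → Finset ℕ := fun t => (Finset.range n).filter (fun j => c - t < v j) with hG
  set L : Finset ℕ × Finset ℕ → Set ℝ :=
    fun q => {t | t ∈ Set.Icc 0 c ∧ q.1 = F t ∧ q.2 = G t} with hL
  have hLmeas : ∀ q, MeasurableSet (L q) := by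
    intro q
    have h₁ : MeasurableSet {t | q.1 = F t} := by
      simp only [hF, Finset.ext_iff, Set.ofPred_forall, Finset.mem_filter]
      refine MeasurableSet.iInter fun i => ?_
      measurability
    have h₂ : MeasurableSet {t | q.2 = G t} := by
      simp only [hG, Finset.ext_iff, Set.ofPred_forall, Finset.mem_filter]
      refine MeasurableSet.iInter fun i => ?_
      measurability
    exact measurableSet_Icc.inter (h₁.inter h₂)
  refine ⟨fun I J => MeasureTheory.volume.real (L (I, J)),
    fun I J => MeasureTheory.measureReal_nonneg, ?_, ?_⟩
  · intro I J hIJ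
    obtain ⟨t, ht, hI, hJ⟩ : (L (I, J)).Nonempty := by
      by_contra h
      rw [Set.not_nonempty_iff_eq_empty] at h
      simp [h] at hIJ
    exact ⟨t, ht.1, ht.2, hI, hJ⟩
  · intro i hi j hj
    rw [← Finset.sum_product']
    have hV : ∀ q : Finset ℕ × Finset ℕ, MeasureTheory.volume.real (L (q.1, q.2)) * V q.1 q.2 i j =
        if i ∉ q.1 ∧ j ∉ q.2 then MeasureTheory.volume.real (L q) else 0 := by
      intro q
      rw [V]
      by_cases h : i ∈ q.1 ∨ j ∈ q.2
      · rw [if_pos h, if_neg (by tauto), mul_zero]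
      · rw [if_neg h, if_pos (by tauto), mul_one]
    simp only [hV]
    rw [← Finset.sum_filter, ← MeasureTheory.measureReal_biUnion_finset _ (fun q _ => hLmeas q)
      fun q _ => ne_top_of_le_ne_top measure_Icc_lt_top.ne
        (MeasureTheory.measure_mono fun t ht => ht.1)]
    · have hUnion : ⋃ q ∈ ((Finset.range m).powerset ×ˢ (Finset.range n).powerset).filter
          (fun q => i ∉ q.1 ∧ j ∉ q.2), L q = Set.Icc (u i) (c - v j) := by
        ext t
        simp only [Set.mem_iUnion, Finset.mem_filter, exists_prop, hL, Set.mem_ofPred_eq,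
          Set.mem_Icc, Finset.mem_product, Finset.mem_powerset]
        constructor
        · rintro ⟨⟨I, J⟩, ⟨-, hi', hj'⟩, -, rfl, rfl⟩
          simp only [hF, hG, Finset.mem_filter, Finset.mem_range, hi, hj, true_and, not_lt]
            at hi' hj'
          exact ⟨hi', by linarith⟩
        · rintro ⟨h₁, h₂⟩
          have := hu i hi
          have := hv j hj
          refine ⟨(F t, G t), ⟨⟨Finset.filter_subset _ _, Finset.filter_subset _ _⟩, ?_, ?_⟩,
            ⟨by linarith, by linarith⟩, rfl, rfl⟩
          · simp only [hF, Finset.mem_filter, not_and, not_lt]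
            exact fun _ => h₁
          · simp only [hG, Finset.mem_filter, not_and, not_lt]
            exact fun _ => by linarith
      rw [hUnion, Real.volume_real_Icc]
      congr 1
      ring
    · intro q _ q' _ hqq'
      refine Set.disjoint_left.2 fun t ht ht' => hqq' ?_
      exact Prod.ext (ht.2.1.trans ht'.2.1.symm) (ht.2.2.trans ht'.2.2.symm)

/-- Theorem 1: every nonnegative matrix whose minimum `k`-assignment is (the fixed
assignment) `S₀` is a nonnegative linear combination of the matrices `e_{ij}` with
`(i,j) ∉ S₀` and the matrices `V I J` with `|I| + |J| < k` whose minimum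
`k`-assignment is also `S₀`. -/
theorem cone_generators (m n k : ℕ) (hk : 0 < k) (hkm : k ≤ m) (hmn : m ≤ n)
    (S₀ : Finset (ℕ × ℕ)) (hS₀ : IsAssign m n k S₀)
    (X : ℕ → ℕ → ℝ) (hX : ∀ i < m, ∀ j < n, 0 ≤ X i j)
    (hXmin : MinAssign m n k X S₀) :
    ∃ (α : ℕ → ℕ → ℝ) (β : Finset ℕ → Finset ℕ → ℝ),
      (∀ i j, 0 ≤ α i j) ∧
      (∀ p ∈ S₀, α p.1 p.2 = 0) ∧
      (∀ I J, 0 ≤ β I J) ∧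
      (∀ I J, β I J ≠ 0 →
        I ⊆ Finset.range m ∧ J ⊆ Finset.range n ∧ I.card + J.card < k ∧
        MinAssign m n k (V I J) S₀) ∧
      (∀ i < m, ∀ j < n,
        X i j = α i j +
          ∑ I ∈ (Finset.range m).powerset, ∑ J ∈ (Finset.range n).powerset,
            β I J * V I J i j) := by
  classical
  obtain ⟨c, u, v, hu, hv, hle, htight, hu₀, hv₀⟩ := hXmin.exists_dual hk hkm hmn hX
  obtain ⟨β, hβ, hβV, hsum⟩ := exists_V_decomposition m n c u v hu hv
  have hval : ∀ I J, β I J ≠ 0 → I ⊆ Finset.range m ∧ J ⊆ Finset.range n ∧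
      aval (V I J) S₀ = (k : ℝ) - I.card - J.card := by
    intro I J hIJ
    obtain ⟨t, ht₀, htc, rfl, rfl⟩ := hβV I J hIJ
    refine ⟨Finset.filter_subset _ _, Finset.filter_subset _ _, hS₀.aval_V_eq ?_ ?_ ?_⟩
    · intro i hi
      obtain ⟨him, hti⟩ := Finset.mem_filter.1 hi
      by_contra h
      linarith [hu₀ i (Finset.mem_range.1 him) h]
    · intro j hj
      obtain ⟨hjn, htj⟩ := Finset.mem_filter.1 hj
      by_contra h
      linarith [hv₀ j (Finset.mem_range.1 hjn) h]
    · intro p hp hp₁ hp₂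
      have h₁ := (Finset.mem_filter.1 hp₁).2
      have h₂ := (Finset.mem_filter.1 hp₂).2
      have h₃ := htight p hp
      linarith [hX p.1 (hS₀.2.1 p hp).1 p.2 (hS₀.2.1 p hp).2]
  set β' : Finset ℕ → Finset ℕ → ℝ := fun I J => if I.card + J.card < k then β I J else 0 with hβ'
  have hV_nonneg : ∀ I J i j, 0 ≤ V I J i j := fun I J i j => by
    rw [V]; split_ifs <;> norm_num
  have hβ'_le : ∀ I J i j, β' I J * V I J i j ≤ β I J * V I J i j := fun I J i j => by
    refine mul_le_mul_of_nonneg_right ?_ (hV_nonneg I J i j)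
    simp only [hβ']
    split_ifs
    exacts [le_rfl, hβ I J]
  have hβ'_eq : ∀ p ∈ S₀, ∀ I J, β' I J * V I J p.1 p.2 = β I J * V I J p.1 p.2 := by
    intro p hp I J
    simp only [hβ']
    split_ifs with hcard
    · rfl
    · by_cases h : β I J = 0
      · rw [h]
      · have h₁ : aval (V I J) S₀ ≤ 0 := by
          rw [(hval I J h).2.2]
          have : (k : ℝ) ≤ I.card + J.card := by exact_mod_cast not_lt.1 hcard
          linarith
        have h₂ := Finset.single_le_sum (f := fun p : ℕ × ℕ => V I J p.1 p.2)
          (fun q _ => hV_nonneg I J q.1 q.2) hp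
        have h₃ : V I J p.1 p.2 = 0 := le_antisymm (h₂.trans h₁) (hV_nonneg I J p.1 p.2)
        rw [h₃, mul_zero, mul_zero]
  set Y : ℕ → ℕ → ℝ := fun i j => ∑ I ∈ (Finset.range m).powerset,
    ∑ J ∈ (Finset.range n).powerset, β' I J * V I J i j with hY
  refine ⟨fun i j => if i < m ∧ j < n then X i j - Y i j else 0, β', ?_, ?_, ?_, ?_, ?_⟩
  · intro i j
    simp only
    split_ifs with hij
    · have h₁ : Y i j ≤ max (c - u i - v j) 0 := by
        rw [← hsum i hij.1 j hij.2]
        exact Finset.sum_le_sum fun I _ => Finset.sum_le_sum fun J _ => hβ'_le I J i j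
      have h₂ := max_le (hle i hij.1 j hij.2) (hX i hij.1 j hij.2)
      linarith
    · exact le_rfl
  · intro p hp
    obtain ⟨hpm, hpn⟩ := hS₀.2.1 p hp
    have h₁ : Y p.1 p.2 = max (c - u p.1 - v p.2) 0 := by
      rw [← hsum p.1 hpm p.2 hpn]
      exact Finset.sum_congr rfl fun I _ => Finset.sum_congr rfl fun J _ => hβ'_eq p hp I J
    simp only
    rw [if_pos ⟨hpm, hpn⟩, h₁, ← htight p hp, max_eq_left (hX p.1 hpm p.2 hpn), sub_self]
  · intro I J
    simp only [hβ']
    split_ifs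
    exacts [hβ I J, le_rfl]
  · intro I J hIJ
    have hcard : I.card + J.card < k := by
      by_contra h
      simp [hβ', h] at hIJ
    have hne : β I J ≠ 0 := by simpa [hβ', hcard] using hIJ
    obtain ⟨hI, hJ, hIJval⟩ := hval I J hne
    exact ⟨hI, hJ, hcard, hS₀, fun T hT => hIJval ▸ hT.le_aval_V I J⟩
  · intro i hi j hj
    simp only
    rw [if_pos ⟨hi, hj⟩]
    ring
end

section
/- Fix k ≤ m ≤ n. There exist a polynomial P in the mn variables a_{ij} with real coefficients and nonnegative integers n_{IJ} (indexed by pairs of subsets I ⊊ {1,…,m}, J ⊊ {1,…,n} with |I| + |J| < k) such that for every m×n matrix A with all entries positive, the expected value E_k(A) of the minimum k-assignment of a random exponential matrix with rate matrix A equals P(A) divided by the product over such pairs (I,J) of (∑_{i∉I, j∉J} a_{ij})^{n_{IJ}}. In particular, E_k(A) is a rational function of the entries of A whose denominator is a product of sums of all entries of submatrices of A obtained by omitting i rows and j columns with i + j < k. -/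
open MeasureTheory

/-- A `k`-assignment of an `m × n` matrix: a set of `k` positions,
no two in the same row or column. -/
def IsAssignF (m n k : ℕ) (S : Finset (Fin m × Fin n)) : Prop :=
  S.card = k ∧ ∀ p ∈ S, ∀ q ∈ S, p ≠ q → p.1 ≠ q.1 ∧ p.2 ≠ q.2

/-- The value `min_k(X)` of a minimum `k`-assignment of the matrix `x`. -/
noncomputable def minAssign (m n k : ℕ) (x : Fin m × Fin n → ℝ) : ℝ :=
  sInf {v | ∃ S : Finset (Fin m × Fin n), IsAssignF m n k S ∧ v = ∑ p ∈ S, x p}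

/-- The law of a random `m × n` matrix whose entries are independent and exponentially
distributed, the entry at `p` having rate `A p.1 p.2`: the measure on `(Fin m × Fin n) → ℝ`
with the product exponential density with respect to Lebesgue measure. -/
noncomputable def rateMatrixMeasure (m n : ℕ) (A : Fin m → Fin n → ℝ) :
    Measure ((Fin m × Fin n) → ℝ) :=
  volume.withDensity fun x => ENNReal.ofReal
    (∏ p : Fin m × Fin n,
      if 0 ≤ x p then A p.1 p.2 * Real.exp (-(A p.1 p.2 * x p)) else 0)

/-- `E_k(A)`: the expected value of the minimum `k`-assignment of a random exponential
matrix with rate matrix `A`. -/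
noncomputable def Ek (m n k : ℕ) (A : Fin m → Fin n → ℝ) : ℝ :=
  ∫ x, minAssign m n k x ∂(rateMatrixMeasure m n A)

section LP
variable {ι V : Type*} [Fintype ι] [Fintype V]

/-- A finite set of indices whose vectors form a basis of the ambient space. -/
abbrev VBasis (w : V → ι → ℝ) : Type _ :=
  {B : Finset V // LinearIndependent ℝ (fun v : B => w v) ∧
    ⊤ ≤ Submodule.span ℝ (Set.range fun v : B => w v)}

noncomputable instance (w : V → ι → ℝ) : Fintype (VBasis w) := by
  classical
  infer_instance

/-- The basis of the ambient space given by a `VBasis`. -/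
noncomputable def VBasis.basis {w : V → ι → ℝ} (B : VBasis w) : Module.Basis B.1 ℝ (ι → ℝ) :=
  Module.Basis.mk B.2.1 B.2.2

lemma VBasis.basis_apply {w : V → ι → ℝ} (B : VBasis w) (b : B.1) : B.basis b = w b := by
  simp [VBasis.basis]

/-- The reduced cost of `v` with respect to the basis `B`, as a linear function of the costs. -/
noncomputable def redCost {w : V → ι → ℝ} (B : VBasis w) (v : V) : (V → ℝ) →ₗ[ℝ] ℝ :=
  ∑ b : B.1, B.basis.equivFun (w v) b • LinearMap.proj (b : V) - LinearMap.proj v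

lemma redCost_apply {w : V → ι → ℝ} (B : VBasis w) (v : V) (c : V → ℝ) :
    redCost B v c = ∑ b : B.1, B.basis.equivFun (w v) b * c b - c v := by
  simp [redCost, LinearMap.sum_apply]

lemma redCost_ne_zero {w : V → ι → ℝ} (B : VBasis w) {v : V} (hv : v ∉ B.1) :
    redCost B v ≠ 0 := by
  classical
  intro h
  have h1 := LinearMap.congr_fun h (Pi.single v 1)
  rw [redCost_apply] at h1
  have : ∑ b : B.1, B.basis.equivFun (w v) b * (Pi.single v 1 : V → ℝ) b = 0 := by
    apply Finset.sum_eq_zero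
    intro b _
    have hb : (b : V) ≠ v := fun hb => hv (hb ▸ b.2)
    simp [hb]
  rw [this] at h1
  simp at h1

lemma redCost_of_mem {w : V → ι → ℝ} (B : VBasis w) (c : V → ℝ) (b : B.1) :
    redCost B b c = 0 := by
  classical
  rw [redCost_apply, ← B.basis_apply b]
  simp only [Module.Basis.equivFun_self]
  simp

/-- The gap between the value of the basis `B` at a point and the value of any representation of
that point is the sum of the reduced costs. -/
lemma sum_mul_redCost {w : V → ι → ℝ} (B : VBasis w) (c s : V → ℝ) :
    ∑ v, s v * redCost B v c =
      ∑ b : B.1, B.basis.equivFun (∑ v, s v • w v) b * c b - ∑ v, s v * c v := by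
  simp only [redCost_apply, mul_sub, Finset.sum_sub_distrib, Finset.mul_sum, map_sum, map_smul,
    Finset.sum_apply, Pi.smul_apply, smul_eq_mul, Finset.sum_mul]
  rw [Finset.sum_comm]
  simp only [mul_assoc]

/-- Costs can be perturbed so that no reduced cost outside the basis vanishes, and no dual feasible
basis is created. -/
lemma exists_generic_cost (w : V → ι → ℝ) (c : V → ℝ) :
    ∃ c' : V → ℝ, (∀ (B : VBasis w) (v : V), v ∉ B.1 → redCost B v c' ≠ 0) ∧
      ∀ (B : VBasis w) (v : V), 0 ≤ redCost B v c' → 0 ≤ redCost B v c := by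
  have hae : ∀ᵐ c' : V → ℝ, ∀ (B : VBasis w) (v : V), v ∉ B.1 → redCost B v c' ≠ 0 := by
    rw [ae_all_iff]; intro B
    rw [ae_all_iff]; intro v
    by_cases hv : v ∈ B.1
    · simp [hv]
    · have hk : LinearMap.ker (redCost B v) ≠ ⊤ := fun h =>
        redCost_ne_zero B hv (LinearMap.ker_eq_top.1 h)
      have := Measure.addHaar_submodule (volume : Measure (V → ℝ)) _ hk
      rw [measure_eq_zero_iff_ae_notMem] at this
      filter_upwards [this] with x hx _ h
      exact hx h
  have hopen : ∀ᶠ c' in nhds c, ∀ (B : VBasis w) (v : V),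
      0 ≤ redCost B v c' → 0 ≤ redCost B v c := by
    rw [Filter.eventually_all]; intro B
    rw [Filter.eventually_all]; intro v
    by_cases h : 0 ≤ redCost B v c
    · simp [h]
    · push Not at h
      have hc := (LinearMap.continuous_of_finiteDimensional (redCost B v)).tendsto c
      filter_upwards [hc.eventually (gt_mem_nhds h)] with x hx h'
      exact absurd h' (not_le.2 hx)
  have hd := Measure.dense_of_ae hae
  obtain ⟨c', h1, h2⟩ := (mem_closure_iff_nhds.1 (hd c)) _ hopen
  exact ⟨c', h2, h1⟩

/-- A point is generic for `w` if it lies in no proper subspace spanned by vectors of `w`. -/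
def GenericFor (w : V → ι → ℝ) (x : ι → ℝ) : Prop :=
  ∀ S : Finset V, x ∈ Submodule.span ℝ (Set.range fun v : S => w v) →
    Submodule.span ℝ (Set.range fun v : S => w v) = ⊤

lemma ae_genericFor (w : V → ι → ℝ) : ∀ᵐ x, GenericFor w x := by
  unfold GenericFor
  rw [ae_all_iff]; intro S
  by_cases h : Submodule.span ℝ (Set.range fun v : S => w v) = ⊤
  · simp [h]
  · have := Measure.addHaar_submodule (volume : Measure (ι → ℝ)) _ h
    rw [measure_eq_zero_iff_ae_notMem] at this
    filter_upwards [this] with x hx h'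
    exact absurd h' hx

lemma sum_smul_mem_span (w : V → ι → ℝ) (S : Finset V) (t : V → ℝ) (ht : ∀ v ∉ S, t v = 0) :
    ∑ v, t v • w v ∈ Submodule.span ℝ (Set.range fun v : S => w v) := by
  refine Submodule.sum_mem _ fun v _ => ?_
  by_cases hv : v ∈ S
  · exact Submodule.smul_mem _ _ (Submodule.subset_span ⟨⟨v, hv⟩, rfl⟩)
  · simp [ht v hv]

lemma exists_pos_forall_nonneg_add_mul (t g : V → ℝ) (ht : ∀ v, 0 ≤ t v)
    (hg : ∀ v, t v = 0 → 0 ≤ g v) : ∃ δ : ℝ, 0 < δ ∧ ∀ v, 0 ≤ t v + δ * g v := by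
  have : ∀ᶠ δ in nhdsWithin (0 : ℝ) (Set.Ioi 0), ∀ v, 0 ≤ t v + δ * g v := by
    rw [Filter.eventually_all]; intro v
    rcases (ht v).eq_or_lt with h | h
    · filter_upwards [self_mem_nhdsWithin] with δ hδ
      have := mul_nonneg (le_of_lt (Set.mem_Ioi.1 hδ)) (hg v h.symm)
      linarith
    · have hc : Filter.Tendsto (fun δ : ℝ => t v + δ * g v) (nhdsWithin 0 (Set.Ioi 0))
          (nhds (t v + 0 * g v)) :=
        (Continuous.tendsto (by fun_prop) _).mono_left nhdsWithin_le_nhds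
      rw [zero_mul, add_zero] at hc
      filter_upwards [hc.eventually (lt_mem_nhds h)] with δ hδ
      exact hδ.le
  obtain ⟨δ, h1, h2⟩ := (this.and self_mem_nhdsWithin).exists
  exact ⟨δ, h2, h1⟩

/-- The nonnegative representations of `x` in terms of `w`. -/
def nonnegReps (w : V → ι → ℝ) (x : ι → ℝ) : Set (V → ℝ) :=
  {t | (∀ v, 0 ≤ t v) ∧ ∑ v, t v • w v = x}

lemma isCompact_nonnegReps (w : V → ι → ℝ) (x : ι → ℝ) (hw : ∀ v i, 0 ≤ w v i)
    (hw0 : ∀ v, ∃ i, 0 < w v i) : IsCompact (nonnegReps w x) := by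
  choose p hp using hw0
  refine IsCompact.of_isClosed_subset
    (isCompact_univ_pi fun v : V => isCompact_Icc (a := (0 : ℝ)) (b := x (p v) / w v (p v))) ?_ ?_
  · have h1 : IsClosed {t : V → ℝ | ∀ v, 0 ≤ t v} := by
      simp only [Set.ofPred_forall]
      exact isClosed_iInter fun v => isClosed_le continuous_const (continuous_apply v)
    have h2 : IsClosed {t : V → ℝ | ∑ v, t v • w v = x} :=
      isClosed_eq (by fun_prop) continuous_const
    exact h1.inter h2
  · rintro t ⟨h0, hx⟩ v -
    refine ⟨h0 v, ?_⟩
    rw [le_div_iff₀ (hp v), ← hx, Finset.sum_apply]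
    exact Finset.single_le_sum (f := fun u => (t u • w u) (p v))
      (fun u _ => mul_nonneg (h0 u) (hw u _)) (Finset.mem_univ v)

lemma exists_optimal_basis (w : V → ι → ℝ) (hw : ∀ v i, 0 ≤ w v i)
    (hw0 : ∀ v, ∃ i, 0 < w v i) (c : V → ℝ) (x : ι → ℝ) (hx : GenericFor w x)
    (hne : (nonnegReps w x).Nonempty) :
    ∃ B : VBasis w, (∀ v, 0 ≤ redCost B v c) ∧ ∀ b, 0 ≤ B.basis.equivFun x b := by
  classical
  have hK := isCompact_nonnegReps w x hw hw0
  have hcont : Continuous fun t : V → ℝ => ∑ v, t v * c v := by fun_prop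
  obtain ⟨t₀, ht₀, hmax⟩ := hK.exists_isMaxOn hne hcont.continuousOn
  let F : Set (V → ℝ) := nonnegReps w x ∩ {t | ∑ v, t v * c v = ∑ v, t₀ v * c v}
  have hF : IsCompact F := hK.inter_right (isClosed_eq hcont continuous_const)
  obtain ⟨t, htF, htext⟩ := hF.extremePoints_nonempty ⟨t₀, ht₀, rfl⟩
  obtain ⟨⟨ht0, htx⟩, htc⟩ := htF
  have htc' : ∑ v, t v * c v = ∑ v, t₀ v * c v := htc
  have hopt : ∀ s ∈ nonnegReps w x, ∑ v, s v * c v ≤ ∑ v, t v * c v := by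
    intro s hs
    rw [htc']
    exact hmax hs
  have hmove : ∀ g : V → ℝ, ∑ v, g v • w v = 0 → (∀ v, t v = 0 → 0 ≤ g v) →
      ∃ δ : ℝ, 0 < δ ∧ t + δ • g ∈ nonnegReps w x := by
    intro g hg hg0
    obtain ⟨δ, hδ, h⟩ := exists_pos_forall_nonneg_add_mul t g ht0 hg0
    refine ⟨δ, hδ, h, ?_⟩
    simp only [Pi.add_apply, Pi.smul_apply, smul_eq_mul, add_smul, mul_smul,
      Finset.sum_add_distrib, ← Finset.smul_sum, hg, htx, smul_zero, add_zero]
  have hval : ∀ (g : V → ℝ) (δ : ℝ), ∑ v, (t + δ • g) v * c v =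
      ∑ v, t v * c v + δ * ∑ v, g v * c v := by
    intro g δ
    simp only [Pi.add_apply, Pi.smul_apply, smul_eq_mul, add_mul, Finset.sum_add_distrib,
      Finset.mul_sum, mul_assoc]
  have hdir : ∀ g : V → ℝ, ∑ v, g v • w v = 0 → (∀ v, t v = 0 → 0 ≤ g v) →
      ∑ v, g v * c v ≤ 0 := by
    intro g hg hg0
    obtain ⟨δ, hδ, h⟩ := hmove g hg hg0
    have := hopt _ h
    rw [hval] at this
    by_contra hcon
    push Not at hcon
    have := mul_pos hδ hcon
    linarith
  let S : Finset V := Finset.univ.filter fun v => t v ≠ 0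
  have hS : ∀ v, v ∉ S ↔ t v = 0 := by intro v; simp [S]
  have hli : LinearIndependent ℝ (fun v : S => w v) := by
    rw [Fintype.linearIndependent_iff]
    intro g₀ hg₀ i
    let g : V → ℝ := fun v => if h : v ∈ S then g₀ ⟨v, h⟩ else 0
    have hgS : ∀ v, t v = 0 → g v = 0 := by
      intro v hv
      simp [g, (hS v).2 hv]
    have hg : ∑ v, g v • w v = 0 := by
      rw [← hg₀, ← Finset.sum_subset (Finset.subset_univ S)
        (fun v _ hv => by simp [g, hv]), ← Finset.sum_coe_sort S]
      exact Finset.sum_congr rfl fun v _ => by simp [g]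
    have hng : ∑ v, (-g) v • w v = 0 := by simp [Finset.sum_neg_distrib, hg]
    obtain ⟨δ₁, hδ₁, h1⟩ := hmove g hg fun v hv => (hgS v hv).ge
    obtain ⟨δ₂, hδ₂, h2⟩ := hmove (-g) hng fun v hv => by simp [hgS v hv]
    have hgc : ∑ v, g v * c v = 0 := by
      have a1 := hdir g hg fun v hv => (hgS v hv).ge
      have a2 := hdir (-g) hng fun v hv => by simp [hgS v hv]
      simp only [Pi.neg_apply, neg_mul, Finset.sum_neg_distrib] at a2
      linarith
    have hngc : ∑ v, (-g) v * c v = 0 := by simp [Finset.sum_neg_distrib, hgc]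
    have f1 : t + δ₁ • g ∈ F := ⟨h1, (hval g δ₁).trans (by rw [hgc, mul_zero, add_zero, htc'])⟩
    have f2 : t + δ₂ • (-g) ∈ F := ⟨h2, (hval (-g) δ₂).trans (by rw [hngc, mul_zero, add_zero, htc'])⟩
    have hseg : t ∈ openSegment ℝ (t + δ₁ • g) (t + δ₂ • (-g)) := by
      refine ⟨δ₂ / (δ₁ + δ₂), δ₁ / (δ₁ + δ₂), by positivity, by positivity, by field_simp; ring, ?_⟩
      ext v
      simp only [Pi.add_apply, Pi.smul_apply, smul_eq_mul, Pi.neg_apply]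
      field_simp
      ring
    have := htext f1 f2 hseg
    have h3 := congr_fun this i
    simp only [Pi.add_apply, Pi.smul_apply, smul_eq_mul, add_eq_left, mul_eq_zero] at h3
    rcases h3 with h3 | h3
    · exact absurd h3 hδ₁.ne'
    · simpa [g] using h3
  have hspan : Submodule.span ℝ (Set.range fun v : S => w v) = ⊤ := by
    apply hx
    rw [← htx]
    exact sum_smul_mem_span w S t fun v hv => (hS v).1 hv
  let B : VBasis w := ⟨S, hli, hspan.ge⟩
  refine ⟨B, fun v => ?_, fun b => ?_⟩
  · by_cases hv : v ∈ S
    · exact (redCost_of_mem B c ⟨v, hv⟩).ge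
    · let r : V → ℝ := fun u => if h : u ∈ S then B.basis.equivFun (w v) ⟨u, h⟩ else 0
      have hr : ∀ f : V → ℝ, ∑ u, r u * f u = ∑ b : S, B.basis.equivFun (w v) b * f b := by
        intro f
        rw [← Finset.sum_subset (Finset.subset_univ S)
          (fun v _ hv => by simp [r, hv]), ← Finset.sum_coe_sort S]
        exact Finset.sum_congr rfl fun v _ => by simp [r]
      have hrw : ∑ u, r u • w u = w v := by
        ext i
        have h1 := congr_fun (B.basis.sum_equivFun (w v)) i
        simp only [Finset.sum_apply, Pi.smul_apply, smul_eq_mul, VBasis.basis_apply] at h1 ⊢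
        rw [hr (fun u => w u i)]
        exact h1
      have := hdir (Pi.single v 1 - r) (by
        simp only [Pi.sub_apply, sub_smul, Finset.sum_sub_distrib, hrw]
        rw [Finset.sum_eq_single v (by intro b _ hb; simp [hb]) (by simp)]
        simp) (by
        intro u hu
        have : r u = 0 := by simp [r, (hS u).2 hu]
        rw [Pi.sub_apply, this, sub_zero]
        by_cases h : u = v
        · subst h; simp
        · simp [h])
      simp only [Pi.sub_apply, sub_mul, Finset.sum_sub_distrib, hr] at this
      rw [Finset.sum_eq_single v (by intro b _ hb; simp [hb]) (by simp)] at this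
      rw [redCost_apply]
      simp only [Pi.single_eq_same, one_mul] at this
      linarith
  · have : x = ∑ b : S, t b • B.basis b := by
      simp only [VBasis.basis_apply]
      rw [Finset.sum_coe_sort S (fun b => t b • w b), ← htx]
      exact (Finset.sum_subset (Finset.subset_univ S)
        (fun v _ hv => by simp [(hS v).1 hv])).symm
    have h2 : B.basis.equivFun x = fun b : S => t b := by
      conv_lhs => rw [this]
      rw [← Module.Basis.equivFun_symm_apply]
      exact LinearEquiv.apply_symm_apply _ _
    rw [h2]
    exact ht0 b

lemma sum_extend (B : Finset V) (g : B → ℝ) {M : Type*} [AddCommMonoid M] [Module ℝ M]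
    (f : V → M) [DecidableEq V] :
    ∑ v, (if h : v ∈ B then g ⟨v, h⟩ else 0) • f v = ∑ b : B, g b • f b := by
  rw [← Finset.sum_subset (Finset.subset_univ B)
    (fun v _ hv => by simp [hv]), ← Finset.sum_coe_sort B]
  exact Finset.sum_congr rfl fun v _ => by simp

lemma equivFun_pos_of_genericFor {w : V → ι → ℝ} (B : VBasis w) {x : ι → ℝ}
    (hx : GenericFor w x) (h0 : ∀ b, 0 ≤ B.basis.equivFun x b) (b : B.1) :
    0 < B.basis.equivFun x b := by
  classical
  refine (h0 b).lt_of_ne fun hb => ?_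
  have hmem : x ∈ Submodule.span ℝ (Set.range fun v : (B.1.erase b : Finset V) => w v) := by
    have h1 := sum_extend B.1 (B.basis.equivFun x) w
    have h2 := B.basis.sum_equivFun x
    simp only [VBasis.basis_apply] at h2
    rw [h2] at h1
    rw [← h1]
    apply sum_smul_mem_span
    intro v hv
    by_cases hvB : v ∈ B.1
    · have : v = b := by
        by_contra hne
        exact hv (Finset.mem_erase.2 ⟨hne, hvB⟩)
      subst this
      simp [← hb]
    · simp [hvB]
  have htop := hx _ hmem
  have hni := B.2.1.notMem_span_image (s := {b}ᶜ) (x := b) (by simp)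
  apply hni
  have : (Set.range fun v : (B.1.erase b : Finset V) => w v) =
      (fun v : B.1 => w v) '' {b}ᶜ := by
    ext y
    constructor
    · rintro ⟨⟨v, hv⟩, rfl⟩
      rw [Finset.mem_erase] at hv
      exact ⟨⟨v, hv.2⟩, by simpa [Subtype.ext_iff] using hv.1, rfl⟩
    · rintro ⟨⟨v, hv⟩, h, rfl⟩
      exact ⟨⟨v, Finset.mem_erase.2 ⟨by simpa [Subtype.ext_iff] using h, hv⟩⟩, rfl⟩
  rw [← this, htop]
  trivial

lemma subset_of_dual_feasible {w : V → ι → ℝ} {c : V → ℝ} (B B' : VBasis w)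
    (hgen : ∀ v, v ∉ B.1 → redCost B v c ≠ 0)
    (hB : ∀ v, 0 ≤ redCost B v c) (hB' : ∀ v, 0 ≤ redCost B' v c) {x : ι → ℝ}
    (hx : GenericFor w x) (h0 : ∀ b, 0 ≤ B.basis.equivFun x b)
    (h0' : ∀ b, 0 ≤ B'.basis.equivFun x b) : B'.1 ⊆ B.1 := by
  classical
  have key : ∀ C D : VBasis w, (∑ b : D.1, D.basis.equivFun x b * redCost C b c) =
      ∑ b : C.1, C.basis.equivFun x b * c b - ∑ b : D.1, D.basis.equivFun x b * c b := by
    intro C D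
    have h1 := sum_mul_redCost C c fun v =>
      if h : v ∈ D.1 then D.basis.equivFun x ⟨v, h⟩ else 0
    rw [sum_extend] at h1
    have h2 := D.basis.sum_equivFun x
    simp only [VBasis.basis_apply] at h2
    rw [h2] at h1
    simp only [← smul_eq_mul (α := ℝ)] at h1 ⊢
    rwa [sum_extend, sum_extend] at h1
  have k1 := key B B'
  have k2 := key B' B
  have p1 : ∀ b : B'.1, b ∈ Finset.univ → 0 ≤ B'.basis.equivFun x b * redCost B b c :=
    fun b _ => mul_nonneg (h0' b) (hB b)
  have p2 : 0 ≤ ∑ b : B.1, B.basis.equivFun x b * redCost B' b c :=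
    Finset.sum_nonneg fun b _ => mul_nonneg (h0 b) (hB' b)
  have z : ∑ b : B'.1, B'.basis.equivFun x b * redCost B b c = 0 :=
    le_antisymm (by linarith) (Finset.sum_nonneg p1)
  intro v hv
  have := (Finset.sum_eq_zero_iff_of_nonneg p1).1 z ⟨v, hv⟩ (Finset.mem_univ _)
  rcases mul_eq_zero.1 this with h | h
  · exact absurd h (equivFun_pos_of_genericFor B' hx h0' _).ne'
  · by_contra hvB
    exact hgen v hvB h

/-- The nonnegative span of `w` is, up to a null set, partitioned into finitely many simplicial
cones on each of which the linear program with costs `c` is solved by the generators of the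
cone. -/
theorem exists_simplicial_partition (w : V → ι → ℝ) (hw : ∀ v i, 0 ≤ w v i)
    (hw0 : ∀ v, ∃ i, 0 < w v i) (c : V → ℝ) :
    ∃ 𝓑 : Finset (VBasis w),
      (∀ᵐ x, (nonnegReps w x).Nonempty → ∃ B ∈ 𝓑, (∀ b, 0 ≤ B.basis.equivFun x b) ∧
        ∀ B' ∈ 𝓑, (∀ b, 0 ≤ B'.basis.equivFun x b) → B' = B) ∧
      ∀ B ∈ 𝓑, ∀ x, ∀ s ∈ nonnegReps w x,
        ∑ v, s v * c v ≤ ∑ b : B.1, B.basis.equivFun x b * c b := by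
  classical
  obtain ⟨c', hgen, hsub⟩ := exists_generic_cost w c
  refine ⟨Finset.univ.filter fun B => ∀ v, 0 ≤ redCost B v c', ?_, ?_⟩
  · filter_upwards [ae_genericFor w] with x hx hne
    obtain ⟨B, hB, h0⟩ := exists_optimal_basis w hw hw0 c' x hx hne
    refine ⟨B, by simpa using hB, h0, fun B' hB' h0' => ?_⟩
    rw [Finset.mem_filter] at hB'
    exact Subtype.ext (Finset.Subset.antisymm
      (subset_of_dual_feasible B B' (hgen B) hB hB'.2 hx h0 h0')
      (subset_of_dual_feasible B' B (hgen B') hB'.2 hB hx h0' h0))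
  · rintro B hB x s ⟨hs0, rfl⟩
    rw [Finset.mem_filter] at hB
    have := sum_mul_redCost B c s
    have h2 : 0 ≤ ∑ v, s v * redCost B v c :=
      Finset.sum_nonneg fun v _ => mul_nonneg (hs0 v) (hsub B v (hB.2 v))
    linarith

end LP
section Assignment

lemma exists_tight_potentials {α β : Type*} [Fintype α] [Fintype β] [Nonempty α]
    (hcard : Fintype.card α = Fintype.card β) (y : α → β → ℝ) (hy : ∀ i j, 0 ≤ y i j) :
    ∃ (p : α → ℝ) (q : β → ℝ), (∀ i j, p i + q j ≤ y i j) ∧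
      ∃ σ : α ≃ β, ∀ i, p i + q (σ i) = y i (σ i) := by
  classical
  obtain ⟨a₀⟩ := ‹Nonempty α›
  let e₀ : α ≃ β := Fintype.equivOfCardEq hcard
  let K : Set ((α → ℝ) × (β → ℝ)) := {z | z.1 a₀ = 0 ∧ (∀ i j, z.1 i + z.2 j ≤ y i j) ∧
    0 ≤ ∑ i, z.1 i + ∑ j, z.2 j}
  let M : ℝ := ∑ i, ∑ j, y i j
  have hM0 : 0 ≤ M := Finset.sum_nonneg fun i _ => Finset.sum_nonneg fun j _ => hy i j
  have hM : ∀ i j, y i j ≤ M := fun i j =>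
    (Finset.single_le_sum (f := fun j => y i j) (fun j _ => hy i j) (Finset.mem_univ j)).trans
      (Finset.single_le_sum (f := fun i => ∑ j, y i j)
        (fun i _ => Finset.sum_nonneg fun j _ => hy i j) (Finset.mem_univ i))
  let C : ℝ := Fintype.card α * M
  have hC0 : 0 ≤ C := by positivity
  have hlow : ∀ z ∈ K, ∀ i j, -C ≤ z.1 i + z.2 j := by
    rintro z ⟨-, h1, h2⟩ i j
    let e : α ≃ β := e₀.trans (Equiv.swap (e₀ i) j)
    have he : e i = j := by simp [e]
    have h3 : ∑ i, z.1 i + ∑ j, z.2 j = ∑ i, (z.1 i + z.2 (e i)) := by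
      rw [Finset.sum_add_distrib, Equiv.sum_comp e z.2]
    rw [h3, ← Finset.add_sum_erase _ _ (Finset.mem_univ i), he] at h2
    have h4 : ∑ x ∈ Finset.univ.erase i, (z.1 x + z.2 (e x)) ≤ C := by
      calc _ ≤ ∑ x ∈ Finset.univ.erase i, M :=
            Finset.sum_le_sum fun x _ => (h1 _ _).trans (hM _ _)
        _ ≤ ∑ x : α, M := Finset.sum_le_sum_of_subset_of_nonneg (Finset.subset_univ _)
            fun _ _ _ => hM0
        _ = C := by simp [C]
    linarith
  have hcl : IsClosed K := by
    have h1 : IsClosed {z : (α → ℝ) × (β → ℝ) | z.1 a₀ = 0} :=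
      isClosed_eq (by fun_prop) continuous_const
    have h2 : IsClosed {z : (α → ℝ) × (β → ℝ) | ∀ i j, z.1 i + z.2 j ≤ y i j} := by
      simp only [Set.ofPred_forall]
      exact isClosed_iInter fun i => isClosed_iInter fun j =>
        isClosed_le (by fun_prop) continuous_const
    have h3 : IsClosed {z : (α → ℝ) × (β → ℝ) | 0 ≤ ∑ i, z.1 i + ∑ j, z.2 j} :=
      isClosed_le continuous_const (by fun_prop)
    exact h1.inter (h2.inter h3)
  have hK : IsCompact K := by
    refine IsCompact.of_isClosed_subset
      ((isCompact_univ_pi fun _ : α => isCompact_Icc (a := -C - M) (b := C + M)).prod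
        (isCompact_univ_pi fun _ : β => isCompact_Icc (a := -C) (b := M))) hcl ?_
    intro z hz
    have hq : ∀ j, -C ≤ z.2 j ∧ z.2 j ≤ M := by
      intro j
      have h1 := hlow z hz a₀ j
      have h2 := (hz.2.1 a₀ j).trans (hM _ _)
      rw [hz.1, zero_add] at h1 h2
      exact ⟨h1, h2⟩
    refine ⟨fun i _ => ?_, fun j _ => hq j⟩
    have h1 := hlow z hz i (e₀ i)
    have h2 := (hz.2.1 i (e₀ i)).trans (hM _ _)
    have h3 := hq (e₀ i)
    constructor <;> linarith
  have hne : K.Nonempty := ⟨(0, 0), by simp [K, hy]⟩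
  obtain ⟨z, hz, hmax⟩ := hK.exists_isMaxOn hne
    (f := fun z : (α → ℝ) × (β → ℝ) => ∑ i, z.1 i + ∑ j, z.2 j) (by fun_prop)
  refine ⟨z.1, z.2, hz.2.1, ?_⟩
  let T : α → Finset β := fun i => Finset.univ.filter fun j => z.1 i + z.2 j = y i j
  have hall : ∀ S : Finset α, S.card ≤ (S.biUnion T).card := by
    by_contra! hcon
    obtain ⟨S, hS⟩ := hcon
    obtain ⟨ε, hε0, hε⟩ : ∃ ε : ℝ, 0 < ε ∧ ∀ i j, z.1 i + z.2 j ≠ y i j →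
        z.1 i + z.2 j + ε ≤ y i j := by
      have : ∀ᶠ ε in nhdsWithin (0 : ℝ) (Set.Ioi 0), ∀ i j, z.1 i + z.2 j ≠ y i j →
          z.1 i + z.2 j + ε ≤ y i j := by
        rw [Filter.eventually_all]; intro i
        rw [Filter.eventually_all]; intro j
        by_cases h : z.1 i + z.2 j = y i j
        · simp [h]
        · have h' : 0 < y i j - (z.1 i + z.2 j) := sub_pos.2 ((hz.2.1 i j).lt_of_ne h)
          filter_upwards [nhdsWithin_le_nhds (gt_mem_nhds h')] with ε hε _
          linarith
      obtain ⟨ε, h1, h2⟩ := (this.and self_mem_nhdsWithin).exists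
      exact ⟨ε, h2, h1⟩
    let c : ℝ := if a₀ ∈ S then ε else 0
    let z' : (α → ℝ) × (β → ℝ) :=
      (fun i => z.1 i + (if i ∈ S then ε else 0) - c,
        fun j => z.2 j - (if j ∈ S.biUnion T then ε else 0) + c)
    have hsum : ∑ i, z'.1 i + ∑ j, z'.2 j =
        (∑ i, z.1 i + ∑ j, z.2 j) + ε * ((S.card : ℝ) - (S.biUnion T).card) := by
      simp only [z', Finset.sum_add_distrib, Finset.sum_sub_distrib, Finset.sum_ite_mem,
        Finset.univ_inter, Finset.sum_const, nsmul_eq_mul, Finset.card_univ, hcard]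
      ring
    have hpos : 0 < ε * ((S.card : ℝ) - (S.biUnion T).card) :=
      mul_pos hε0 (sub_pos.2 (by exact_mod_cast hS))
    have hz' : z' ∈ K := by
      refine ⟨?_, fun i j => ?_, ?_⟩
      · simp [z', c, hz.1]
      · have h0 := hz.2.1 i j
        simp only [z']
        by_cases hi : i ∈ S
        · by_cases hj : j ∈ S.biUnion T
          · simp only [hi, hj, if_true]; linarith
          · have : z.1 i + z.2 j ≠ y i j := fun h =>
              hj (Finset.mem_biUnion.2 ⟨i, hi, by simp [T, h]⟩)
            have := hε i j this
            simp only [hi, hj, if_true, if_false]; linarith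
        · simp only [hi, if_false]
          split_ifs <;> linarith
      · rw [hsum]
        have := hz.2.2
        linarith
    have := hmax hz'
    simp only [Set.mem_ofPred_eq, hsum] at this
    linarith
  obtain ⟨f, hf, hfT⟩ := (Finset.all_card_le_biUnion_card_iff_exists_injective T).1 hall
  refine ⟨Equiv.ofBijective f ((Fintype.bijective_iff_injective_and_card f).2 ⟨hf, hcard⟩),
    fun i => ?_⟩
  simpa [T] using hfT i

/-- Layer-cake decomposition of a pair of potentials. -/
lemma exists_layer_weights {α β : Type*} [Fintype α] [Fintype β] [DecidableEq α] [DecidableEq β]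
    (hcard : Fintype.card α = Fintype.card β) (p : α → ℝ) (q : β → ℝ) :
    ∃ ν : Finset α × Finset β → ℝ, (∀ L, 0 ≤ ν L) ∧
      (∀ L, ν L ≠ 0 → ∃ s : ℝ, (∀ i, i ∈ L.1 ↔ p i ≤ s) ∧ ∀ j, j ∈ L.2 ↔ q j ≤ -s) ∧
      (∑ L, ν L * ((Fintype.card α : ℝ) - L.1.card - L.2.card) = ∑ i, p i + ∑ j, q j) ∧
      ∀ i j, (∑ L, if i ∉ L.1 ∧ j ∉ L.2 then ν L else 0) ≤ max 0 (p i + q j) := by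
  obtain ⟨R, hRp, hRq⟩ : ∃ R : ℝ, (∀ i, |p i| ≤ R) ∧ ∀ j, |q j| ≤ R := by
    refine ⟨∑ i, |p i| + ∑ j, |q j|, fun i => ?_, fun j => ?_⟩
    · have h1 := Finset.single_le_sum (f := fun i => |p i|) (fun i _ => abs_nonneg _)
        (Finset.mem_univ i)
      have h2 : 0 ≤ ∑ j, |q j| := Finset.sum_nonneg fun j _ => abs_nonneg _
      linarith
    · have h1 := Finset.single_le_sum (f := fun i => |q i|) (fun i _ => abs_nonneg _)
        (Finset.mem_univ j)
      have h2 : 0 ≤ ∑ j, |p j| := Finset.sum_nonneg fun j _ => abs_nonneg _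
      linarith
  let layer : ℝ → Finset α × Finset β := fun s =>
    (Finset.univ.filter fun i => p i ≤ s, Finset.univ.filter fun j => q j ≤ -s)
  let μ : Measure ℝ := volume.restrict (Set.Icc (-R) R)
  have hmeas : ∀ L, MeasurableSet {s | layer s = L} := by
    intro L
    have : {s | layer s = L} = (⋂ i, {s | p i ≤ s ↔ i ∈ L.1}) ∩ ⋂ j, {s | q j ≤ -s ↔ j ∈ L.2} := by
      ext s
      simp [layer, Prod.ext_iff, Finset.ext_iff]
    rw [this]
    refine MeasurableSet.inter (MeasurableSet.iInter fun i => ?_) (MeasurableSet.iInter fun j => ?_)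
    · exact (measurableSet_le measurable_const measurable_id).iff (MeasurableSet.const _)
    · exact (measurableSet_le measurable_const measurable_neg).iff (MeasurableSet.const _)
  let ν : Finset α × Finset β → ℝ := fun L => μ.real {s | layer s = L}
  have hν : ∀ (P : Finset α × Finset β → Prop) [DecidablePred P],
      (∑ L, if P L then ν L else 0) = μ.real {s | P (layer s)} := by
    intro P _
    have : {s | P (layer s)} = ⋃ L ∈ Finset.univ.filter P, {s | layer s = L} := by
      ext s
      simp
    rw [this, measureReal_biUnion_finset, Finset.sum_filter]
    · intro L _ L' _ hne
      exact Set.disjoint_left.2 fun s hs hs' => hne (hs.symm.trans hs')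
    · exact fun L _ => hmeas L
  have hμ : ∀ s : Set ℝ, MeasurableSet s → μ.real s = volume.real (s ∩ Set.Icc (-R) R) :=
    fun s hs => by simp [μ, measureReal_def, Measure.restrict_apply hs]
  have hp : ∀ i, (∑ L, if i ∉ L.1 then ν L else 0) = p i + R := by
    intro i
    rw [hν fun L => i ∉ L.1]
    have h1 := abs_le.1 (hRp i)
    have : {s | i ∉ (layer s).1} = Set.Iio (p i) := by ext s; simp [layer]
    rw [this, hμ _ measurableSet_Iio]
    have : Set.Iio (p i) ∩ Set.Icc (-R) R = Set.Ico (-R) (p i) := by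
      ext s
      simp only [Set.mem_inter_iff, Set.mem_Iio, Set.mem_Icc, Set.mem_Ico]
      constructor
      · rintro ⟨a, b, c⟩; exact ⟨b, a⟩
      · rintro ⟨a, b⟩; exact ⟨b, a, by linarith⟩
    rw [this, Real.volume_real_Ico_of_le (by linarith)]
    ring
  have hq : ∀ j, (∑ L, if j ∉ L.2 then ν L else 0) = q j + R := by
    intro j
    rw [hν fun L => j ∉ L.2]
    have h1 := abs_le.1 (hRq j)
    have : {s | j ∉ (layer s).2} = Set.Ioi (-q j) := by
      ext s; simp only [layer, Finset.mem_filter, Finset.mem_univ, true_and, not_le,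
        Set.mem_ofPred_eq, Set.mem_Ioi]
      exact neg_lt
    rw [this, hμ _ measurableSet_Ioi]
    have : Set.Ioi (-q j) ∩ Set.Icc (-R) R = Set.Ioc (-q j) R := by
      ext s
      simp only [Set.mem_inter_iff, Set.mem_Ioi, Set.mem_Icc, Set.mem_Ioc]
      constructor
      · rintro ⟨a, b, c⟩; exact ⟨a, c⟩
      · rintro ⟨a, b⟩; exact ⟨a, by linarith, b⟩
    rw [this, Real.volume_real_Ioc_of_le (by linarith)]
    ring
  refine ⟨ν, fun L => measureReal_nonneg, fun L hL => ?_, ?_, fun i j => ?_⟩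
  · have : {s | layer s = L}.Nonempty := by
      by_contra h
      rw [Set.not_nonempty_iff_eq_empty] at h
      exact hL (by simp [ν, h])
    obtain ⟨s, rfl⟩ := this
    exact ⟨s, by simp [layer], by simp [layer]⟩
  · rcases isEmpty_or_nonempty α with hα | ⟨⟨a⟩⟩
    · have hβ : IsEmpty β := by
        rw [← Fintype.card_eq_zero_iff, ← hcard, Fintype.card_eq_zero_iff]; exact hα
      simp [Finset.eq_empty_of_isEmpty]
    have hR : 0 ≤ R := (abs_nonneg _).trans (hRp a)
    have htot : ∑ L, ν L = 2 * R := by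
      have := hν fun _ => True
      simp only [if_true] at this
      rw [this, hμ _ (MeasurableSet.const _)]
      simp [Real.volume_real_Icc_of_le (by linarith : -R ≤ R)]
      ring
    have h1 : ∀ L : Finset α × Finset β, ν L * ((Fintype.card α : ℝ) - L.1.card - L.2.card) =
        (∑ i, if i ∉ L.1 then ν L else 0) + (∑ j, if j ∉ L.2 then ν L else 0)
          - Fintype.card α * ν L := by
      intro L
      rw [← Finset.sum_filter, ← Finset.sum_filter, Finset.sum_const, Finset.sum_const]
      have e1 : Finset.univ.filter (fun i => i ∉ L.1) = L.1ᶜ := by ext; simp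
      have e2 : Finset.univ.filter (fun i => i ∉ L.2) = L.2ᶜ := by ext; simp
      rw [e1, e2, Finset.card_compl, Finset.card_compl, nsmul_eq_mul, nsmul_eq_mul,
        Nat.cast_sub (Finset.card_le_univ _), Nat.cast_sub (Finset.card_le_univ _), ← hcard]
      ring
    rw [Finset.sum_congr rfl fun L _ => h1 L, Finset.sum_sub_distrib, Finset.sum_add_distrib,
      Finset.sum_comm, Finset.sum_comm (f := fun L j => if j ∉ L.2 then ν L else 0),
      Finset.sum_congr rfl fun i _ => hp i, Finset.sum_congr rfl fun j _ => hq j,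
      ← Finset.mul_sum, htot, Finset.sum_add_distrib, Finset.sum_add_distrib]
    simp only [Finset.sum_const, Finset.card_univ, nsmul_eq_mul, ← hcard]
    ring
  · rw [hν fun L => i ∉ L.1 ∧ j ∉ L.2]
    have hs : {s | i ∉ (layer s).1 ∧ j ∉ (layer s).2} = Set.Ioo (-q j) (p i) := by
      ext s
      simp only [layer, Finset.mem_filter, Finset.mem_univ, true_and, not_le,
        Set.mem_ofPred_eq, Set.mem_Ioo]
      rw [neg_lt, and_comm]
    rw [hs, hμ _ measurableSet_Ioo]
    calc _ ≤ volume.real (Set.Ioo (-q j) (p i)) :=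
          measureReal_mono Set.inter_subset_left (by simp)
      _ = max 0 (p i + q j) := by
          rw [Real.volume_real_Ioo, max_comm]; congr 1; ring

end Assignment
section MinAssign
variable {m n k : ℕ}

lemma bddBelow_assign_sums (x : Fin m × Fin n → ℝ) :
    BddBelow {v | ∃ S : Finset (Fin m × Fin n), IsAssignF m n k S ∧ v = ∑ p ∈ S, x p} := by
  refine (Set.Finite.subset (Set.finite_range fun S : Finset (Fin m × Fin n) => ∑ p ∈ S, x p)
    ?_).bddBelow
  rintro v ⟨S, -, rfl⟩
  exact ⟨S, rfl⟩

lemma minAssign_le {S : Finset (Fin m × Fin n)} (hS : IsAssignF m n k S)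
    (x : Fin m × Fin n → ℝ) : minAssign m n k x ≤ ∑ p ∈ S, x p :=
  csInf_le (bddBelow_assign_sums x) ⟨S, hS, rfl⟩

lemma exists_isAssignF (hkm : k ≤ m) (hmn : m ≤ n) : ∃ S, IsAssignF m n k S := by
  refine ⟨Finset.univ.map ⟨fun i : Fin k => (Fin.castLE hkm i, Fin.castLE (hkm.trans hmn) i),
    fun i j h => by simpa [Fin.ext_iff] using h⟩, by simp, ?_⟩
  simp only [Finset.mem_map, Finset.mem_univ, true_and]
  rintro _ ⟨i, rfl⟩ _ ⟨j, rfl⟩ h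
  have hij : i ≠ j := fun e => h (e ▸ rfl)
  exact ⟨fun e => hij (Fin.castLE_injective hkm e),
    fun e => hij (Fin.castLE_injective (hkm.trans hmn) e)⟩

lemma le_minAssign (hkm : k ≤ m) (hmn : m ≤ n) {x : Fin m × Fin n → ℝ} {a : ℝ}
    (h : ∀ S, IsAssignF m n k S → a ≤ ∑ p ∈ S, x p) : a ≤ minAssign m n k x := by
  obtain ⟨S, hS⟩ := exists_isAssignF hkm hmn
  refine le_csInf ⟨_, S, hS, rfl⟩ ?_
  rintro v ⟨S, hS, rfl⟩
  exact h S hS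

/-- The generators of the cones: pairs `(I, J)` of deleted rows and columns with fewer than `k`
lines altogether, and single positions. -/
abbrev Gen (m n k : ℕ) : Type :=
  {q : Finset (Fin m) × Finset (Fin n) // q.1.card + q.2.card < k} ⊕ (Fin m × Fin n)

/-- The vector of a generator: the indicator of the remaining submatrix, or of the position. -/
noncomputable def genVec : Gen m n k → Fin m × Fin n → ℝ :=
  Sum.elim (fun q p => if p.1 ∉ q.1.1 ∧ p.2 ∉ q.1.2 then 1 else 0) fun p => Pi.single p 1

/-- The value of the minimum `k`-assignment at the vector of a generator. -/
noncomputable def genCost : Gen m n k → ℝ :=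
  Sum.elim (fun q => (k : ℝ) - q.1.1.card - q.1.2.card) fun _ => 0

lemma genVec_nonneg (v : Gen m n k) (p : Fin m × Fin n) : 0 ≤ genVec v p := by
  classical
  rcases v with q | r
  · simp only [genVec, Sum.elim_inl]
    split_ifs <;> norm_num
  · simp only [genVec, Sum.elim_inr, Pi.single_apply]
    split_ifs <;> norm_num

lemma exists_notMem_of_card_lt {m : ℕ} {I : Finset (Fin m)} (h : I.card < m) : ∃ i, i ∉ I := by
  by_contra! hI
  rw [Finset.eq_univ_of_forall hI] at h
  simp at h

lemma exists_genVec_pos (hkm : k ≤ m) (hmn : m ≤ n) (v : Gen m n k) : ∃ p, 0 < genVec v p := by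
  rcases v with ⟨q, hq⟩ | r
  · obtain ⟨i, hi⟩ := exists_notMem_of_card_lt (show q.1.card < m by omega)
    obtain ⟨j, hj⟩ := exists_notMem_of_card_lt (show q.2.card < n by omega)
    exact ⟨(i, j), by simp [genVec, hi, hj]⟩
  · exact ⟨r, by simp [genVec]⟩

lemma IsAssignF.genCost_le {S : Finset (Fin m × Fin n)} (hS : IsAssignF m n k S)
    (v : Gen m n k) : genCost v ≤ ∑ p ∈ S, genVec v p := by
  classical
  rcases v with ⟨⟨I, J⟩, hq⟩ | r
  · simp only [genCost, genVec, Sum.elim_inl]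
    rw [Finset.sum_boole]
    have h1 : (S.filter fun p => p.1 ∈ I).card ≤ I.card := by
      refine Finset.card_le_card_of_injOn Prod.fst (fun p hp => (Finset.mem_filter.1 hp).2) ?_
      intro p hp q hq h
      by_contra hne
      exact (hS.2 p (Finset.mem_filter.1 hp).1 q (Finset.mem_filter.1 hq).1 hne).1 h
    have h2 : (S.filter fun p => p.2 ∈ J).card ≤ J.card := by
      refine Finset.card_le_card_of_injOn Prod.snd (fun p hp => (Finset.mem_filter.1 hp).2) ?_
      intro p hp q hq h
      by_contra hne
      exact (hS.2 p (Finset.mem_filter.1 hp).1 q (Finset.mem_filter.1 hq).1 hne).2 h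
    have h3 : S ⊆ (S.filter fun p => p.1 ∉ I ∧ p.2 ∉ J) ∪
        ((S.filter fun p => p.1 ∈ I) ∪ S.filter fun p => p.2 ∈ J) := by
      intro p hp
      simp only [Finset.mem_union, Finset.mem_filter, hp, true_and]
      tauto
    have h4 := (Finset.card_le_card h3).trans ((Finset.card_union_le _ _).trans
      (Nat.add_le_add_left (Finset.card_union_le _ _) _))
    rw [hS.1] at h4
    have h5 : (k : ℝ) ≤ (S.filter fun p => p.1 ∉ I ∧ p.2 ∉ J).card + (I.card + J.card) := by
      exact_mod_cast h4.trans (by omega)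
    linarith
  · simp only [genCost, Sum.elim_inr]
    exact Finset.sum_nonneg fun p _ => genVec_nonneg _ _

lemma sum_genCost_le_minAssign (hkm : k ≤ m) (hmn : m ≤ n) {x : Fin m × Fin n → ℝ}
    {s : Gen m n k → ℝ} (hs : s ∈ nonnegReps genVec x) :
    ∑ v, s v * genCost v ≤ minAssign m n k x := by
  refine le_minAssign hkm hmn fun S hS => ?_
  rw [← hs.2]
  simp only [Finset.sum_apply, Pi.smul_apply, smul_eq_mul]
  rw [Finset.sum_comm]
  refine Finset.sum_le_sum fun v _ => ?_
  rw [← Finset.mul_sum]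
  exact mul_le_mul_of_nonneg_left (hS.genCost_le v) (hs.1 v)

/-- The matrix `x` bordered by `n - k` zero rows and `m - k` zero columns. -/
def bordered (k : ℕ) (x : Fin m × Fin n → ℝ) :
    Fin m ⊕ Fin (n - k) → Fin n ⊕ Fin (m - k) → ℝ
  | .inl i, .inl j => x (i, j)
  | _, _ => 0

lemma minAssign_le_sum_bordered (x : Fin m × Fin n → ℝ) (hx : ∀ p, 0 ≤ x p) (hkm : k ≤ m)
    (σ : Fin m ⊕ Fin (n - k) ≃ Fin n ⊕ Fin (m - k)) :
    minAssign m n k x ≤ ∑ i, bordered k x i (σ i) := by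
  classical
  let S : Finset (Fin m × Fin n) := Finset.univ.filter fun p => σ (.inl p.1) = .inl p.2
  have hassign : ∀ p ∈ S, ∀ q ∈ S, p ≠ q → p.1 ≠ q.1 ∧ p.2 ≠ q.2 := by
    rintro ⟨i, j⟩ hp ⟨i', j'⟩ hq hne
    simp only [S, Finset.mem_filter, Finset.mem_univ, true_and] at hp hq
    constructor
    · rintro rfl
      rw [hp] at hq
      exact hne (by rw [Sum.inl.inj hq])
    · rintro rfl
      have := σ.injective (hp.trans hq.symm)
      exact hne (by rw [Sum.inl.inj this])
  let D : Finset (Fin m) := Finset.univ.filter fun i => (σ (.inl i)).isRight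
  have hD : D.card ≤ m - k := by
    have : (D.map Function.Embedding.inl).map σ.toEmbedding ⊆
        (Finset.univ : Finset (Fin (m - k))).map Function.Embedding.inr := by
      intro b hb
      simp only [Finset.mem_map, D, Finset.mem_filter, Finset.mem_univ, true_and] at hb ⊢
      obtain ⟨_, ⟨i, hi, rfl⟩, rfl⟩ := hb
      obtain ⟨c, hc⟩ := Sum.isRight_iff.1 hi
      exact ⟨c, hc.symm⟩
    simpa using Finset.card_le_card this
  have hS : m ≤ S.card + D.card := by
    have : (Finset.univ : Finset (Fin m)) ⊆ S.image Prod.fst ∪ D := by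
      intro i _
      rcases h : σ (.inl i) with j | c
      · exact Finset.mem_union_left _ (Finset.mem_image.2 ⟨(i, j), by simp [S, h], rfl⟩)
      · exact Finset.mem_union_right _ (by simp [D, h])
    have h1 := (Finset.card_le_card this).trans (Finset.card_union_le _ _)
    have h2 := Finset.card_image_le (s := S) (f := Prod.fst)
    simp only [Finset.card_univ, Fintype.card_fin] at h1
    omega
  obtain ⟨S', hS', hcard⟩ := Finset.exists_subset_card_eq (show k ≤ S.card by omega)
  refine (minAssign_le ⟨hcard, fun p hp q hq => hassign p (hS' hp) q (hS' hq)⟩ x).trans ?_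
  have hb : ∀ i j, 0 ≤ bordered k x i j := by
    rintro (i | i) (j | j) <;> simp [bordered, hx]
  have hinj : Set.InjOn (fun p : Fin m × Fin n => (Sum.inl p.1 : Fin m ⊕ Fin (n - k))) S' := by
    intro p hp q hq h
    by_contra hne
    exact (hassign p (hS' hp) q (hS' hq) hne).1 (Sum.inl.inj h)
  calc ∑ p ∈ S', x p = ∑ p ∈ S', bordered k x (.inl p.1) (σ (.inl p.1)) := by
        refine Finset.sum_congr rfl fun p hp => ?_
        have := hS' hp
        simp only [S, Finset.mem_filter, Finset.mem_univ, true_and] at this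
        rw [this]
        rfl
    _ = ∑ i ∈ S'.image fun p => Sum.inl p.1, bordered k x i (σ i) := by
        rw [Finset.sum_image hinj]
    _ ≤ ∑ i, bordered k x i (σ i) :=
        Finset.sum_le_sum_of_subset_of_nonneg (Finset.subset_univ _) fun _ _ _ => hb _ _

/-- Strong duality: every nonnegative matrix has a representation attaining `minAssign`. -/
lemma exists_rep_minAssign_le (hk : 0 < k) (hkm : k ≤ m) (hmn : m ≤ n) (x : Fin m × Fin n → ℝ)
    (hx : ∀ p, 0 ≤ x p) :
    ∃ s ∈ nonnegReps (genVec (k := k)) x, minAssign m n k x ≤ ∑ v, s v * genCost v := by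
  classical
  have hcard : Fintype.card (Fin m ⊕ Fin (n - k)) = Fintype.card (Fin n ⊕ Fin (m - k)) := by
    simp only [Fintype.card_sum, Fintype.card_fin]; omega
  have hb : ∀ i j, 0 ≤ bordered k x i j := by
    rintro (i | i) (j | j) <;> simp [bordered, hx]
  have : Nonempty (Fin m ⊕ Fin (n - k)) := ⟨.inl ⟨0, by omega⟩⟩
  obtain ⟨p, q, hpq, σ, hσ⟩ := exists_tight_potentials hcard (bordered k x) hb
  obtain ⟨ν, hν0, hνL, hνsum, hνle⟩ := exists_layer_weights hcard p q
  let real : Finset (Fin m ⊕ Fin (n - k)) × Finset (Fin n ⊕ Fin (m - k)) →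
    Finset (Fin m) × Finset (Fin n) := fun L => (L.1.toLeft, L.2.toLeft)
  let τ : {q : Finset (Fin m) × Finset (Fin n) // q.1.card + q.2.card < k} → ℝ :=
    fun u => ∑ L, if real L = u.1 then ν L else 0
  have hτ : ∀ f : Finset (Fin m) × Finset (Fin n) → ℝ, ∑ u, τ u * f u.1 =
      ∑ L, if (real L).1.card + (real L).2.card < k then ν L * f (real L) else 0 := by
    intro f
    simp only [τ, Finset.sum_mul]
    rw [Finset.sum_comm]
    refine Finset.sum_congr rfl fun L _ => ?_
    split_ifs with h
    · rw [Finset.sum_eq_single ⟨real L, h⟩]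
      · simp
      · rintro u - hu
        rw [if_neg, zero_mul]
        exact fun h' => hu (Subtype.ext h'.symm)
      · simp
    · refine Finset.sum_eq_zero fun u _ => ?_
      rw [if_neg, zero_mul]
      exact fun h' => h (h' ▸ u.2)
  have hle : ∀ r, (∑ u, τ u • genVec (Sum.inl u : Gen m n k)) r ≤ x r := by
    rintro ⟨i, j⟩
    simp only [Finset.sum_apply, Pi.smul_apply, smul_eq_mul, genVec, Sum.elim_inl]
    rw [hτ fun u => if i ∉ u.1 ∧ j ∉ u.2 then 1 else 0]
    refine le_trans ?_ ((hνle (.inl i) (.inl j)).trans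
      (max_le (hx _) (hpq (.inl i) (.inl j))))
    refine Finset.sum_le_sum fun L _ => ?_
    have h0 := hν0 L
    simp only [real, Finset.mem_toLeft]
    split_ifs <;> simp [h0]
  refine ⟨Sum.elim τ fun r => x r - (∑ u, τ u • genVec (Sum.inl u : Gen m n k)) r,
    ⟨?_, ?_⟩, ?_⟩
  · rintro (u | r)
    · exact Finset.sum_nonneg fun L _ => by split_ifs <;> simp [hν0]
    · exact sub_nonneg.2 (hle r)
  · rw [Fintype.sum_sum_type]
    ext r
    simp only [Sum.elim_inl, Sum.elim_inr, Pi.add_apply]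
    have : (∑ r' : Fin m × Fin n, (x r' - (∑ u, τ u • genVec (Sum.inl u : Gen m n k)) r') •
        genVec (Sum.inr r' : Gen m n k)) r =
        x r - (∑ u, τ u • genVec (Sum.inl u : Gen m n k)) r := by
      rw [Finset.sum_apply, Finset.sum_eq_single r]
      · simp [genVec]
      · intro b _ hb
        simp [genVec, hb.symm]
      · simp
    rw [this]
    ring
  · refine (minAssign_le_sum_bordered x hx hkm σ).trans ?_
    rw [Fintype.sum_sum_type (α₁ := {q : Finset (Fin m) × Finset (Fin n) //
      q.1.card + q.2.card < k})]
    simp only [Sum.elim_inl, Sum.elim_inr, genCost, mul_zero, Finset.sum_const_zero, add_zero]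
    rw [hτ fun u => (k : ℝ) - u.1.card - u.2.card]
    have : ∑ i, bordered k x i (σ i) = ∑ i, p i + ∑ j, q j := by
      rw [← Equiv.sum_comp σ q, ← Finset.sum_add_distrib]
      exact Finset.sum_congr rfl fun i _ => (hσ i).symm
    rw [this, ← hνsum]
    refine Finset.sum_le_sum fun L _ => ?_
    by_cases hL : ν L = 0
    · simp [hL]
    obtain ⟨s, h1, h2⟩ := hνL L hL
    have hN : Fintype.card (Fin m ⊕ Fin (n - k)) = m + (n - k) := by simp
    have hN' : Fintype.card (Fin n ⊕ Fin (m - k)) = n + (m - k) := by simp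
    have hl1 := L.1.card_toLeft_add_card_toRight
    have hl2 := L.2.card_toLeft_add_card_toRight
    have hr1 : L.1.toRight.card ≤ n - k := by simpa using Finset.card_le_univ L.1.toRight
    have hr2 : L.2.toRight.card ≤ m - k := by simpa using Finset.card_le_univ L.2.toRight
    have hkey : m + (n - k) ≤ L.1.card + L.2.card ∨
        L.1.card + L.2.card = L.1.toLeft.card + L.2.toLeft.card + ((n - k) + (m - k)) := by
      by_cases hd1 : ∃ d, Sum.inr d ∉ L.1
      · left
        obtain ⟨d, hd⟩ := hd1
        have : L.2 = Finset.univ := by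
          refine Finset.eq_univ_of_forall fun j => ?_
          rw [h2]
          rw [h1, not_le] at hd
          have h3 : p (.inr d) + q j ≤ 0 := hpq (.inr d) j
          linarith
        rw [this, Finset.card_univ, ← hcard, hN]
        omega
      by_cases hd2 : ∃ d, Sum.inr d ∉ L.2
      · left
        obtain ⟨d, hd⟩ := hd2
        have : L.1 = Finset.univ := by
          refine Finset.eq_univ_of_forall fun i => ?_
          rw [h1]
          rw [h2, not_le] at hd
          have h3 : p i + q (.inr d) ≤ 0 :=
            (hpq i (.inr d)).trans (by rcases i with i | i <;> simp [bordered])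
          linarith
        rw [this, Finset.card_univ, hN]
        omega
      right
      push Not at hd1 hd2
      have e1 : L.1.toRight = Finset.univ :=
        Finset.eq_univ_of_forall fun d => Finset.mem_toRight.2 (hd1 d)
      have e2 : L.2.toRight = Finset.univ :=
        Finset.eq_univ_of_forall fun d => Finset.mem_toRight.2 (hd2 d)
      have e1' : L.1.toRight.card = n - k := by rw [e1]; simp
      have e2' : L.2.toRight.card = m - k := by rw [e2]; simp
      omega
    rw [hN]
    simp only [real]
    split_ifs with hlt
    · refine mul_le_mul_of_nonneg_left ?_ (hν0 L)
      have : m + (n - k) + (L.1.toLeft.card + L.2.toLeft.card) ≤ k + (L.1.card + L.2.card) := by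
        omega
      have : ((m + (n - k) : ℕ) : ℝ) + (L.1.toLeft.card + L.2.toLeft.card) ≤
          k + (L.1.card + L.2.card) := by exact_mod_cast this
      linarith
    · refine mul_nonpos_of_nonneg_of_nonpos (hν0 L) ?_
      have : m + (n - k) ≤ L.1.card + L.2.card := by omega
      have : ((m + (n - k) : ℕ) : ℝ) ≤ L.1.card + L.2.card := by exact_mod_cast this
      linarith

end MinAssign
section ConeIntegral

/-- The exponential function `s ↦ exp (-a s)` cut off to the nonnegative half-line. -/
noncomputable def expCut (a s : ℝ) : ℝ := if 0 ≤ s then Real.exp (-(a * s)) else 0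

lemma expCut_eq_indicator (a : ℝ) :
    expCut a = (Set.Ici 0).indicator fun s => Real.exp (-(a * s)) := by
  ext s
  simp [expCut, Set.indicator_apply]

lemma integral_expCut {a : ℝ} (ha : 0 < a) : ∫ s, expCut a s = 1 / a := by
  rw [expCut_eq_indicator, integral_indicator measurableSet_Ici, integral_Ici_eq_integral_Ioi]
  have := Real.integral_rpow_mul_exp_neg_mul_Ioi one_pos ha
  simpa using this

lemma integral_mul_expCut {a : ℝ} (ha : 0 < a) : ∫ s, s * expCut a s = 1 / a * (1 / a) := by
  have : (fun s => s * expCut a s) =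
      (Set.Ici 0).indicator fun s => s * Real.exp (-(a * s)) := by
    ext s
    simp [expCut, Set.indicator_apply]
  rw [this, integral_indicator measurableSet_Ici, integral_Ici_eq_integral_Ioi]
  have := Real.integral_rpow_mul_exp_neg_mul_Ioi two_pos ha
  norm_num at this
  rw [this]
  ring

lemma integrable_expCut {a : ℝ} (ha : 0 < a) : Integrable (expCut a) :=
  .of_integral_ne_zero (by rw [integral_expCut ha]; positivity)

lemma integrable_mul_expCut {a : ℝ} (ha : 0 < a) : Integrable fun s => s * expCut a s :=
  .of_integral_ne_zero (by rw [integral_mul_expCut ha]; positivity)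

variable {κ : Type*} [Fintype κ]

lemma mul_prod_expCut [DecidableEq κ] (a : κ → ℝ) (j : κ) (t : κ → ℝ) :
    t j * ∏ i, expCut (a i) (t i) =
      ∏ i, (if i = j then fun s => s * expCut (a i) s else expCut (a i)) (t i) := by
  rw [← Finset.mul_prod_erase _ _ (Finset.mem_univ j),
    ← Finset.mul_prod_erase _ _ (Finset.mem_univ j), ← mul_assoc, if_pos rfl]
  congr 1
  refine Finset.prod_congr rfl fun i hi => ?_
  rw [if_neg (Finset.ne_of_mem_erase hi)]

lemma integrable_mul_prod_expCut (a : κ → ℝ) (ha : ∀ i, 0 < a i) (j : κ) :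
    Integrable fun t : κ → ℝ => t j * ∏ i, expCut (a i) (t i) := by
  classical
  simp only [mul_prod_expCut]
  refine Integrable.fintype_prod fun i => ?_
  split_ifs
  · exact integrable_mul_expCut (ha i)
  · exact integrable_expCut (ha i)

lemma integral_mul_prod_expCut (a : κ → ℝ) (ha : ∀ i, 0 < a i) (j : κ) :
    ∫ t : κ → ℝ, t j * ∏ i, expCut (a i) (t i) = 1 / a j * ∏ i, 1 / a i := by
  classical
  simp only [mul_prod_expCut]
  rw [integral_fintype_prod_volume_eq_prod,
    ← Finset.mul_prod_erase _ _ (Finset.mem_univ j),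
    ← Finset.mul_prod_erase (f := fun i => 1 / a i) _ (Finset.mem_univ j), ← mul_assoc,
    if_pos rfl, integral_mul_expCut (ha j)]
  congr 1
  refine Finset.prod_congr rfl fun i hi => ?_
  rw [if_neg (Finset.ne_of_mem_erase hi), integral_expCut (ha i)]

/-- The contribution of a simplicial cone, in the coordinates given by its generators. -/
noncomputable def coneIntegrand (c a t : κ → ℝ) : ℝ :=
  ∑ j, c j * (t j * ∏ i, expCut (a i) (t i))

lemma integrable_coneIntegrand (c a : κ → ℝ) (ha : ∀ i, 0 < a i) :
    Integrable (coneIntegrand c a) :=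
  integrable_finsetSum _ fun j _ => (integrable_mul_prod_expCut a ha j).const_mul (c j)

lemma integral_coneIntegrand (c a : κ → ℝ) (ha : ∀ i, 0 < a i) :
    ∫ t, coneIntegrand c a t = ∑ j, c j * (1 / a j * ∏ i, 1 / a i) := by
  unfold coneIntegrand
  rw [integral_finsetSum _ fun j _ => (integrable_mul_prod_expCut a ha j).const_mul (c j)]
  exact Finset.sum_congr rfl fun j _ => by
    rw [integral_const_mul, integral_mul_prod_expCut a ha]

/-- Linear changes of coordinates multiply integrals by a constant. -/
lemma exists_integral_comp_equivFun {ι : Type*} [Fintype ι] (b : Module.Basis κ ℝ (ι → ℝ)) :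
    ∃ C : ℝ, ∀ G : (κ → ℝ) → ℝ, Integrable G →
      Integrable (fun x => G (b.equivFun x)) ∧ ∫ x, G (b.equivFun x) = C * ∫ t, G t := by
  let e : (ι → ℝ) ≃L[ℝ] (κ → ℝ) := b.equivFun.toContinuousLinearEquiv
  have he : MeasurableEmbedding e := e.toHomeomorph.measurableEmbedding
  let μ : Measure (κ → ℝ) := volume.map e
  have hμ : μ.IsAddHaarMeasure := e.isAddHaarMeasure_map volume
  obtain ⟨C, h⟩ : ∃ C : NNReal, μ = C • (volume : Measure (κ → ℝ)) :=
    ⟨_, Measure.isAddLeftInvariant_eq_smul μ volume⟩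
  refine ⟨C, fun G hG => ⟨?_, ?_⟩⟩
  · have : Integrable G μ := by
      rw [h]
      exact hG.smul_measure_nnreal
    exact (he.integrable_map_iff).1 this
  · have : ∫ x, G (e x) = ∫ t, G t ∂μ := (he.integral_map G).symm
    change ∫ x, G (e x) = _
    rw [this, h, integral_smul_nnreal_measure]
    rfl

end ConeIntegral

section Expectation
variable {m n k : ℕ}

lemma coneIntegrand_basis_eq (A : Fin m × Fin n → ℝ) (B : VBasis (genVec (m := m) (n := n) (k := k)))
    (x : Fin m × Fin n → ℝ) :
    coneIntegrand (fun b : B.1 => genCost b.1) (fun b => ∑ p, A p * genVec b.1 p)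
        (B.basis.equivFun x) =
      if ∀ b, 0 ≤ B.basis.equivFun x b then
        (∑ b : B.1, B.basis.equivFun x b * genCost b.1) * Real.exp (-∑ p, A p * x p)
      else 0 := by
  unfold coneIntegrand
  split_ifs with h
  · have h1 : ∏ b : B.1, expCut (∑ p, A p * genVec b.1 p) (B.basis.equivFun x b) =
        Real.exp (-∑ p, A p * x p) := by
      simp only [expCut, h, if_true]
      rw [← Real.exp_sum, Finset.sum_neg_distrib]
      congr 2
      have h2 := B.basis.sum_equivFun x
      simp only [VBasis.basis_apply] at h2
      conv_rhs => rw [← h2]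
      simp only [Finset.sum_apply, Pi.smul_apply, smul_eq_mul, Finset.mul_sum, Finset.sum_mul]
      rw [Finset.sum_comm]
      exact Finset.sum_congr rfl fun p _ => Finset.sum_congr rfl fun b _ => by ring
    rw [h1, Finset.sum_mul]
    exact Finset.sum_congr rfl fun b _ => by ring
  · push Not at h
    obtain ⟨b, hb⟩ := h
    have : ∏ b : B.1, expCut (∑ p, A p * genVec b.1 p) (B.basis.equivFun x b) = 0 :=
      Finset.prod_eq_zero (Finset.mem_univ b) (if_neg (not_le.2 hb))
    simp only [this, mul_zero, Finset.sum_const_zero]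

lemma Ek_eq_integral (A : Fin m → Fin n → ℝ) (hA : ∀ i j, 0 < A i j) :
    Ek m n k A = ∫ x : Fin m × Fin n → ℝ,
      (∏ p : Fin m × Fin n, if 0 ≤ x p then A p.1 p.2 * Real.exp (-(A p.1 p.2 * x p)) else 0) *
        minAssign m n k x := by
  unfold Ek rateMatrixMeasure
  have hmeas : Measurable fun x : Fin m × Fin n → ℝ =>
      ∏ p : Fin m × Fin n, if 0 ≤ x p then A p.1 p.2 * Real.exp (-(A p.1 p.2 * x p)) else 0 := by
    refine Finset.measurable_fun_prod _ fun p _ => ?_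
    exact Measurable.ite (measurableSet_le measurable_const (measurable_pi_apply p))
      (by fun_prop) measurable_const
  rw [integral_withDensity_eq_integral_toReal_smul hmeas.ennreal_ofReal
    (Filter.Eventually.of_forall fun _ => ENNReal.ofReal_lt_top)]
  refine integral_congr_ae (Filter.Eventually.of_forall fun x => ?_)
  simp only [smul_eq_mul]
  rw [ENNReal.toReal_ofReal]
  exact Finset.prod_nonneg fun p _ => by
    split_ifs
    · exact mul_nonneg (hA _ _).le (Real.exp_nonneg _)
    · exact le_rfl

lemma sum_mul_genVec_pos (hkm : k ≤ m) (hmn : m ≤ n) (A : Fin m → Fin n → ℝ)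
    (hA : ∀ i j, 0 < A i j) (v : Gen m n k) : 0 < ∑ p, A p.1 p.2 * genVec v p := by
  obtain ⟨p, hp⟩ := exists_genVec_pos hkm hmn v
  exact Finset.sum_pos' (fun p _ => mul_nonneg (hA _ _).le (genVec_nonneg v p))
    ⟨p, Finset.mem_univ _, mul_pos (hA _ _) hp⟩

/-- `E_k(A)` is a sum over finitely many simplicial cones, independent of `A`. -/
theorem exists_Ek_eq_sum (hk : 0 < k) (hkm : k ≤ m) (hmn : m ≤ n) :
    ∃ (𝓑 : Finset (VBasis (genVec (m := m) (n := n) (k := k)))) (C : VBasis (genVec (m := m) (n := n) (k := k)) → ℝ),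
      ∀ A : Fin m → Fin n → ℝ, (∀ i j, 0 < A i j) →
        Ek m n k A = ∑ B ∈ 𝓑, C B * (∑ b : B.1, genCost b.1 * (1 / ∑ p, A p.1 p.2 * genVec b.1 p)) *
          ((∏ p : Fin m × Fin n, A p.1 p.2) * ∏ b : B.1, 1 / ∑ p, A p.1 p.2 * genVec b.1 p) := by
  classical
  obtain ⟨𝓑, hpart, hopt⟩ := exists_simplicial_partition (genVec (m := m) (n := n) (k := k))
    genVec_nonneg (exists_genVec_pos hkm hmn) genCost
  choose C hC using fun B : VBasis (genVec (m := m) (n := n) (k := k)) =>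
    exists_integral_comp_equivFun B.basis
  refine ⟨𝓑, C, fun A hA => ?_⟩
  let a : Fin m × Fin n → ℝ := fun p => A p.1 p.2
  let G : VBasis (genVec (m := m) (n := n) (k := k)) → (Fin m × Fin n → ℝ) → ℝ := fun B x =>
    coneIntegrand (fun b : B.1 => genCost b.1) (fun b => ∑ p, a p * genVec b.1 p)
      (B.basis.equivFun x)
  have hae : ∀ᵐ x : Fin m × Fin n → ℝ,
      (∏ p : Fin m × Fin n, if 0 ≤ x p then A p.1 p.2 * Real.exp (-(A p.1 p.2 * x p)) else 0) *
        minAssign m n k x = (∏ p, a p) * ∑ B ∈ 𝓑, G B x := by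
    filter_upwards [hpart] with x hx
    simp only [G, coneIntegrand_basis_eq]
    by_cases h0 : ∀ p, 0 ≤ x p
    · obtain ⟨s, hs, hle⟩ := exists_rep_minAssign_le hk hkm hmn x h0
      obtain ⟨B, hB, hB0, huniq⟩ := hx ⟨s, hs⟩
      rw [Finset.sum_eq_single B, if_pos hB0]
      · have hval : ∑ b : B.1, B.basis.equivFun x b * genCost b.1 = minAssign m n k x := by
          refine le_antisymm ?_ (hle.trans (hopt B hB x s hs))
          have h1 : (fun v => if h : v ∈ B.1 then B.basis.equivFun x ⟨v, h⟩ else 0) ∈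
              nonnegReps (genVec (m := m) (n := n) (k := k)) x := by
            refine ⟨fun v => ?_, ?_⟩
            · dsimp only
              split_ifs
              · exact hB0 _
              · exact le_rfl
            · rw [sum_extend]
              have h2 := B.basis.sum_equivFun x
              simpa only [VBasis.basis_apply] using h2
          have h2 := sum_genCost_le_minAssign hkm hmn h1
          simp only [← smul_eq_mul (α := ℝ)] at h2 ⊢
          rwa [sum_extend] at h2
        rw [hval]
        simp only [h0, if_true, Finset.prod_mul_distrib, ← Real.exp_sum,
          Finset.sum_neg_distrib, a]
        ring
      · intro B' hB' hne
        rw [if_neg]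
        exact fun h => hne (huniq B' hB' h)
      · exact fun h => absurd hB h
    · have h1 : ∀ B ∈ 𝓑, (if ∀ b, 0 ≤ B.basis.equivFun x b then
          (∑ b : B.1, B.basis.equivFun x b * genCost b.1) * Real.exp (-∑ p, a p * x p)
          else 0) = 0 := by
        intro B _
        rw [if_neg]
        intro h
        apply h0
        intro p
        rw [← B.basis.sum_equivFun x]
        simp only [Finset.sum_apply, Pi.smul_apply, smul_eq_mul, VBasis.basis_apply]
        exact Finset.sum_nonneg fun b _ => mul_nonneg (h b) (genVec_nonneg _ _)
      rw [Finset.sum_eq_zero h1, mul_zero]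
      push Not at h0
      obtain ⟨p, hp⟩ := h0
      rw [Finset.prod_eq_zero (Finset.mem_univ p) (if_neg (not_le.2 hp)), zero_mul]
  have hpos : ∀ v : Gen m n k, 0 < ∑ p, a p * genVec v p := sum_mul_genVec_pos hkm hmn A hA
  have hcone := fun B : VBasis (genVec (m := m) (n := n) (k := k)) =>
    hC B _ (integrable_coneIntegrand (fun b : B.1 => genCost b.1)
      (fun b => ∑ p, a p * genVec b.1 p) fun b => hpos b.1)
  rw [Ek_eq_integral A hA, integral_congr_ae hae, integral_const_mul,
    integral_finsetSum _ fun B _ => (hcone B).1, Finset.mul_sum]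
  refine Finset.sum_congr rfl fun B _ => ?_
  rw [(hcone B).2, integral_coneIntegrand _ _ fun b : B.1 => hpos b.1]
  simp only [← mul_assoc, ← Finset.sum_mul, a]
  ring

end Expectation

section RationalForm
variable {m n : ℕ}

/-- `F A` is, for positive `A`, a polynomial in the entries of `A` divided by a product of sums of
all entries of `A` outside `i` rows and `j` columns with `i + j < k`. -/
def HasRationalForm (k : ℕ) (F : (Fin m → Fin n → ℝ) → ℝ) : Prop :=
  ∃ (P : MvPolynomial (Fin m × Fin n) ℝ) (e : Finset (Fin m) → Finset (Fin n) → ℕ),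
    (∀ I J, e I J ≠ 0 → I ≠ Finset.univ ∧ J ≠ Finset.univ ∧ I.card + J.card < k) ∧
    ∀ A : Fin m → Fin n → ℝ, (∀ i j, 0 < A i j) →
      F A = MvPolynomial.eval (fun p => A p.1 p.2) P /
        ∏ I : Finset (Fin m), ∏ J : Finset (Fin n), (∑ i ∈ Iᶜ, ∑ j ∈ Jᶜ, A i j) ^ e I J

variable {k : ℕ} {F G : (Fin m → Fin n → ℝ) → ℝ}

lemma sum_compl_pos {A : Fin m → Fin n → ℝ} (hA : ∀ i j, 0 < A i j) {I : Finset (Fin m)}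
    {J : Finset (Fin n)} (hI : I ≠ Finset.univ) (hJ : J ≠ Finset.univ) :
    0 < ∑ i ∈ Iᶜ, ∑ j ∈ Jᶜ, A i j := by
  have hI' : Iᶜ.Nonempty := by
    rwa [Finset.nonempty_iff_ne_empty, Ne, Finset.compl_eq_empty_iff]
  have hJ' : Jᶜ.Nonempty := by
    rwa [Finset.nonempty_iff_ne_empty, Ne, Finset.compl_eq_empty_iff]
  exact Finset.sum_pos (fun i _ => Finset.sum_pos (fun j _ => hA i j) hJ') hI'

lemma prod_sum_compl_pow_ne_zero {A : Fin m → Fin n → ℝ} (hA : ∀ i j, 0 < A i j)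
    {e : Finset (Fin m) → Finset (Fin n) → ℕ}
    (he : ∀ I J, e I J ≠ 0 → I ≠ Finset.univ ∧ J ≠ Finset.univ ∧ I.card + J.card < k) :
    ∏ I : Finset (Fin m), ∏ J : Finset (Fin n), (∑ i ∈ Iᶜ, ∑ j ∈ Jᶜ, A i j) ^ e I J ≠ 0 := by
  refine Finset.prod_ne_zero_iff.2 fun I _ => Finset.prod_ne_zero_iff.2 fun J _ => ?_
  by_cases h : e I J = 0
  · rw [h, pow_zero]
    exact one_ne_zero
  · obtain ⟨hI, hJ, -⟩ := he I J h
    exact pow_ne_zero _ (sum_compl_pos hA hI hJ).ne'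

namespace HasRationalForm

lemma congr (hF : HasRationalForm k F)
    (h : ∀ A : Fin m → Fin n → ℝ, (∀ i j, 0 < A i j) → G A = F A) : HasRationalForm k G := by
  obtain ⟨P, e, he, hP⟩ := hF
  exact ⟨P, e, he, fun A hA => (h A hA).trans (hP A hA)⟩

lemma eval (P : MvPolynomial (Fin m × Fin n) ℝ) :
    HasRationalForm k fun A => MvPolynomial.eval (fun p => A p.1 p.2) P :=
  ⟨P, 0, by simp, by simp⟩

lemma const (c : ℝ) : HasRationalForm k fun _ : Fin m → Fin n → ℝ => c :=
  (eval (MvPolynomial.C c)).congr fun A _ => by simp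

lemma coord (p : Fin m × Fin n) : HasRationalForm k fun A => A p.1 p.2 :=
  (eval (MvPolynomial.X p)).congr fun A _ => by simp

lemma mul (hF : HasRationalForm k F) (hG : HasRationalForm k G) :
    HasRationalForm k fun A => F A * G A := by
  obtain ⟨P, e, he, hP⟩ := hF
  obtain ⟨Q, f, hf, hQ⟩ := hG
  refine ⟨P * Q, e + f, fun I J h => ?_, fun A hA => ?_⟩
  · by_cases h0 : e I J = 0
    · exact hf I J fun h1 => h (by simp [h0, h1])
    · exact he I J h0
  · simp only [hP A hA, hQ A hA, map_mul, Pi.add_apply, pow_add, Finset.prod_mul_distrib,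
      div_mul_div_comm]

lemma add (hF : HasRationalForm k F) (hG : HasRationalForm k G) :
    HasRationalForm k fun A => F A + G A := by
  obtain ⟨P, e, he, hP⟩ := hF
  obtain ⟨Q, f, hf, hQ⟩ := hG
  let D : (Finset (Fin m) → Finset (Fin n) → ℕ) → MvPolynomial (Fin m × Fin n) ℝ := fun e =>
    ∏ I : Finset (Fin m), ∏ J : Finset (Fin n),
      (∑ i ∈ Iᶜ, ∑ j ∈ Jᶜ, MvPolynomial.X (i, j)) ^ e I J
  refine ⟨P * D f + D e * Q, e + f, fun I J h => ?_, fun A hA => ?_⟩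
  · by_cases h0 : e I J = 0
    · exact hf I J fun h1 => h (by simp [h0, h1])
    · exact he I J h0
  · simp only [hP A hA, hQ A hA, map_add, map_mul, Pi.add_apply, pow_add,
      Finset.prod_mul_distrib, D, map_prod, map_pow, map_sum, MvPolynomial.eval_X]
    exact div_add_div _ _ (prod_sum_compl_pow_ne_zero hA he) (prod_sum_compl_pow_ne_zero hA hf)

lemma sum {ι : Type*} (s : Finset ι) {F : ι → (Fin m → Fin n → ℝ) → ℝ}
    (h : ∀ i ∈ s, HasRationalForm k (F i)) : HasRationalForm k fun A => ∑ i ∈ s, F i A := by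
  classical
  induction s using Finset.induction_on with
  | empty => simpa using const 0
  | insert i s hi ih =>
    simp only [Finset.sum_insert hi]
    exact (h i (Finset.mem_insert_self i s)).add
      (ih fun j hj => h j (Finset.mem_insert_of_mem hj))

lemma prod {ι : Type*} (s : Finset ι) {F : ι → (Fin m → Fin n → ℝ) → ℝ}
    (h : ∀ i ∈ s, HasRationalForm k (F i)) : HasRationalForm k fun A => ∏ i ∈ s, F i A := by
  classical
  induction s using Finset.induction_on with
  | empty => simpa using const 1
  | insert i s hi ih =>
    simp only [Finset.prod_insert hi]
    exact (h i (Finset.mem_insert_self i s)).mul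
      (ih fun j hj => h j (Finset.mem_insert_of_mem hj))

lemma one_div_sum {I : Finset (Fin m)} {J : Finset (Fin n)} (hI : I ≠ Finset.univ)
    (hJ : J ≠ Finset.univ) (hIJ : I.card + J.card < k) :
    HasRationalForm k fun A => 1 / ∑ i ∈ Iᶜ, ∑ j ∈ Jᶜ, A i j := by
  classical
  refine ⟨1, fun I' J' => if I' = I ∧ J' = J then 1 else 0, fun I' J' h => ?_, fun A hA => ?_⟩
  · obtain ⟨rfl, rfl⟩ : I' = I ∧ J' = J := by
      by_contra h'
      exact h (if_neg h')
    exact ⟨hI, hJ, hIJ⟩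
  · rw [Finset.prod_eq_single I, Finset.prod_eq_single J]
    · simp
    · intro J' _ h
      simp [h]
    · simp
    · intro I' _ h
      simp [h]
    · simp

end HasRationalForm

end RationalForm

section Gen
variable {m n k : ℕ}

lemma sum_mul_genVec_inl (A : Fin m → Fin n → ℝ)
    (q : {q : Finset (Fin m) × Finset (Fin n) // q.1.card + q.2.card < k}) :
    ∑ p, A p.1 p.2 * genVec (Sum.inl q : Gen m n k) p =
      ∑ i ∈ q.1.1ᶜ, ∑ j ∈ q.1.2ᶜ, A i j := by
  rw [← Finset.sum_product', ← Finset.sum_subset (Finset.subset_univ (q.1.1ᶜ ×ˢ q.1.2ᶜ))]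
  · refine Finset.sum_congr rfl fun p hp => ?_
    have hp' : p.1 ∉ q.1.1 ∧ p.2 ∉ q.1.2 := by simpa using hp
    simp [genVec, hp']
  · intro p _ hp
    have hp' : ¬(p.1 ∉ q.1.1 ∧ p.2 ∉ q.1.2) := by simpa using hp
    simp only [genVec, Sum.elim_inl, if_neg hp', mul_zero]

lemma sum_mul_genVec_inr (A : Fin m → Fin n → ℝ) (r : Fin m × Fin n) :
    ∑ p, A p.1 p.2 * genVec (Sum.inr r : Gen m n k) p = A r.1 r.2 := by
  simp [genVec, Pi.single_apply]

lemma hasRationalForm_one_div_inl (hkm : k ≤ m) (hmn : m ≤ n)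
    (q : {q : Finset (Fin m) × Finset (Fin n) // q.1.card + q.2.card < k}) :
    HasRationalForm k fun A => 1 / ∑ p, A p.1 p.2 * genVec (Sum.inl q : Gen m n k) p := by
  have hq := q.2
  simp only [sum_mul_genVec_inl]
  refine HasRationalForm.one_div_sum ?_ ?_ hq
  · intro h
    rw [h, Finset.card_univ, Fintype.card_fin] at hq
    omega
  · intro h
    rw [h, Finset.card_univ, Fintype.card_fin] at hq
    omega

lemma hasRationalForm_genCost_mul (hkm : k ≤ m) (hmn : m ≤ n) (v : Gen m n k) :
    HasRationalForm k fun A => genCost v * (1 / ∑ p, A p.1 p.2 * genVec v p) := by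
  rcases v with q | r
  · exact (HasRationalForm.const _).mul (hasRationalForm_one_div_inl hkm hmn q)
  · simpa [genCost] using HasRationalForm.const 0

lemma hasRationalForm_prod (hkm : k ≤ m) (hmn : m ≤ n) (B : Finset (Gen m n k)) :
    HasRationalForm k fun A =>
      (∏ p : Fin m × Fin n, A p.1 p.2) * ∏ b : B, 1 / ∑ p, A p.1 p.2 * genVec b.1 p := by
  classical
  have h : HasRationalForm k fun A =>
      (∏ p : Fin m × Fin n, if (Sum.inr p : Gen m n k) ∈ B then 1 else A p.1 p.2) *
        ∏ q, if (Sum.inl q : Gen m n k) ∈ B then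
          1 / ∑ p, A p.1 p.2 * genVec (Sum.inl q : Gen m n k) p else 1 := by
    refine .mul (.prod _ fun p _ => ?_) (.prod _ fun q _ => ?_)
    · split_ifs
      · exact .const 1
      · exact .coord p
    · split_ifs
      · exact hasRationalForm_one_div_inl hkm hmn q
      · exact .const 1
  refine h.congr fun A hA => ?_
  have h1 : ∏ b : B, 1 / ∑ p, A p.1 p.2 * genVec b.1 p =
      ∏ v, if v ∈ B then 1 / ∑ p, A p.1 p.2 * genVec v p else 1 := by
    rw [Finset.prod_coe_sort B fun v => 1 / ∑ p, A p.1 p.2 * genVec v p,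
      Finset.prod_ite_mem, Finset.univ_inter]
  rw [h1, Fintype.prod_sum_type, mul_comm (∏ q, _) (∏ p, _), ← mul_assoc,
    ← Finset.prod_mul_distrib]
  congr 1
  refine Finset.prod_congr rfl fun p _ => ?_
  rw [sum_mul_genVec_inr]
  split_ifs
  · exact mul_one_div_cancel (hA _ _).ne'
  · exact mul_one _

end Gen

/-- `E_k(A)` is a rational function of the entries of `A`: a polynomial divided by a
product of factors, each the sum of all entries of `A` outside `i` rows and `j` columns
with `i + j < k`. -/
theorem Ek_rational (m n k : ℕ) (hk : 0 < k) (hkm : k ≤ m) (hmn : m ≤ n) :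
    ∃ (P : MvPolynomial (Fin m × Fin n) ℝ) (e : Finset (Fin m) → Finset (Fin n) → ℕ),
      (∀ I J, e I J ≠ 0 → I ≠ Finset.univ ∧ J ≠ Finset.univ ∧ I.card + J.card < k) ∧
      ∀ A : Fin m → Fin n → ℝ, (∀ i j, 0 < A i j) →
        Ek m n k A =
          MvPolynomial.eval (fun p => A p.1 p.2) P /
            ∏ I : Finset (Fin m), ∏ J : Finset (Fin n),
              (∑ i ∈ Iᶜ, ∑ j ∈ Jᶜ, A i j) ^ e I J := by
  obtain ⟨𝓑, C, h⟩ := exists_Ek_eq_sum hk hkm hmn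
  have hsum : HasRationalForm k (Ek m n k) := by
    refine HasRationalForm.congr (.sum 𝓑 fun B _ => ?_) h
    exact .mul (.mul (.const (C B)) (.sum _ fun b _ => hasRationalForm_genCost_mul hkm hmn b.1))
      (hasRationalForm_prod hkm hmn B.1)
  exact hsum
end

section
/- Let k ≤ m ≤ n and let X be a random exponential m×n matrix with rank 1 rate matrix A = (r_i c_j), where r_1,…,r_m and c_1,…,c_n are positive reals. Condition on the event that the minimum (k−1)-assignment of X uses exactly the first k−1 rows and first k−1 columns. Then almost surely the minimum k-assignment uses exactly one additional row and one additional column; for each i' ≥ k, the conditional probability that row i' is the additional row is r_{i'}/(r_k + ⋯ + r_m); for each j' ≥ k, the conditional probability that column j' is the additional column is c_{j'}/(c_k + ⋯ + c_n); and the additional row and the additional column are conditionally independent. -/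
open MeasureTheory ProbabilityTheory

/-- `S` is a `k`-assignment of the matrix `x` achieving `min_k(x)`. -/
def MinAssignF (m n k : ℕ) (x : Fin m × Fin n → ℝ) (S : Finset (Fin m × Fin n)) : Prop :=
  IsAssignF m n k S ∧ ∀ T, IsAssignF m n k T → ∑ p ∈ S, x p ≤ ∑ p ∈ T, x p

/-- The law of a random exponential `m × n` matrix with rank 1 rate matrix `(r i * c j)`:
the measure on `(Fin m × Fin n) → ℝ` with the product exponential density with respect
to Lebesgue measure. -/
noncomputable def rankOneMeasure (m n : ℕ) (r : Fin m → ℝ) (c : Fin n → ℝ) :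
    Measure ((Fin m × Fin n) → ℝ) :=
  volume.withDensity fun x => ENNReal.ofReal
    (∏ p : Fin m × Fin n,
      if 0 ≤ x p then (r p.1 * c p.2) * Real.exp (-((r p.1 * c p.2) * x p)) else 0)

/-- The first `t` rows of an `m × n` matrix, as a set of row indices. -/
def firstRows (m t : ℕ) : Finset (Fin m) := Finset.univ.filter fun i => (i : ℕ) < t

/-- The event that the minimum `(k−1)`-assignment uses exactly the first `k−1` rows and the
first `k−1` columns. -/
def condEvent (k m n : ℕ) : Set (Fin m × Fin n → ℝ) :=
  {x | ∃ S, MinAssignF m n (k - 1) x S ∧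
    S.image Prod.fst = firstRows m (k - 1) ∧ S.image Prod.snd = firstRows n (k - 1)}

/-- The event that the minimum `k`-assignment uses exactly the first `k−1` rows together
with the additional row `i'`. -/
def rowEvent (k m n : ℕ) (i' : Fin m) : Set (Fin m × Fin n → ℝ) :=
  {x | ∃ S, MinAssignF m n k x S ∧ S.image Prod.fst = insert i' (firstRows m (k - 1))}

/-- The event that the minimum `k`-assignment uses exactly the first `k−1` columns together
with the additional column `j'`. -/
def colEvent (k m n : ℕ) (j' : Fin n) : Set (Fin m × Fin n → ℝ) :=
  {x | ∃ S, MinAssignF m n k x S ∧ S.image Prod.snd = insert j' (firstRows n (k - 1))}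

/-- Pairing up the elements of a finite set of even size so that elements in a common fibre of `f`
are paired with each other. -/
theorem exists_pairing {ι γ : Type*} [DecidableEq ι] (f : ι → γ) (N : ℕ) :
    ∀ E : Finset ι, E.card = 2 * N →
      (∀ e₁ ∈ E, ∀ e₂ ∈ E, ∀ e₃ ∈ E, f e₁ = f e₂ → f e₂ = f e₃ → e₁ = e₂ ∨ e₂ = e₃ ∨ e₁ = e₃) →
      ∃ σ : ι → ι, ∀ e ∈ E, σ e ∈ E ∧ σ (σ e) = e ∧ σ e ≠ e ∧
        ∀ e' ∈ E, f e = f e' → e' = e ∨ e' = σ e := by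
  induction N with
  | zero =>
    intro E hE _
    have : E = ∅ := by simpa using hE
    exact ⟨id, by simp [this]⟩
  | succ N ih =>
    intro E hE h3
    have hab : ∃ a ∈ E, ∃ b ∈ E, a ≠ b ∧ (f a = f b ∨ Set.InjOn f E) := by
      by_cases hinj : Set.InjOn f E
      · obtain ⟨a, ha, b, hb, hne⟩ := Finset.one_lt_card.1 (show 1 < E.card by omega)
        exact ⟨a, ha, b, hb, hne, Or.inr hinj⟩
      · simp only [Set.InjOn, not_forall] at hinj
        obtain ⟨a, ha, b, hb, hf, hne⟩ := hinj
        exact ⟨a, ha, b, hb, hne, Or.inl hf⟩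
    obtain ⟨a, ha, b, hb, hne, hf⟩ := hab
    have hcard : ((E.erase a).erase b).card = 2 * N := by
      rw [Finset.card_erase_of_mem (by simp [hb, hne.symm]), Finset.card_erase_of_mem ha]
      omega
    obtain ⟨σ, hσ⟩ := ih ((E.erase a).erase b) hcard (by
      intro e₁ h₁ e₂ h₂ e₃ h₃
      simp only [Finset.mem_erase] at h₁ h₂ h₃
      exact h3 e₁ h₁.2.2 e₂ h₂.2.2 e₃ h₃.2.2)
    simp only [Finset.mem_erase] at hσ
    refine ⟨fun e => if e = a then b else if e = b then a else σ e, fun e he => ?_⟩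
    have key : ∀ e' ∈ E, f a = f b → f e' = f a → e' = a ∨ e' = b := by
      intro e' he' h1 h2
      have := h3 e' he' a ha b hb h2 h1
      tauto
    have hab' : ∀ e' ∈ E, (f a = f e' ∨ f b = f e') → e' = a ∨ e' = b := by
      intro e' he' h
      rcases hf with hf | hf
      · exact key e' he' hf (by rcases h with h | h <;> simp [h, hf])
      · rcases h with h | h
        · exact Or.inl (hf ha he' h).symm
        · exact Or.inr (hf hb he' h).symm
    by_cases hea : e = a
    · subst hea
      refine ⟨by simpa using hb, by simp [hne.symm], by simpa using hne.symm, fun e' he' h => ?_⟩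
      simpa using hab' e' he' (Or.inl h)
    by_cases heb : e = b
    · subst heb
      refine ⟨by simpa [hea] using ha, by simp [hea], by simpa [hea] using hne, fun e' he' h => ?_⟩
      simpa [hea, or_comm] using hab' e' he' (Or.inr h)
    obtain ⟨⟨h1, h2, h3'⟩, h4, h5, h6⟩ := hσ e ⟨heb, hea, he⟩
    simp only [if_neg hea, if_neg heb, if_neg h1, if_neg h2]
    refine ⟨h3', h4, h5, fun e' he' h => h6 e' ⟨?_, ?_, he'⟩ h⟩
    · rintro rfl
      exact (hab' e he (Or.inr h.symm)).elim hea heb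
    · rintro rfl
      exact (hab' e he (Or.inl h.symm)).elim hea heb

/-- Two fixed-point-free involutions of a finite set are simultaneously reversed by some
two-colouring. -/
theorem exists_two_colouring {ι : Type*} [Fintype ι] [DecidableEq ι] (σ τ : Equiv.Perm ι)
    (hσ : ∀ e, σ (σ e) = e) (hτ : ∀ e, τ (τ e) = e) (hσ' : ∀ e, σ e ≠ e) (hτ' : ∀ e, τ e ≠ e) :
    ∃ C : Finset ι, (∀ e, σ e ∈ C ↔ e ∉ C) ∧ (∀ e, τ e ∈ C ↔ e ∉ C) := by
  classical
  set π : Equiv.Perm ι := σ * τ with hπ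
  have hττ : τ * τ = 1 := Equiv.ext hτ
  have hσσ : σ * σ = 1 := Equiv.ext hσ
  have hτi : τ⁻¹ = τ := inv_eq_of_mul_eq_one_left hττ
  have hσi : σ⁻¹ = σ := inv_eq_of_mul_eq_one_left hσσ
  have hconj : τ * π * τ⁻¹ = π⁻¹ := by
    rw [hπ, mul_inv_rev, hτi, hσi, mul_assoc, mul_assoc, hττ, mul_one]
  have hpow : ∀ n : ℤ, ∀ e, τ ((π ^ n) e) = (π ^ (-n)) (τ e) := by
    intro n e
    have : τ * π ^ n * τ⁻¹ = π ^ (-n) := by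
      rw [← conj_zpow, hconj, inv_zpow, zpow_neg]
    rw [← this]
    simp [hτi, hτ]
  have hnot : ∀ e, ¬ π.SameCycle e (τ e) := by
    rintro e ⟨n, hn⟩
    obtain ⟨l, rfl | rfl⟩ := Int.even_or_odd' n
    · apply hτ' ((π ^ l) e)
      rw [hpow, ← hn, ← Equiv.Perm.mul_apply, ← zpow_add]
      congr 2
      ring
    · apply hσ' (τ ((π ^ l) e))
      have h1 : σ (τ ((π ^ l) e)) = (π ^ (1 + l)) e := by
        rw [zpow_add, zpow_one]; rfl
      rw [h1, hpow, ← hn, ← Equiv.Perm.mul_apply, ← zpow_add]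
      congr 2
      ring
  let key : ι → Fin (Fintype.card (Quotient (Equiv.Perm.SameCycle.setoid π))) := fun e =>
    Fintype.equivFin _ (Quotient.mk (Equiv.Perm.SameCycle.setoid π) e)
  have hkey : ∀ e e', key e = key e' ↔ π.SameCycle e e' := by
    intro e e'
    simp only [key, EmbeddingLike.apply_eq_iff_eq]
    exact Quotient.eq
  have hkτ : ∀ e, key e ≠ key (τ e) := fun e h => hnot e ((hkey _ _).1 h)
  have hkσ : ∀ e, key (σ e) = key (τ e) := by
    intro e
    refine ((hkey _ _).2 ⟨1, ?_⟩).symm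
    simp [hπ, hτ]
  have hkτσ : ∀ e, key (τ (σ e)) = key e := by
    intro e
    refine (hkey _ _).2 ⟨1, ?_⟩
    simp [hπ, hτ, hσ]
  refine ⟨Finset.univ.filter fun e => key e < key (τ e), fun e => ?_, fun e => ?_⟩
  · simp only [Finset.mem_filter, Finset.mem_univ, true_and, hkσ, hkτσ, not_lt]
    exact ⟨le_of_lt, fun h => lt_of_le_of_ne h (hkτ e).symm⟩
  · simp only [Finset.mem_filter, Finset.mem_univ, true_and, hτ, not_lt]
    exact ⟨le_of_lt, fun h => lt_of_le_of_ne h (hkτ e).symm⟩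

/-- No value of `a` is taken more than twice. -/
def AtMostTwo {ι α : Type*} (a : ι → α) : Prop :=
  ∀ e₁ e₂ e₃, a e₁ = a e₂ → a e₂ = a e₃ → e₁ = e₂ ∨ e₂ = e₃ ∨ e₁ = e₃

theorem exists_involution {ι α : Type*} [Fintype ι] {a : ι → α} (hι : Even (Fintype.card ι))
    (ha : AtMostTwo a) :
    ∃ σ : Equiv.Perm ι, (∀ e, σ (σ e) = e) ∧ (∀ e, σ e ≠ e) ∧
      ∀ e e', a e = a e' → e' = e ∨ e' = σ e := by
  classical
  obtain ⟨N, hN⟩ := hι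
  obtain ⟨σ, hσ⟩ := exists_pairing a N Finset.univ (by rw [Finset.card_univ]; omega)
    fun e₁ _ e₂ _ e₃ _ => ha e₁ e₂ e₃
  have hinv : Function.Involutive σ := fun e => (hσ e (Finset.mem_univ e)).2.1
  exact ⟨hinv.toPerm, hinv, fun e => (hσ e (Finset.mem_univ e)).2.2.1,
    fun e e' => (hσ e (Finset.mem_univ e)).2.2.2 e' (Finset.mem_univ e')⟩

theorem exists_even_split {ι α β : Type*} [Fintype ι] [DecidableEq ι] (a : ι → α) (b : ι → β)
    (hι : Even (Fintype.card ι)) (ha : AtMostTwo a) (hb : AtMostTwo b) :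
    ∃ C : Finset ι, (Set.InjOn a C ∧ Set.InjOn b C) ∧
      (Set.InjOn a (Cᶜ : Finset ι) ∧ Set.InjOn b (Cᶜ : Finset ι)) ∧
      2 * C.card = Fintype.card ι := by
  obtain ⟨σ, hσ, hσ', hσa⟩ := exists_involution hι ha
  obtain ⟨τ, hτ, hτ', hτb⟩ := exists_involution hι hb
  obtain ⟨C, hCσ, hCτ⟩ := exists_two_colouring σ τ hσ hτ hσ' hτ'
  have hcard : C.card = Cᶜ.card := by
    refine Finset.card_bij (fun e _ => σ e) (fun e he => ?_) (fun e _ e' _ h => σ.injective h)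
      (fun e he => ⟨σ e, ?_, hσ e⟩)
    · simpa [hCσ] using he
    · simpa [hCσ] using he
  refine ⟨C, ⟨?_, ?_⟩, ⟨?_, ?_⟩, ?_⟩
  · intro e he e' he' h
    rcases hσa e e' h with h | h
    · exact h.symm
    · exact absurd he ((hCσ e).1 (h ▸ he'))
  · intro e he e' he' h
    rcases hτb e e' h with h | h
    · exact h.symm
    · exact absurd he ((hCτ e).1 (h ▸ he'))
  · intro e he e' he' h
    rcases hσa e e' h with h | h
    · exact h.symm
    · have h1 := (hCσ e).2 (by simpa using he)
      rw [← h] at h1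
      exact absurd h1 (by simpa using he')
  · intro e he e' he' h
    rcases hτb e e' h with h | h
    · exact h.symm
    · have h1 := (hCτ e).2 (by simpa using he)
      rw [← h] at h1
      exact absurd h1 (by simpa using he')
  · have := Finset.card_compl_add_card C
    omega

theorem AtMostTwo.option {ι α : Type*} {a : ι → α} (ha : AtMostTwo a) :
    AtMostTwo (Option.map a) := by
  rintro (_ | e₁) (_ | e₂) (_ | e₃) h₁ h₂ <;> simp at h₁ h₂ ⊢
  exact ha e₁ e₂ e₃ h₁ h₂

/-- The edges of a bipartite multigraph of maximum degree two split into two matchings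
whose sizes differ by at most one. -/
theorem exists_balanced_split {ι α β : Type*} [Fintype ι] [DecidableEq ι] (a : ι → α) (b : ι → β)
    (ha : AtMostTwo a) (hb : AtMostTwo b) :
    ∃ C : Finset ι, (Set.InjOn a C ∧ Set.InjOn b C) ∧
      (Set.InjOn a (Cᶜ : Finset ι) ∧ Set.InjOn b (Cᶜ : Finset ι)) ∧
      C.card = Fintype.card ι / 2 := by
  rcases Nat.even_or_odd (Fintype.card ι) with hι | hι
  · obtain ⟨C, h1, h2, h3⟩ := exists_even_split a b hι ha hb
    exact ⟨C, h1, h2, by omega⟩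
  · have hcard : Fintype.card (Option ι) = Fintype.card ι + 1 := Fintype.card_option
    obtain ⟨C, h1, h2, h3⟩ := exists_even_split (Option.map a) (Option.map b)
      (by rw [hcard]; exact hι.add_one) ha.option hb.option
    have pulla : ∀ (D : Finset (Option ι)) (D' : Finset ι),
        (∀ e ∈ D', some e ∈ D) → Set.InjOn (Option.map a) D → Set.InjOn a D' :=
      fun D D' hD hg e he e' he' h =>
        Option.some_injective _ (hg (hD e he) (hD e' he') (by simp [h]))
    have pullb : ∀ (D : Finset (Option ι)) (D' : Finset ι),
        (∀ e ∈ D', some e ∈ D) → Set.InjOn (Option.map b) D → Set.InjOn b D' :=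
      fun D D' hD hg e he e' he' h =>
        Option.some_injective _ (hg (hD e he) (hD e' he') (by simp [h]))
    obtain ⟨N, hN⟩ := hι
    have mem : ∀ D : Finset (Option ι), ∀ e ∈ Finset.eraseNone D, some e ∈ D := by simp
    have memc : ∀ D D' : Finset (Option ι), D' = Dᶜ →
        ∀ e ∈ (Finset.eraseNone D)ᶜ, some e ∈ D' := by
      rintro D D' rfl
      simp
    by_cases hnone : none ∈ C
    · refine ⟨Finset.eraseNone C, ⟨pulla _ _ (mem C) h1.1, pullb _ _ (mem C) h1.2⟩,
        ⟨pulla _ _ (memc C _ rfl) h2.1, pullb _ _ (memc C _ rfl) h2.2⟩, ?_⟩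
      have := Finset.card_eraseNone_of_mem hnone
      omega
    · refine ⟨Finset.eraseNone Cᶜ, ⟨pulla _ _ (mem Cᶜ) h2.1, pullb _ _ (mem Cᶜ) h2.2⟩,
        ⟨pulla _ _ (memc Cᶜ C (by simp)) h1.1, pullb _ _ (memc Cᶜ C (by simp)) h1.2⟩, ?_⟩
      have := Finset.card_compl_add_card C
      have := Finset.card_eraseNone_of_mem (s := Cᶜ) (by simpa using hnone)
      omega

section Assignments

variable {m n l : ℕ} {S T : Finset (Fin m × Fin n)} {x : Fin m × Fin n → ℝ}

theorem IsAssignF.injOn_fst (h : IsAssignF m n l S) : Set.InjOn Prod.fst (S : Set (Fin m × Fin n)) :=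
  fun p hp q hq hpq => by_contra fun hne => (h.2 p hp q hq hne).1 hpq

theorem IsAssignF.injOn_snd (h : IsAssignF m n l S) : Set.InjOn Prod.snd (S : Set (Fin m × Fin n)) :=
  fun p hp q hq hpq => by_contra fun hne => (h.2 p hp q hq hne).2 hpq

theorem isAssignF_image {ι : Type*} [DecidableEq ι] {pos : ι → Fin m × Fin n} {C : Finset ι}
    (h₁ : Set.InjOn (fun e => (pos e).1) C) (h₂ : Set.InjOn (fun e => (pos e).2) C) :
    IsAssignF m n C.card (C.image pos) := by
  refine ⟨Finset.card_image_of_injOn fun e he e' he' h => h₁ he he' (congrArg Prod.fst h), ?_⟩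
  simp only [Finset.mem_image]
  rintro _ ⟨e, he, rfl⟩ _ ⟨e', he', rfl⟩ hne
  exact ⟨fun h => hne (congrArg pos (h₁ he he' h)), fun h => hne (congrArg pos (h₂ he he' h))⟩

/-- A family of positions using each (merged) row and column at most twice can be rearranged into
two assignments of nearly equal size. -/
theorem exists_assign_split {ι α : Type*} [Fintype ι] [DecidableEq ι]
    (pos : ι → Fin m × Fin n) (a : Fin m → α)
    (ha : AtMostTwo fun e => a (pos e).1) (hb : AtMostTwo fun e => (pos e).2)
    (hcard : Fintype.card ι = l + l ∨ Fintype.card ι = l + (l + 1)) :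
    ∃ C : Finset ι, IsAssignF m n l (C.image pos) ∧
      IsAssignF m n (Fintype.card ι - l) (Cᶜ.image pos) ∧
      (∀ x : Fin m × Fin n → ℝ,
        ∑ p ∈ C.image pos, x p + ∑ p ∈ Cᶜ.image pos, x p = ∑ e, x (pos e)) ∧
      Set.InjOn (fun e => a (pos e).1) (Cᶜ : Finset ι) := by
  obtain ⟨C, ⟨h1, h2⟩, ⟨h3, h4⟩, hC⟩ := exists_balanced_split _ _ ha hb
  have inj : ∀ D : Finset ι, Set.InjOn (fun e => a (pos e).1) D →
      Set.InjOn (fun e => (pos e).1) D :=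
    fun D hD e he e' he' h => hD he he' (congrArg a h)
  have hCl : C.card = l := by omega
  have hCc : Cᶜ.card = Fintype.card ι - l := by
    have := Finset.card_compl_add_card C
    omega
  refine ⟨C, hCl ▸ isAssignF_image (inj C h1) h2, hCc ▸ isAssignF_image (inj Cᶜ h3) h4,
    fun x => ?_, h3⟩
  rw [Finset.sum_image fun e he e' he' h => h2 he he' (congrArg Prod.snd h),
    Finset.sum_image fun e he e' he' h => h4 he he' (congrArg Prod.snd h),
    Finset.sum_add_sum_compl]

/-- Moving the position `q` to another position `p` in its row, both in columns not used by the
minimal assignment `S`, does not bring the weight of an assignment below the minimum. -/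
theorem le_sum_redirect {k : ℕ} {p q : Fin m × Fin n} (hS : MinAssignF m n l x S)
    (hpq : p.1 = q.1) (hp : p.2 ∉ S.image Prod.snd) (hq : q.2 ∉ S.image Prod.snd)
    (hT : IsAssignF m n k T) (hk : k = l ∨ k = l + 1) {M : ℝ}
    (hM : ∀ T', IsAssignF m n k T' → M ≤ ∑ t ∈ T', x t) :
    M ≤ ∑ t ∈ T, x (if t = q then p else t) := by
  classical
  let pos : S ⊕ T → Fin m × Fin n :=
    Sum.elim (fun s => s.1) (fun t => if t.1 = q then p else t.1)
  have hcard : Fintype.card (S ⊕ T) = l + k := by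
    simp [hS.1.1, hT.1]
  have hp' : ∀ s ∈ S, s.2 ≠ p.2 := fun s hs h => hp (h ▸ Finset.mem_image_of_mem _ hs)
  have hq' : ∀ s ∈ S, s.2 ≠ q.2 := fun s hs h => hq (h ▸ Finset.mem_image_of_mem _ hs)
  have hS1 : ∀ s ∈ S, ∀ s' ∈ S, s.1 = s'.1 → s = s' := fun s hs s' hs' h => hS.1.injOn_fst hs hs' h
  have hS2 : ∀ s ∈ S, ∀ s' ∈ S, s.2 = s'.2 → s = s' := fun s hs s' hs' h => hS.1.injOn_snd hs hs' h
  have hT1 : ∀ s ∈ T, ∀ s' ∈ T, s.1 = s'.1 → s = s' := fun s hs s' hs' h => hT.injOn_fst hs hs' h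
  have hT2 : ∀ s ∈ T, ∀ s' ∈ T, s.2 = s'.2 → s = s' := fun s hs s' hs' h => hT.injOn_snd hs hs' h
  obtain ⟨C, h1, h2, h3, -⟩ := exists_assign_split (l := l) pos id
    (by
      rintro (⟨e₁, h₁⟩ | ⟨e₁, h₁⟩) (⟨e₂, h₂⟩ | ⟨e₂, h₂⟩) (⟨e₃, h₃⟩ | ⟨e₃, h₃⟩) <;>
        simp only [pos, Sum.elim_inl, Sum.elim_inr, id, Sum.inl.injEq, Sum.inr.injEq,
          Subtype.mk.injEq, reduceCtorEq, false_or, or_false] <;> grind)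
    (by
      rintro (⟨e₁, h₁⟩ | ⟨e₁, h₁⟩) (⟨e₂, h₂⟩ | ⟨e₂, h₂⟩) (⟨e₃, h₃⟩ | ⟨e₃, h₃⟩) <;>
        simp only [pos, Sum.elim_inl, Sum.elim_inr, Sum.inl.injEq, Sum.inr.injEq,
          Subtype.mk.injEq, reduceCtorEq, false_or, or_false] <;> grind)
    (by omega)
  have hsum := h3 x
  rw [Fintype.sum_sum_type] at hsum
  simp only [pos, Sum.elim_inl, Sum.elim_inr] at hsum
  rw [Finset.sum_coe_sort S x, Finset.sum_coe_sort T fun t => x (if t = q then p else t)] at hsum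
  have h4 := hS.2 _ h1
  have h5 := hM _ (by rwa [hcard, Nat.add_sub_cancel_left] at h2)
  linarith

theorem MinAssignF.fst_image_subset (hx : Function.Injective fun U : Finset (Fin m × Fin n) =>
    ∑ p ∈ U, x p) (hS : MinAssignF m n l x S) (hT : MinAssignF m n (l + 1) x T) :
    S.image Prod.fst ⊆ T.image Prod.fst := by
  classical
  intro i hi
  by_contra hiT
  have hSc : (S.image Prod.fst).card = l := by
    rw [Finset.card_image_of_injOn hS.1.injOn_fst, hS.1.1]
  have hTc : (T.image Prod.fst).card = l + 1 := by
    rw [Finset.card_image_of_injOn hT.1.injOn_fst, hT.1.1]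
  have h2 : 1 < (T.image Prod.fst \ S.image Prod.fst).card := by
    have h3 : T.image Prod.fst ∩ S.image Prod.fst ⊆ (S.image Prod.fst).erase i := by
      intro j hj
      rw [Finset.mem_inter] at hj
      exact Finset.mem_erase.2 ⟨fun h => hiT (h ▸ hj.1), hj.2⟩
    have h4 := Finset.card_le_card h3
    rw [Finset.card_erase_of_mem hi] at h4
    have h5 := Finset.card_sdiff_add_card_inter (T.image Prod.fst) (S.image Prod.fst)
    have h6 := Finset.card_pos.2 ⟨i, hi⟩
    omega
  obtain ⟨i₁, hi₁, i₂, hi₂, hne⟩ := Finset.one_lt_card.1 h2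
  rw [Finset.mem_sdiff] at hi₁ hi₂
  have hs₁ : ∀ s ∈ S, s.1 ≠ i₁ := fun s hs h => hi₁.2 (h ▸ Finset.mem_image_of_mem _ hs)
  have hs₂ : ∀ s ∈ S, s.1 ≠ i₂ := fun s hs h => hi₂.2 (h ▸ Finset.mem_image_of_mem _ hs)
  obtain ⟨t₁, ht₁, rfl⟩ := Finset.mem_image.1 hi₁.1
  obtain ⟨t₂, ht₂, rfl⟩ := Finset.mem_image.1 hi₂.1
  let pos : S ⊕ T → Fin m × Fin n := Sum.elim (fun s => s.1) (fun t => t.1)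
  have hcard : Fintype.card (S ⊕ T) = l + (l + 1) := by
    simp [hS.1.1, hT.1.1]
  have hS1 : ∀ s ∈ S, ∀ s' ∈ S, s.1 = s'.1 → s = s' := fun s hs s' hs' h => hS.1.injOn_fst hs hs' h
  have hS2 : ∀ s ∈ S, ∀ s' ∈ S, s.2 = s'.2 → s = s' := fun s hs s' hs' h => hS.1.injOn_snd hs hs' h
  have hT1 : ∀ s ∈ T, ∀ s' ∈ T, s.1 = s'.1 → s = s' := fun s hs s' hs' h => hT.1.injOn_fst hs hs' h
  have hT2 : ∀ s ∈ T, ∀ s' ∈ T, s.2 = s'.2 → s = s' := fun s hs s' hs' h => hT.1.injOn_snd hs hs' h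
  obtain ⟨C, h1, h2, h3, h4⟩ := exists_assign_split (l := l) pos
    (fun i => if i = t₂.1 then t₁.1 else i)
    (by
      rintro (⟨e₁, h₁⟩ | ⟨e₁, h₁⟩) (⟨e₂, h₂⟩ | ⟨e₂, h₂⟩) (⟨e₃, h₃⟩ | ⟨e₃, h₃⟩) <;>
        simp only [pos, Sum.elim_inl, Sum.elim_inr, Sum.inl.injEq, Sum.inr.injEq,
          Subtype.mk.injEq, reduceCtorEq, false_or, or_false] <;> grind)
    (by
      rintro (⟨e₁, h₁⟩ | ⟨e₁, h₁⟩) (⟨e₂, h₂⟩ | ⟨e₂, h₂⟩) (⟨e₃, h₃⟩ | ⟨e₃, h₃⟩) <;>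
        simp only [pos, Sum.elim_inl, Sum.elim_inr, Sum.inl.injEq, Sum.inr.injEq,
          Subtype.mk.injEq, reduceCtorEq, false_or, or_false] <;> grind)
    (Or.inr hcard)
  have hsum := h3 x
  rw [Fintype.sum_sum_type] at hsum
  simp only [pos, Sum.elim_inl, Sum.elim_inr] at hsum
  rw [Finset.sum_coe_sort S x, Finset.sum_coe_sort T x] at hsum
  rw [hcard, Nat.add_sub_cancel_left] at h2
  have h5 := hS.2 _ h1
  have h6 := hT.2 _ h2
  have hCS : C.image pos = S := hx (by simp only [pos]; linarith)
  have hmem : Sum.inr ⟨t₁, ht₁⟩ ∈ C ∨ Sum.inr ⟨t₂, ht₂⟩ ∈ C := by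
    by_contra! h
    have := h4 (Finset.mem_coe.2 (Finset.mem_compl.2 h.1))
      (Finset.mem_coe.2 (Finset.mem_compl.2 h.2))
      (by
        change (if t₁.1 = t₂.1 then t₁.1 else t₁.1) = (if t₂.1 = t₂.1 then t₁.1 else t₂.1)
        simp)
    rw [Sum.inr.injEq, Subtype.mk.injEq] at this
    exact hne (congrArg Prod.fst this)
  rcases hmem with h | h
  · exact hs₁ t₁ (hCS ▸ Finset.mem_image_of_mem pos h) rfl
  · exact hs₂ t₂ (hCS ▸ Finset.mem_image_of_mem pos h) rfl

theorem MinAssignF.exists_fst_image_eq_insert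
    (hx : Function.Injective fun U : Finset (Fin m × Fin n) => ∑ p ∈ U, x p)
    (hS : MinAssignF m n l x S) (hT : MinAssignF m n (l + 1) x T) :
    ∃ i ∉ S.image Prod.fst, T.image Prod.fst = insert i (S.image Prod.fst) := by
  obtain ⟨i, hi, h⟩ := Finset.exists_eq_insert_iff.2 ⟨hS.fst_image_subset hx hT, by
    rw [Finset.card_image_of_injOn hS.1.injOn_fst, Finset.card_image_of_injOn hT.1.injOn_fst,
      hS.1.1, hT.1.1]⟩
  exact ⟨i, hi, h.symm⟩

theorem IsAssignF.swap (h : IsAssignF m n l S) : IsAssignF n m l (S.image Prod.swap) := by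
  refine ⟨(Finset.card_image_of_injective _ Prod.swap_injective).trans h.1, ?_⟩
  simp only [Finset.mem_image]
  rintro _ ⟨p, hp, rfl⟩ _ ⟨q, hq, rfl⟩ hne
  exact (h.2 p hp q hq fun hpq => hne (congrArg _ hpq)).symm

theorem MinAssignF.swap (h : MinAssignF m n l x S) :
    MinAssignF n m l (x ∘ Prod.swap) (S.image Prod.swap) := by
  refine ⟨h.1.swap, fun U hU => ?_⟩
  have h1 := h.2 _ hU.swap
  rw [Finset.sum_image Prod.swap_injective.injOn] at h1 ⊢
  simpa using h1

theorem image_fst_image_swap : (S.image Prod.swap).image Prod.fst = S.image Prod.snd := by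
  rw [Finset.image_image]; rfl

theorem image_snd_image_swap : (S.image Prod.swap).image Prod.snd = S.image Prod.fst := by
  rw [Finset.image_image]; rfl

theorem MinAssignF.exists_snd_image_eq_insert
    (hx : Function.Injective fun U : Finset (Fin m × Fin n) => ∑ p ∈ U, x p)
    (hS : MinAssignF m n l x S) (hT : MinAssignF m n (l + 1) x T) :
    ∃ j ∉ S.image Prod.snd, T.image Prod.snd = insert j (S.image Prod.snd) := by
  have := hS.swap.exists_fst_image_eq_insert (fun U V hUV => ?_) hT.swap
  · simpa only [image_fst_image_swap] using this
  · refine Finset.image_injective Prod.swap_injective (hx ?_)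
    simpa [Finset.sum_image Prod.swap_injective.injOn] using hUV

theorem exists_minAssignF (hm : l ≤ m) (hn : l ≤ n) (x : Fin m × Fin n → ℝ) :
    ∃ S, MinAssignF m n l x S := by
  classical
  have hne : (Finset.univ.filter fun S => IsAssignF m n l S).Nonempty := by
    refine ⟨Finset.univ.image fun i : Fin l => (Fin.castLE hm i, Fin.castLE hn i), ?_⟩
    simp only [Finset.mem_filter, Finset.mem_univ, true_and]
    have := isAssignF_image (C := Finset.univ)
      (pos := fun i : Fin l => (Fin.castLE hm i, Fin.castLE hn i))
      (Fin.castLE_injective hm).injOn (Fin.castLE_injective hn).injOn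
    rwa [Finset.card_univ, Fintype.card_fin] at this
  obtain ⟨S, hS, hmin⟩ := Finset.exists_min_image _ (fun S => ∑ p ∈ S, x p) hne
  simp only [Finset.mem_filter, Finset.mem_univ, true_and] at hS hmin
  exact ⟨S, hS, hmin⟩

end Assignments

/-- The minimal `l`-assignment uses the rows `R` and columns `K`, and the minimal
`(l + 1)`-assignment uses the rows `R ∪ {i}` and columns `K ∪ {j}` and contains `p`. -/
def augEvent (m n l : ℕ) (R : Finset (Fin m)) (K : Finset (Fin n)) (i : Fin m) (j : Fin n)
    (p : Fin m × Fin n) : Set (Fin m × Fin n → ℝ) :=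
  {x | ∃ S T, (MinAssignF m n l x S ∧ S.image Prod.fst = R ∧ S.image Prod.snd = K) ∧
    MinAssignF m n (l + 1) x T ∧ T.image Prod.fst = insert i R ∧ T.image Prod.snd = insert j K ∧
      p ∈ T}

/-- The linear map with `x_q ↦ x_p` and `x_p ↦ x_p + ρ (x_q - x_p)`. -/
def exchange {ι : Type*} [DecidableEq ι] (ρ : ℝ) (p q : ι) (x : ι → ℝ) : ι → ℝ :=
  fun e => if e = p then x p + ρ * (x q - x p) else if e = q then x p else x e

section Exchange

variable {m n l : ℕ} {x : Fin m × Fin n → ℝ} {R : Finset (Fin m)} {K : Finset (Fin n)}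
  {i : Fin m} {j : Fin n} {p q : Fin m × Fin n} {ρ : ℝ}

theorem swap_mem_augEvent (h : x ∈ augEvent m n l R K i j p) :
    x ∘ Prod.swap ∈ augEvent n m l K R j i p.swap := by
  obtain ⟨S, T, ⟨hS, hR, hK⟩, hT, hi, hj, hp⟩ := h
  refine ⟨S.image Prod.swap, T.image Prod.swap, ⟨hS.swap, ?_, ?_⟩, hT.swap, ?_, ?_,
    Finset.mem_image_of_mem _ hp⟩
  all_goals simpa only [image_fst_image_swap, image_snd_image_swap]

theorem exchange_comp_swap :
    exchange ρ p q x ∘ Prod.swap = exchange ρ p.swap q.swap (x ∘ Prod.swap) := by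
  funext e
  have h : ∀ e' : Fin m × Fin n, e.swap = e' ↔ e = e'.swap := fun e' => by
    constructor
    · rintro rfl; simp
    · rintro rfl; simp
  simp [exchange, h]

theorem exchange_mem_augEvent_col (hne : p ≠ q) (hrow : p.1 = q.1) (hp : p.2 ∉ K) (hq : q.2 ∉ K)
    (hρ : 0 ≤ ρ) (hx : x ∈ augEvent m n l R K i p.2 p) :
    x p ≤ x q ∧ exchange ρ p q x ∈ augEvent m n l R K i q.2 q := by
  obtain ⟨S, T, ⟨hS, hR, hK⟩, hT, hi, hj, hpT⟩ := hx
  have hcol : p.2 ≠ q.2 := fun h => hne (Prod.ext hrow h)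
  have hqT : q ∉ T := fun h => by
    have := Finset.mem_image_of_mem Prod.snd h
    rw [hj, Finset.mem_insert] at this
    exact this.elim (fun h => hcol h.symm) hq
  have hpS : p ∉ S := fun h => hp (hK ▸ Finset.mem_image_of_mem _ h)
  have hqS : q ∉ S := fun h => hq (hK ▸ Finset.mem_image_of_mem _ h)
  have hT1 : ∀ t ∈ T, t.1 = p.1 → t = p := fun t ht h => hT.1.injOn_fst ht hpT h
  have hT2 : ∀ t ∈ T, t.2 ≠ q.2 := fun t ht h => by
    have := Finset.mem_image_of_mem Prod.snd ht
    rw [hj, Finset.mem_insert, h] at this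
    exact this.elim (fun h => hcol h.symm) hq
  set U := insert q (T.erase p) with hU
  have hqe : q ∉ T.erase p := fun h => hqT (Finset.mem_of_mem_erase h)
  have hUa : IsAssignF m n (l + 1) U := by
    refine ⟨?_, ?_⟩
    · rw [hU, Finset.card_insert_of_notMem hqe, Finset.card_erase_of_mem hpT, hT.1.1]
      rfl
    · have h2 := hT.1.2
      simp only [hU, Finset.mem_insert, Finset.mem_erase]
      rintro a (rfl | ⟨ha, haT⟩) b (rfl | ⟨hb, hbT⟩) hab
      · exact absurd rfl hab
      · exact ⟨fun h => hb (hT1 b hbT (by rw [hrow, h])), fun h => hT2 b hbT h.symm⟩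
      · exact ⟨fun h => ha (hT1 a haT (by rw [hrow, h])), fun h => hT2 a haT h⟩
      · exact h2 a haT b hbT hab
  have hTsum : ∑ t ∈ T, x t = x p + ∑ t ∈ T.erase p, x t := (Finset.add_sum_erase T x hpT).symm
  have hle : x p ≤ x q := by
    have := hT.2 U hUa
    rw [hU, Finset.sum_insert hqe] at this
    linarith
  refine ⟨hle, ?_⟩
  set y := exchange ρ p q x with hy
  have hyS : ∑ s ∈ S, y s = ∑ s ∈ S, x s := by
    refine Finset.sum_congr rfl fun s hs => ?_
    have h1 : s ≠ p := fun h => hpS (h ▸ hs)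
    have h2 : s ≠ q := fun h => hqS (h ▸ hs)
    simp [hy, exchange, h1, h2]
  have hyU : ∑ s ∈ U, y s = ∑ t ∈ T, x t := by
    rw [hU, Finset.sum_insert hqe, hTsum]
    congr 1
    · simp [hy, exchange, hne.symm]
    · refine Finset.sum_congr rfl fun s hs => ?_
      have h1 : s ≠ p := Finset.ne_of_mem_erase hs
      have h2 : s ≠ q := fun h => hqe (h ▸ hs)
      simp [hy, exchange, h1, h2]
  have hge : ∀ V : Finset (Fin m × Fin n),
      ∑ t ∈ V, x (if t = q then p else t) ≤ ∑ t ∈ V, y t := by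
    refine fun V => Finset.sum_le_sum fun t _ => ?_
    by_cases htq : t = q
    · simp [hy, exchange, htq, hne.symm]
    · by_cases htp : t = p
      · simp only [htp, hy, exchange, if_neg hne, if_true]
        nlinarith [mul_nonneg hρ (sub_nonneg.2 hle)]
      · simp [hy, exchange, htq, htp]
  refine ⟨S, U, ⟨⟨hS.1, fun V hV => ?_⟩, hR, hK⟩, ⟨hUa, fun V hV => ?_⟩, ?_, ?_,
    Finset.mem_insert_self _ _⟩
  · rw [hyS]
    exact (le_sum_redirect hS hrow (hK ▸ hp) (hK ▸ hq) hV (Or.inl rfl) hS.2).trans (hge V)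
  · rw [hyU]
    exact (le_sum_redirect hS hrow (hK ▸ hp) (hK ▸ hq) hV (Or.inr rfl) hT.2).trans (hge V)
  · rw [hU, Finset.image_insert, ← hrow, ← Finset.image_insert, Finset.insert_erase hpT, hi]
  · have : (T.erase p).image Prod.snd = K := by
      rw [← Finset.erase_insert hp, ← hj]
      ext c
      simp only [Finset.mem_image, Finset.mem_erase]
      constructor
      · rintro ⟨t, ⟨h1, h2⟩, rfl⟩
        exact ⟨fun h => h1 (hT.1.injOn_snd h2 hpT h), t, h2, rfl⟩
      · rintro ⟨h1, t, h2, rfl⟩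
        exact ⟨t, ⟨fun h => h1 (h ▸ rfl), h2⟩, rfl⟩
    rw [hU, Finset.image_insert, this]

theorem exchange_mem_augEvent_row (hne : p ≠ q) (hcol : p.2 = q.2) (hp : p.1 ∉ R) (hq : q.1 ∉ R)
    (hρ : 0 ≤ ρ) (hx : x ∈ augEvent m n l R K p.1 j p) :
    x p ≤ x q ∧ exchange ρ p q x ∈ augEvent m n l R K q.1 j q := by
  have := exchange_mem_augEvent_col (p := p.swap) (q := q.swap)
    (fun h => hne (Prod.swap_injective h)) hcol hp hq hρ (swap_mem_augEvent hx)
  refine ⟨by simpa using this.1, ?_⟩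
  have h2 := swap_mem_augEvent this.2
  rw [← exchange_comp_swap] at h2
  simpa [Function.comp_assoc] using h2

end Exchange

section Density

variable {ι : Type*} [Fintype ι]

/-- The joint density of independent exponential variables with rates `b p`. -/
noncomputable def expDensity (b : ι → ℝ) (x : ι → ℝ) : ℝ :=
  ∏ p, if 0 ≤ x p then b p * Real.exp (-(b p * x p)) else 0

theorem integrable_expDensity {b : ι → ℝ} (hb : ∀ p, 0 < b p) :
    Integrable (expDensity b) := by
  have : ∀ p, Integrable fun y : ℝ => if 0 ≤ y then b p * Real.exp (-(b p * y)) else 0 := by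
    intro p
    have h1 : IntegrableOn (fun y : ℝ => b p * Real.exp (-(b p * y))) (Set.Ici 0) := by
      rw [integrableOn_Ici_iff_integrableOn_Ioi]
      have := (exp_neg_integrableOn_Ioi 0 (hb p)).const_mul (b p)
      simpa only [neg_mul, IntegrableOn] using this
    exact (integrable_indicator_iff measurableSet_Ici).2 h1
  exact Integrable.fintype_prod this

variable [DecidableEq ι] {p q : ι} {ρ : ℝ}

theorem expDensity_exchange {b : ι → ℝ} (hb : ∀ p, 0 < b p) (hne : p ≠ q) {x : ι → ℝ}
    (hx : x p ≤ x q) : expDensity b (exchange (b q / b p) p q x) = expDensity b x := by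
  have hq : q ∈ Finset.univ.erase p := Finset.mem_erase.2 ⟨hne.symm, Finset.mem_univ q⟩
  have hbp := (hb p).ne'
  have hρ : 0 ≤ b q / b p := (div_pos (hb q) (hb p)).le
  unfold expDensity
  rw [← Finset.mul_prod_erase _ _ (Finset.mem_univ p), ← Finset.mul_prod_erase _ _ hq,
    ← Finset.mul_prod_erase _ _ (Finset.mem_univ p), ← Finset.mul_prod_erase _ _ hq,
    ← mul_assoc, ← mul_assoc]
  congr 1
  · have hyp : exchange (b q / b p) p q x p = x p + b q / b p * (x q - x p) := by simp [exchange]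
    have hyq : exchange (b q / b p) p q x q = x p := by simp [exchange, hne.symm]
    rw [hyp, hyq]
    rcases le_or_gt 0 (x p) with h0 | h0
    · have h1 : 0 ≤ x p + b q / b p * (x q - x p) :=
        add_nonneg h0 (mul_nonneg hρ (sub_nonneg.2 hx))
      simp only [if_pos h0, if_pos h1, if_pos (h0.trans hx)]
      rw [mul_mul_mul_comm, mul_mul_mul_comm (b p) (Real.exp _), ← Real.exp_add, ← Real.exp_add]
      congr 2
      field_simp
      ring
    · simp only [if_neg h0.not_ge, mul_zero, zero_mul]
  · refine Finset.prod_congr rfl fun e he => ?_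
    rw [Finset.mem_erase, Finset.mem_erase] at he
    simp [exchange, he.1, he.2.1]

/-- `exchange` as a matrix. -/
def exchangeMatrix (ρ : ℝ) (p q : ι) : Matrix ι ι ℝ :=
  ((1 : Matrix ι ι ℝ).updateRow q (Pi.single p 1)).updateRow p
    ((1 - ρ) • Pi.single p 1 + ρ • Pi.single q 1)

theorem toLin'_exchangeMatrix (hne : p ≠ q) (x : ι → ℝ) :
    Matrix.toLin' (exchangeMatrix ρ p q) x = exchange ρ p q x := by
  ext e
  rw [Matrix.toLin'_apply, exchangeMatrix, exchange]
  by_cases hp : e = p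
  · subst hp
    rw [Matrix.mulVec, Matrix.updateRow_self, add_dotProduct, smul_dotProduct, smul_dotProduct,
      single_dotProduct, single_dotProduct, if_pos rfl]
    simp only [one_mul, smul_eq_mul]
    ring
  · by_cases hq : e = q
    · subst hq
      simp [Matrix.mulVec, hp]
    · simp [Matrix.mulVec, Matrix.updateRow_ne, hp, hq, Matrix.one_apply, dotProduct]

theorem det_exchangeMatrix (hne : p ≠ q) : (exchangeMatrix ρ p q).det = -ρ := by
  have h1 : (((1 : Matrix ι ι ℝ).updateRow q (Pi.single p 1)).updateRow p
      (Pi.single p 1)).det = 0 := by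
    refine Matrix.det_zero_of_row_eq hne ?_
    rw [Matrix.updateRow_self, Matrix.updateRow_ne hne.symm, Matrix.updateRow_self]
  have h2 : ((1 : Matrix ι ι ℝ).updateRow q (Pi.single p 1)).updateRow p (Pi.single q 1)
      = (1 : Matrix ι ι ℝ).submatrix (Equiv.swap p q) id := by
    ext a b
    by_cases ha : a = p
    · subst ha
      simp [Matrix.one_apply, Pi.single_apply, eq_comm]
    · by_cases hb : a = q
      · subst hb
        simp [ha, Matrix.one_apply, Pi.single_apply, eq_comm]
      · simp [ha, hb, Matrix.one_apply, Equiv.swap_apply_of_ne_of_ne]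
  rw [exchangeMatrix, Matrix.det_updateRow_add, Matrix.det_updateRow_smul,
    Matrix.det_updateRow_smul, h1, h2, Matrix.det_permute]
  simp [Equiv.Perm.sign_swap hne]

theorem mul_withDensity_le {b : ι → ℝ} (hb : ∀ p, 0 < b p) (hne : p ≠ q) {A B : Set (ι → ℝ)}
    (hA : MeasurableSet A)
    (h : ∀ x ∈ A, x p ≤ x q ∧ exchange (b q / b p) p q x ∈ B) :
    ENNReal.ofReal (b q / b p) *
      (volume.withDensity fun x => ENNReal.ofReal (expDensity b x)) A ≤
      (volume.withDensity fun x => ENNReal.ofReal (expDensity b x)) B := by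
  set ρ := b q / b p with hρ
  have hρ0 : 0 < ρ := div_pos (hb q) (hb p)
  let L : (ι → ℝ) →L[ℝ] (ι → ℝ) :=
    LinearMap.toContinuousLinearMap (Matrix.toLin' (exchangeMatrix ρ p q))
  have hL : ∀ x, L x = exchange ρ p q x := toLin'_exchangeMatrix hne
  have hdet : L.det = -ρ := by
    simp only [L, LinearMap.det_toContinuousLinearMap, LinearMap.det_toLin']
    exact det_exchangeMatrix hne
  have hinj : Function.Injective L := by
    intro x y hxy
    rw [hL, hL] at hxy
    have h1 : x p = y p := by simpa [exchange, hne.symm] using congrFun hxy q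
    funext e
    by_cases hp : e = p
    · rw [hp, h1]
    · by_cases hq : e = q
      · have := congrFun hxy p
        simp only [exchange, if_true, h1] at this
        rw [hq]
        have := mul_left_cancel₀ hρ0.ne' (add_left_cancel this)
        linarith
      · simpa [exchange, hp, hq] using congrFun hxy e
  rw [withDensity_apply' _ A, withDensity_apply' _ B,
    ← lintegral_const_mul' _ _ ENNReal.ofReal_ne_top]
  calc _ = ∫⁻ x in A, ENNReal.ofReal |L.det| * ENNReal.ofReal (expDensity b (L x)) := by
        refine setLIntegral_congr_fun hA fun x hx => ?_
        simp only [hdet, abs_neg, abs_of_pos hρ0, hL]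
        rw [hρ, expDensity_exchange hb hne (h x hx).1]
    _ = ∫⁻ x in L '' A, ENNReal.ofReal (expDensity b x) :=
        (lintegral_image_eq_lintegral_abs_det_fderiv_mul volume hA
          (fun x _ => L.hasFDerivWithinAt) hinj.injOn
          fun x => ENNReal.ofReal (expDensity b x)).symm
    _ ≤ _ := by
        refine lintegral_mono_set ?_
        rintro _ ⟨x, hx, rfl⟩
        rw [hL]
        exact (h x hx).2

theorem ae_injective_sum : ∀ᵐ x : ι → ℝ, Function.Injective fun U : Finset ι => ∑ p ∈ U, x p := by
  have : ∀ U V : Finset ι, U ≠ V → ∀ᵐ x : ι → ℝ, ∑ p ∈ U, x p ≠ ∑ p ∈ V, x p := by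
    intro U V hUV
    let F : (ι → ℝ) →ₗ[ℝ] ℝ := ∑ p ∈ U, LinearMap.proj p - ∑ p ∈ V, LinearMap.proj p
    have hF : ∀ x, F x = ∑ p ∈ U, x p - ∑ p ∈ V, x p := fun x => by
      simp [F, LinearMap.sum_apply]
    have hker : LinearMap.ker F ≠ ⊤ := by
      intro h
      apply hUV
      ext e
      have h1 : F (Pi.single e 1) = 0 := by
        rw [← LinearMap.mem_ker, h]; trivial
      rw [hF] at h1
      simp only [Finset.sum_pi_single'] at h1
      by_cases h2 : e ∈ U <;> by_cases h3 : e ∈ V <;> simp_all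
    have := Measure.addHaar_submodule volume _ hker
    rw [ae_iff]
    convert this using 2
    ext x
    simp [hF, sub_eq_zero]
  have h2 : ∀ᵐ x : ι → ℝ, ∀ U V : Finset ι, U ≠ V → ∑ p ∈ U, x p ≠ ∑ p ∈ V, x p := by
    rw [ae_all_iff]
    intro U
    rw [ae_all_iff]
    intro V
    by_cases h : U = V
    · simp [h]
    · filter_upwards [this U V h] with x hx _ using hx
  filter_upwards [h2] with x hx U V hUV
  by_contra hne
  exact hx U V hne hUV

end Density

section Measure

variable {m n : ℕ} {r : Fin m → ℝ} {c : Fin n → ℝ}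

theorem rankOneMeasure_eq : rankOneMeasure m n r c =
    volume.withDensity fun x => ENNReal.ofReal (expDensity (fun p => r p.1 * c p.2) x) := rfl

theorem isFiniteMeasure_rankOneMeasure (hr : ∀ i, 0 < r i) (hc : ∀ j, 0 < c j) :
    IsFiniteMeasure (rankOneMeasure m n r c) := by
  have h := (integrable_expDensity (b := fun p : Fin m × Fin n => r p.1 * c p.2)
    fun p => mul_pos (hr p.1) (hc p.2)).2
  rw [rankOneMeasure_eq]
  exact isFiniteMeasure_withDensity_ofReal h

theorem ae_rankOneMeasure_injective_sum : ∀ᵐ x ∂rankOneMeasure m n r c,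
    Function.Injective fun U : Finset (Fin m × Fin n) => ∑ p ∈ U, x p :=
  (withDensity_absolutelyContinuous _ _).ae_le ae_injective_sum

theorem measurableSet_minAssignF (l : ℕ) (S : Finset (Fin m × Fin n)) :
    MeasurableSet {x | MinAssignF m n l x S} := by
  have hsum : ∀ U : Finset (Fin m × Fin n),
      Measurable fun x : Fin m × Fin n → ℝ => ∑ p ∈ U, x p := fun U =>
    Finset.measurable_sum U fun p _ => measurable_pi_apply p
  have hmin : MeasurableSet {x : Fin m × Fin n → ℝ |
      ∀ T, IsAssignF m n l T → ∑ p ∈ S, x p ≤ ∑ p ∈ T, x p} := by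
    rw [Set.ofPred_forall]
    refine MeasurableSet.iInter fun T => ?_
    rw [Set.ofPred_forall]
    exact MeasurableSet.iInter fun _ => measurableSet_le (hsum S) (hsum T)
  exact (MeasurableSet.const _).inter hmin

theorem measurableSet_exists_minAssignF (l : ℕ) (P : Finset (Fin m × Fin n) → Prop) :
    MeasurableSet {x | ∃ S, MinAssignF m n l x S ∧ P S} := by
  rw [Set.ofPred_exists]
  exact MeasurableSet.iUnion fun S => (measurableSet_minAssignF l S).inter (MeasurableSet.const _)

theorem measurableSet_condEvent (k : ℕ) : MeasurableSet (condEvent k m n) :=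
  measurableSet_exists_minAssignF _ _

theorem measurableSet_rowEvent (k : ℕ) (i : Fin m) : MeasurableSet (rowEvent k m n i) :=
  measurableSet_exists_minAssignF _ _

theorem measurableSet_colEvent (k : ℕ) (j : Fin n) : MeasurableSet (colEvent k m n j) :=
  measurableSet_exists_minAssignF _ _

theorem measurableSet_augEvent (l : ℕ) (R : Finset (Fin m)) (K : Finset (Fin n)) (i : Fin m)
    (j : Fin n) (p : Fin m × Fin n) : MeasurableSet (augEvent m n l R K i j p) := by
  rw [augEvent, Set.ofPred_exists]
  refine MeasurableSet.iUnion fun S => ?_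
  rw [Set.ofPred_exists]
  exact MeasurableSet.iUnion fun T =>
    ((measurableSet_minAssignF l S).inter (MeasurableSet.const _)).inter
      ((measurableSet_minAssignF (l + 1) T).inter (MeasurableSet.const _))

theorem mul_rankOneMeasure_le (hr : ∀ i, 0 < r i) (hc : ∀ j, 0 < c j) {p q : Fin m × Fin n}
    (hne : p ≠ q) {A B : Set (Fin m × Fin n → ℝ)} (hA : MeasurableSet A)
    (h : ∀ x ∈ A, x p ≤ x q ∧ exchange (r q.1 * c q.2 / (r p.1 * c p.2)) p q x ∈ B) :
    (r q.1 * c q.2) * (rankOneMeasure m n r c).real A ≤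
      (r p.1 * c p.2) * (rankOneMeasure m n r c).real B := by
  have := isFiniteMeasure_rankOneMeasure hr hc
  have hb : ∀ p : Fin m × Fin n, 0 < r p.1 * c p.2 := fun p => mul_pos (hr p.1) (hc p.2)
  have h1 := mul_withDensity_le (b := fun p : Fin m × Fin n => r p.1 * c p.2) hb hne hA h
  rw [← rankOneMeasure_eq] at h1
  have h2 := ENNReal.toReal_mono (measure_ne_top _ B) h1
  rw [ENNReal.toReal_mul, ENNReal.toReal_ofReal (div_pos (hb q) (hb p)).le] at h2
  rw [div_mul_eq_mul_div, div_le_iff₀ (hb p)] at h2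
  rw [mul_comm (r p.1 * c p.2)]
  exact h2

theorem augEvent_col (hr : ∀ i, 0 < r i) (hc : ∀ j, 0 < c j) {l : ℕ} {R : Finset (Fin m)}
    {K : Finset (Fin n)} {i i₀ : Fin m} {j j' : Fin n} (hj : j ∉ K) (hj' : j' ∉ K) :
    c j' * (rankOneMeasure m n r c).real (augEvent m n l R K i j (i₀, j)) =
      c j * (rankOneMeasure m n r c).real (augEvent m n l R K i j' (i₀, j')) := by
  rcases eq_or_ne j j' with rfl | hne
  · rfl
  have key : ∀ {j j' : Fin n}, j ∉ K → j' ∉ K → j ≠ j' →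
      c j' * (rankOneMeasure m n r c).real (augEvent m n l R K i j (i₀, j)) ≤
      c j * (rankOneMeasure m n r c).real (augEvent m n l R K i j' (i₀, j')) := by
    intro j j' hj hj' hne
    have h := mul_rankOneMeasure_le hr hc (p := (i₀, j)) (q := (i₀, j'))
      (fun h => hne (congrArg Prod.snd h)) (measurableSet_augEvent l R K i j (i₀, j))
      fun x hx => exchange_mem_augEvent_col (fun h => hne (congrArg Prod.snd h)) rfl hj hj'
        (div_pos (mul_pos (hr _) (hc _)) (mul_pos (hr _) (hc _))).le hx
    rw [mul_assoc, mul_assoc] at h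
    exact le_of_mul_le_mul_left h (hr i₀)
  exact le_antisymm (key hj hj' hne) (key hj' hj hne.symm)

theorem augEvent_row (hr : ∀ i, 0 < r i) (hc : ∀ j, 0 < c j) {l : ℕ} {R : Finset (Fin m)}
    {K : Finset (Fin n)} {i i' : Fin m} {j j₀ : Fin n} (hi : i ∉ R) (hi' : i' ∉ R) :
    r i' * (rankOneMeasure m n r c).real (augEvent m n l R K i j (i, j₀)) =
      r i * (rankOneMeasure m n r c).real (augEvent m n l R K i' j (i', j₀)) := by
  rcases eq_or_ne i i' with rfl | hne
  · rfl
  have key : ∀ {i i' : Fin m}, i ∉ R → i' ∉ R → i ≠ i' →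
      r i' * (rankOneMeasure m n r c).real (augEvent m n l R K i j (i, j₀)) ≤
      r i * (rankOneMeasure m n r c).real (augEvent m n l R K i' j (i', j₀)) := by
    intro i i' hi hi' hne
    have h := mul_rankOneMeasure_le hr hc (p := (i, j₀)) (q := (i', j₀))
      (fun h => hne (congrArg Prod.fst h)) (measurableSet_augEvent l R K i j (i, j₀))
      fun x hx => exchange_mem_augEvent_row (fun h => hne (congrArg Prod.fst h)) rfl hi hi'
        (div_pos (mul_pos (hr _) (hc _)) (mul_pos (hr _) (hc _))).le hx
    rw [mul_right_comm, mul_right_comm (r _) (c _)] at h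
    exact le_of_mul_le_mul_right h (hc j₀)
  exact le_antisymm (key hi hi' hne) (key hi' hi hne.symm)

/-- Finite additivity over an almost everywhere partition. -/
theorem measureReal_eq_sum {Ω κ : Type*} [MeasurableSpace Ω] {μ : Measure Ω} [IsFiniteMeasure μ]
    {A : Set Ω} {s : Finset κ} {B : κ → Set Ω} (hB : ∀ k, MeasurableSet (B k))
    (hA : ∀ᵐ x ∂μ, x ∈ A ↔ ∃ k ∈ s, x ∈ B k)
    (hd : ∀ᵐ x ∂μ, ∀ k ∈ s, ∀ k' ∈ s, x ∈ B k → x ∈ B k' → k = k') :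
    μ.real A = ∑ k ∈ s, μ.real (B k) := by
  rw [← measureReal_biUnion_finset₀ _ fun k _ => (hB k).nullMeasurableSet]
  · refine measureReal_congr ?_
    filter_upwards [hA] with x hx
    simp only [eq_iff_iff]
    change x ∈ A ↔ x ∈ ⋃ k ∈ s, B k
    rw [hx]
    simp
  · intro k hk k' hk' hne
    refine measure_mono_null ?_ (ae_iff.1 hd)
    rintro x ⟨h1, h2⟩ h
    exact hne (h k hk k' hk' h1 h2)

theorem rankOneMeasure_condEvent_ne_zero (hr : ∀ i, 0 < r i) (hc : ∀ j, 0 < c j) {l : ℕ}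
    (hm : l ≤ m) (hn : l ≤ n) : rankOneMeasure m n r c (condEvent (l + 1) m n) ≠ 0 := by
  classical
  let S₀ : Finset (Fin m × Fin n) :=
    (Finset.univ : Finset (Fin l)).image fun a => (Fin.castLE hm a, Fin.castLE hn a)
  have hmem : ∀ p, p ∈ S₀ ↔ ∃ a : Fin l, (Fin.castLE hm a, Fin.castLE hn a) = p := by simp [S₀]
  have hcard : S₀.card = l := by
    rw [Finset.card_image_of_injective _ fun a b h =>
      Fin.castLE_injective hm (congrArg Prod.fst h), Finset.card_univ, Fintype.card_fin]
  let I : Fin m × Fin n → Set ℝ := fun p => if p ∈ S₀ then Set.Ioo 0 1 else Set.Ioo l (l + 1)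
  have hI : IsOpen (Set.univ.pi I) := isOpen_set_pi Set.finite_univ fun p _ => by
    dsimp only [I]
    split_ifs <;> exact isOpen_Ioo
  have hne : (Set.univ.pi I).Nonempty := Set.univ_pi_nonempty_iff.2 fun p => by
    dsimp only [I]
    split_ifs <;> exact Set.nonempty_Ioo.2 (by norm_num)
  have hpos : ∀ x ∈ Set.univ.pi I, ∀ p, 0 < x p := by
    intro x hx p
    have := hx p trivial
    dsimp only [I] at this
    split_ifs at this
    · exact this.1
    · exact (Nat.cast_nonneg l).trans_lt this.1
  have hsub : Set.univ.pi I ⊆ condEvent (l + 1) m n := by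
    intro x hx
    refine ⟨S₀, ⟨⟨hcard, ?_⟩, fun T hT => ?_⟩, ?_, ?_⟩
    · intro p hp q hq hpq
      obtain ⟨a, rfl⟩ := (hmem p).1 hp
      obtain ⟨b, rfl⟩ := (hmem q).1 hq
      have hab : a ≠ b := fun h => hpq (by rw [h])
      exact ⟨fun h => hab (Fin.castLE_injective hm h), fun h => hab (Fin.castLE_injective hn h)⟩
    · by_cases hTS : T ⊆ S₀
      · rw [Finset.eq_of_subset_of_card_le hTS (by rw [hcard, hT.1, Nat.add_sub_cancel])]
      · obtain ⟨t, ht, htS⟩ := Finset.not_subset.1 hTS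
        have h1 : (l : ℝ) < x t := by
          have := hx t trivial
          simp only [I, if_neg htS] at this
          exact this.1
        calc ∑ p ∈ S₀, x p ≤ S₀.card • (1 : ℝ) := Finset.sum_le_card_nsmul _ _ _ fun p hp => by
              have := hx p trivial
              simp only [I, if_pos hp] at this
              exact this.2.le
          _ ≤ x t := by rw [hcard, nsmul_one]; exact h1.le
          _ ≤ ∑ p ∈ T, x p :=
              Finset.single_le_sum (f := x) (fun p _ => (hpos x hx p).le) ht
    · ext i
      simp only [Finset.mem_image, hmem, firstRows, Finset.mem_filter, Finset.mem_univ, true_and,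
        Nat.add_sub_cancel]
      constructor
      · rintro ⟨_, ⟨a, rfl⟩, rfl⟩
        exact a.2
      · exact fun hi => ⟨_, ⟨⟨i, hi⟩, rfl⟩, rfl⟩
    · ext j
      simp only [Finset.mem_image, hmem, firstRows, Finset.mem_filter, Finset.mem_univ, true_and,
        Nat.add_sub_cancel]
      constructor
      · rintro ⟨_, ⟨a, rfl⟩, rfl⟩
        exact a.2
      · exact fun hj => ⟨_, ⟨⟨j, hj⟩, rfl⟩, rfl⟩
  intro h0
  have h1 := measure_mono_null hsub h0
  have hmeas : Measurable fun x : Fin m × Fin n → ℝ =>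
      ENNReal.ofReal (expDensity (fun p => r p.1 * c p.2) x) := by
    refine ENNReal.measurable_ofReal.comp (Finset.measurable_prod _ fun p _ => ?_)
    refine Measurable.ite (measurableSet_le measurable_const (measurable_pi_apply p)) ?_
      measurable_const
    fun_prop
  rw [rankOneMeasure_eq, withDensity_apply_eq_zero hmeas] at h1
  refine (hI.measure_pos volume hne).ne' (measure_mono_null ?_ h1)
  refine fun x hx => ⟨(ENNReal.ofReal_pos.2 (Finset.prod_pos fun p _ => ?_)).ne', hx⟩
  rw [if_pos (hpos x hx p).le]
  exact mul_pos (mul_pos (hr _) (hc _)) (Real.exp_pos _)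

end Measure

section Combination

variable {m n l : ℕ} {r : Fin m → ℝ} {c : Fin n → ℝ} {x : Fin m × Fin n → ℝ}

theorem mem_filter_le_iff_notMem_firstRows {i : Fin m} :
    i ∈ Finset.univ.filter (fun i : Fin m => l ≤ (i : ℕ)) ↔ i ∉ firstRows m l := by
  simp [firstRows]

theorem MinAssignF.eq (hx : Function.Injective fun U : Finset (Fin m × Fin n) => ∑ p ∈ U, x p)
    {S T : Finset (Fin m × Fin n)} (hS : MinAssignF m n l x S) (hT : MinAssignF m n l x T) :
    S = T :=
  hx (le_antisymm (hS.2 T hT.1) (hT.2 S hS.1))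

theorem MinAssignF.exists_insert_of_mem_condEvent
    (hx : Function.Injective fun U : Finset (Fin m × Fin n) => ∑ p ∈ U, x p)
    (hE : x ∈ condEvent (l + 1) m n) {T : Finset (Fin m × Fin n)}
    (hT : MinAssignF m n (l + 1) x T) :
    (∃ i ∉ firstRows m l, T.image Prod.fst = insert i (firstRows m l)) ∧
      ∃ j ∉ firstRows n l, T.image Prod.snd = insert j (firstRows n l) := by
  obtain ⟨S, hS, hR, hK⟩ := hE
  rw [Nat.add_sub_cancel] at hS hR hK
  rw [← hR, ← hK]
  exact ⟨hS.exists_fst_image_eq_insert hx hT, hS.exists_snd_image_eq_insert hx hT⟩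

theorem eq_of_insert_eq_insert {α : Type*} [DecidableEq α] {s : Finset α} {a b : α} (ha : a ∉ s)
    (h : insert a s = insert b s) : a = b := by
  have := Finset.mem_insert_self a s
  rw [h, Finset.mem_insert] at this
  exact this.resolve_right ha

theorem measureReal_condEvent (hr : ∀ i, 0 < r i) (hc : ∀ j, 0 < c j) (hm : l + 1 ≤ m)
    (hn : l + 1 ≤ n) :
    (rankOneMeasure m n r c).real (condEvent (l + 1) m n) =
      ∑ i ∈ Finset.univ.filter (fun i : Fin m => l ≤ (i : ℕ)),
        (rankOneMeasure m n r c).real (condEvent (l + 1) m n ∩ rowEvent (l + 1) m n i) := by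
  have := isFiniteMeasure_rankOneMeasure hr hc
  refine measureReal_eq_sum
    (fun i => (measurableSet_condEvent _).inter (measurableSet_rowEvent _ i)) ?_ ?_
  · filter_upwards [ae_rankOneMeasure_injective_sum] with x hx
    refine ⟨fun hE => ?_, fun ⟨_, _, h⟩ => h.1⟩
    obtain ⟨T, hT⟩ := exists_minAssignF hm hn x
    obtain ⟨⟨i, hi, hiT⟩, -⟩ := hT.exists_insert_of_mem_condEvent hx hE
    exact ⟨i, mem_filter_le_iff_notMem_firstRows.2 hi, hE, T, hT, hiT⟩
  · filter_upwards [ae_rankOneMeasure_injective_sum] with x hx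
    rintro i hi i' - ⟨-, T, hT, hiT⟩ ⟨-, T', hT', hiT'⟩
    rw [hT.eq hx hT', hiT'] at hiT
    exact eq_of_insert_eq_insert (mem_filter_le_iff_notMem_firstRows.1 hi) hiT.symm

theorem measureReal_condEvent_col (hr : ∀ i, 0 < r i) (hc : ∀ j, 0 < c j) (hm : l + 1 ≤ m)
    (hn : l + 1 ≤ n) :
    (rankOneMeasure m n r c).real (condEvent (l + 1) m n) =
      ∑ j ∈ Finset.univ.filter (fun j : Fin n => l ≤ (j : ℕ)),
        (rankOneMeasure m n r c).real (condEvent (l + 1) m n ∩ colEvent (l + 1) m n j) := by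
  have := isFiniteMeasure_rankOneMeasure hr hc
  refine measureReal_eq_sum
    (fun j => (measurableSet_condEvent _).inter (measurableSet_colEvent _ j)) ?_ ?_
  · filter_upwards [ae_rankOneMeasure_injective_sum] with x hx
    refine ⟨fun hE => ?_, fun ⟨_, _, h⟩ => h.1⟩
    obtain ⟨T, hT⟩ := exists_minAssignF hm hn x
    obtain ⟨-, j, hj, hjT⟩ := hT.exists_insert_of_mem_condEvent hx hE
    exact ⟨j, mem_filter_le_iff_notMem_firstRows.2 hj, hE, T, hT, hjT⟩
  · filter_upwards [ae_rankOneMeasure_injective_sum] with x hx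
    rintro j hj j' - ⟨-, T, hT, hjT⟩ ⟨-, T', hT', hjT'⟩
    rw [hT.eq hx hT', hjT'] at hjT
    exact eq_of_insert_eq_insert (mem_filter_le_iff_notMem_firstRows.1 hj) hjT.symm

theorem measureReal_rowEvent (hr : ∀ i, 0 < r i) (hc : ∀ j, 0 < c j) (i : Fin m) :
    (rankOneMeasure m n r c).real (condEvent (l + 1) m n ∩ rowEvent (l + 1) m n i) =
      ∑ j ∈ Finset.univ.filter (fun j : Fin n => l ≤ (j : ℕ)),
        (rankOneMeasure m n r c).real
          (condEvent (l + 1) m n ∩ (rowEvent (l + 1) m n i ∩ colEvent (l + 1) m n j)) := by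
  have := isFiniteMeasure_rankOneMeasure hr hc
  refine measureReal_eq_sum (fun j => (measurableSet_condEvent _).inter
    ((measurableSet_rowEvent _ i).inter (measurableSet_colEvent _ j))) ?_ ?_
  · filter_upwards [ae_rankOneMeasure_injective_sum] with x hx
    refine ⟨fun ⟨hE, T, hT, hiT⟩ => ?_, fun ⟨_, _, h⟩ => ⟨h.1, h.2.1⟩⟩
    obtain ⟨-, j, hj, hjT⟩ := hT.exists_insert_of_mem_condEvent hx hE
    exact ⟨j, mem_filter_le_iff_notMem_firstRows.2 hj, hE, ⟨T, hT, hiT⟩, T, hT, hjT⟩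
  · filter_upwards [ae_rankOneMeasure_injective_sum] with x hx
    rintro j hj j' - ⟨-, -, T, hT, hjT⟩ ⟨-, -, T', hT', hjT'⟩
    rw [hT.eq hx hT', hjT'] at hjT
    exact eq_of_insert_eq_insert (mem_filter_le_iff_notMem_firstRows.1 hj) hjT.symm

theorem measureReal_colEvent (hr : ∀ i, 0 < r i) (hc : ∀ j, 0 < c j) (j : Fin n) :
    (rankOneMeasure m n r c).real (condEvent (l + 1) m n ∩ colEvent (l + 1) m n j) =
      ∑ i ∈ Finset.univ.filter (fun i : Fin m => l ≤ (i : ℕ)),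
        (rankOneMeasure m n r c).real
          (condEvent (l + 1) m n ∩ (rowEvent (l + 1) m n i ∩ colEvent (l + 1) m n j)) := by
  have := isFiniteMeasure_rankOneMeasure hr hc
  refine measureReal_eq_sum (fun i => (measurableSet_condEvent _).inter
    ((measurableSet_rowEvent _ i).inter (measurableSet_colEvent _ j))) ?_ ?_
  · filter_upwards [ae_rankOneMeasure_injective_sum] with x hx
    refine ⟨fun ⟨hE, T, hT, hjT⟩ => ?_, fun ⟨_, _, h⟩ => ⟨h.1, h.2.2⟩⟩
    obtain ⟨⟨i, hi, hiT⟩, -⟩ := hT.exists_insert_of_mem_condEvent hx hE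
    exact ⟨i, mem_filter_le_iff_notMem_firstRows.2 hi, hE, ⟨T, hT, hiT⟩, T, hT, hjT⟩
  · filter_upwards [ae_rankOneMeasure_injective_sum] with x hx
    rintro i hi i' - ⟨-, ⟨T, hT, hiT⟩, -⟩ ⟨-, ⟨T', hT', hiT'⟩, -⟩
    rw [hT.eq hx hT', hiT'] at hiT
    exact eq_of_insert_eq_insert (mem_filter_le_iff_notMem_firstRows.1 hi) hiT.symm

theorem mem_of_mem_augEvent {i : Fin m} {j : Fin n} {p : Fin m × Fin n}
    (h : x ∈ augEvent m n l (firstRows m l) (firstRows n l) i j p) :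
    x ∈ condEvent (l + 1) m n ∩ (rowEvent (l + 1) m n i ∩ colEvent (l + 1) m n j) := by
  obtain ⟨S, T, hS, hT, hiT, hjT, -⟩ := h
  exact ⟨⟨S, hS⟩, ⟨T, hT, hiT⟩, T, hT, hjT⟩

theorem exists_of_mem_inter
    (hx : Function.Injective fun U : Finset (Fin m × Fin n) => ∑ p ∈ U, x p) {i : Fin m}
    {j : Fin n}
    (h : x ∈ condEvent (l + 1) m n ∩ (rowEvent (l + 1) m n i ∩ colEvent (l + 1) m n j)) :
    ∃ T : Finset (Fin m × Fin n), T.image Prod.fst = insert i (firstRows m l) ∧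
      T.image Prod.snd = insert j (firstRows n l) ∧
      ∀ p ∈ T, x ∈ augEvent m n l (firstRows m l) (firstRows n l) i j p := by
  obtain ⟨⟨S, hS⟩, ⟨T, hT, hiT⟩, T', hT', hjT⟩ := h
  rw [← hT.eq hx hT'] at hjT
  exact ⟨T, hiT, hjT, fun p hp => ⟨S, T, hS, hT, hiT, hjT, hp⟩⟩

theorem measureReal_inter_eq_sum_col (hr : ∀ i, 0 < r i) (hc : ∀ j, 0 < c j) (i : Fin m)
    (j : Fin n) :
    (rankOneMeasure m n r c).real
        (condEvent (l + 1) m n ∩ (rowEvent (l + 1) m n i ∩ colEvent (l + 1) m n j)) =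
      ∑ i₀, (rankOneMeasure m n r c).real
        (augEvent m n l (firstRows m l) (firstRows n l) i j (i₀, j)) := by
  have := isFiniteMeasure_rankOneMeasure hr hc
  refine measureReal_eq_sum (fun i₀ => measurableSet_augEvent _ _ _ _ _ _) ?_ ?_
  · filter_upwards [ae_rankOneMeasure_injective_sum] with x hx
    refine ⟨fun h => ?_, fun ⟨_, _, h⟩ => mem_of_mem_augEvent h⟩
    obtain ⟨T, -, hjT, hT⟩ := exists_of_mem_inter hx h
    have hj := Finset.mem_insert_self j (firstRows n l)
    rw [← hjT] at hj
    obtain ⟨p, hp, rfl⟩ := Finset.mem_image.1 hj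
    exact ⟨p.1, Finset.mem_univ _, hT p hp⟩
  · filter_upwards [ae_rankOneMeasure_injective_sum] with x hx
    rintro a - b - ⟨-, T, -, hT, -, -, ha⟩ ⟨-, T', -, hT', -, -, hb⟩
    rw [← hT.eq hx hT'] at hb
    exact congrArg Prod.fst (hT.1.injOn_snd ha hb rfl)

theorem measureReal_inter_eq_sum_row (hr : ∀ i, 0 < r i) (hc : ∀ j, 0 < c j) (i : Fin m)
    (j : Fin n) :
    (rankOneMeasure m n r c).real
        (condEvent (l + 1) m n ∩ (rowEvent (l + 1) m n i ∩ colEvent (l + 1) m n j)) =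
      ∑ j₀, (rankOneMeasure m n r c).real
        (augEvent m n l (firstRows m l) (firstRows n l) i j (i, j₀)) := by
  have := isFiniteMeasure_rankOneMeasure hr hc
  refine measureReal_eq_sum (fun j₀ => measurableSet_augEvent _ _ _ _ _ _) ?_ ?_
  · filter_upwards [ae_rankOneMeasure_injective_sum] with x hx
    refine ⟨fun h => ?_, fun ⟨_, _, h⟩ => mem_of_mem_augEvent h⟩
    obtain ⟨T, hiT, -, hT⟩ := exists_of_mem_inter hx h
    have hi := Finset.mem_insert_self i (firstRows m l)
    rw [← hiT] at hi
    obtain ⟨p, hp, rfl⟩ := Finset.mem_image.1 hi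
    exact ⟨p.2, Finset.mem_univ _, hT p hp⟩
  · filter_upwards [ae_rankOneMeasure_injective_sum] with x hx
    rintro a - b - ⟨-, T, -, hT, -, -, ha⟩ ⟨-, T', -, hT', -, -, hb⟩
    rw [← hT.eq hx hT'] at hb
    exact congrArg Prod.snd (hT.1.injOn_fst ha hb rfl)

theorem sum_mul_eq_mul_sum {α : Type*} {s : Finset α} {a : α → ℝ} (f : α → ℝ) {j : α}
    (h : ∀ j' ∈ s, a j' * f j = a j * f j') : (∑ j ∈ s, a j) * f j = a j * ∑ j ∈ s, f j := by
  rw [Finset.sum_mul, Finset.mul_sum]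
  exact Finset.sum_congr rfl h

theorem cond_eq_ofReal {Ω : Type*} [MeasurableSpace Ω] {μ : Measure Ω} [IsFiniteMeasure μ]
    {s t : Set Ω} (hs : MeasurableSet s) (h0 : μ s ≠ 0) :
    μ[|s] t = ENNReal.ofReal (μ.real (s ∩ t) / μ.real s) := by
  have hpos : 0 < μ.real s := ENNReal.toReal_pos h0 (measure_ne_top _ _)
  rw [cond_apply hs, ENNReal.ofReal_div_of_pos hpos,
    ofReal_measureReal, ofReal_measureReal, mul_comm, div_eq_mul_inv]

end Combination

/-- Conditionally on the minimum `(k−1)`-assignment using exactly the first `k−1` rows and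
columns, the minimum `k`-assignment almost surely uses exactly one additional row and one
additional column; the additional row is `i'` with probability `r i' / (r_k + ⋯ + r_m)`,
the additional column is `j'` with probability `c j' / (c_k + ⋯ + c_n)`, and the additional
row and additional column are (conditionally) independent. -/
theorem additional_row_column (k m n : ℕ) (hk : 0 < k) (hkm : k ≤ m) (hmn : m ≤ n)
    (r : Fin m → ℝ) (c : Fin n → ℝ) (hr : ∀ i, 0 < r i) (hc : ∀ j, 0 < c j) :
    (∀ᵐ x ∂((rankOneMeasure m n r c)[|condEvent k m n]),
      (∃ S, MinAssignF m n k x S) ∧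
      ∀ S, MinAssignF m n k x S → ∃ (i' : Fin m) (j' : Fin n),
        k - 1 ≤ (i' : ℕ) ∧ k - 1 ≤ (j' : ℕ) ∧
        S.image Prod.fst = insert i' (firstRows m (k - 1)) ∧
        S.image Prod.snd = insert j' (firstRows n (k - 1)))
    ∧ (∀ i' : Fin m, k - 1 ≤ (i' : ℕ) →
        (rankOneMeasure m n r c)[|condEvent k m n] (rowEvent k m n i')
          = ENNReal.ofReal (r i' / ∑ i ∈ Finset.univ.filter fun i : Fin m => k - 1 ≤ (i : ℕ), r i))
    ∧ (∀ j' : Fin n, k - 1 ≤ (j' : ℕ) →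
        (rankOneMeasure m n r c)[|condEvent k m n] (colEvent k m n j')
          = ENNReal.ofReal (c j' / ∑ j ∈ Finset.univ.filter fun j : Fin n => k - 1 ≤ (j : ℕ), c j))
    ∧ (∀ (i' : Fin m) (j' : Fin n), k - 1 ≤ (i' : ℕ) → k - 1 ≤ (j' : ℕ) →
        (rankOneMeasure m n r c)[|condEvent k m n] (rowEvent k m n i' ∩ colEvent k m n j')
          = (rankOneMeasure m n r c)[|condEvent k m n] (rowEvent k m n i')
            * (rankOneMeasure m n r c)[|condEvent k m n] (colEvent k m n j')) := by
  obtain ⟨l, rfl⟩ : ∃ l, k = l + 1 := ⟨k - 1, by omega⟩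
  simp only [Nat.add_sub_cancel]
  have hfin := isFiniteMeasure_rankOneMeasure hr hc
  have hkn := hkm.trans hmn
  have h0 := rankOneMeasure_condEvent_ne_zero hr hc (Nat.le_of_succ_le hkm) (Nat.le_of_succ_le hkn)
  have hE := measurableSet_condEvent (m := m) (n := n) (l + 1)
  set μ := rankOneMeasure m n r c with hμ
  set E := condEvent (l + 1) m n with hEdef
  set e := μ.real E with he
  have hepos : 0 < e := ENNReal.toReal_pos h0 (measure_ne_top _ _)
  set s := Finset.univ.filter fun i : Fin m => l ≤ (i : ℕ) with hs
  set t := Finset.univ.filter fun j : Fin n => l ≤ (j : ℕ) with ht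
  have hspos : 0 < ∑ i ∈ s, r i := Finset.sum_pos (fun i _ => hr i)
    ⟨⟨l, hkm⟩, Finset.mem_filter.2 ⟨Finset.mem_univ _, le_rfl⟩⟩
  have htpos : 0 < ∑ j ∈ t, c j := Finset.sum_pos (fun j _ => hc j)
    ⟨⟨l, hkn⟩, Finset.mem_filter.2 ⟨Finset.mem_univ _, le_rfl⟩⟩
  have hcol : ∀ i, ∀ j ∈ t, ∀ j' ∈ t,
      c j' * μ.real (E ∩ (rowEvent (l + 1) m n i ∩ colEvent (l + 1) m n j)) =
      c j * μ.real (E ∩ (rowEvent (l + 1) m n i ∩ colEvent (l + 1) m n j')) := by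
    intro i j hj j' hj'
    rw [measureReal_inter_eq_sum_col hr hc, measureReal_inter_eq_sum_col hr hc, Finset.mul_sum,
      Finset.mul_sum]
    exact Finset.sum_congr rfl fun i₀ _ => augEvent_col hr hc
      (mem_filter_le_iff_notMem_firstRows.1 hj) (mem_filter_le_iff_notMem_firstRows.1 hj')
  have hrow : ∀ j, ∀ i ∈ s, ∀ i' ∈ s,
      r i' * μ.real (E ∩ (rowEvent (l + 1) m n i ∩ colEvent (l + 1) m n j)) =
      r i * μ.real (E ∩ (rowEvent (l + 1) m n i' ∩ colEvent (l + 1) m n j)) := by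
    intro j i hi i' hi'
    rw [measureReal_inter_eq_sum_row hr hc, measureReal_inter_eq_sum_row hr hc, Finset.mul_sum,
      Finset.mul_sum]
    exact Finset.sum_congr rfl fun j₀ _ => augEvent_row hr hc
      (mem_filter_le_iff_notMem_firstRows.1 hi) (mem_filter_le_iff_notMem_firstRows.1 hi')
  have hw : ∀ i, ∀ j ∈ t, (∑ j ∈ t, c j) *
      μ.real (E ∩ (rowEvent (l + 1) m n i ∩ colEvent (l + 1) m n j)) =
      c j * μ.real (E ∩ rowEvent (l + 1) m n i) := by
    intro i j hj
    rw [measureReal_rowEvent hr hc]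
    exact sum_mul_eq_mul_sum
      (fun j => μ.real (E ∩ (rowEvent (l + 1) m n i ∩ colEvent (l + 1) m n j))) (hcol i j hj)
  have hrows : ∀ i ∈ s, μ.real (E ∩ rowEvent (l + 1) m n i) / e = r i / ∑ i ∈ s, r i := by
    intro i hi
    have h1 : (∑ i ∈ s, r i) * μ.real (E ∩ rowEvent (l + 1) m n i) = r i * e := by
      rw [he, measureReal_condEvent hr hc hkm hkn]
      refine sum_mul_eq_mul_sum (fun i => μ.real (E ∩ rowEvent (l + 1) m n i)) fun i' hi' => ?_
      rw [measureReal_rowEvent hr hc, measureReal_rowEvent hr hc, Finset.mul_sum, Finset.mul_sum]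
      exact Finset.sum_congr rfl fun j _ => hrow j i hi i' hi'
    rw [div_eq_div_iff hepos.ne' hspos.ne', mul_comm, h1]
  have hcols : ∀ j ∈ t, μ.real (E ∩ colEvent (l + 1) m n j) / e = c j / ∑ j ∈ t, c j := by
    intro j hj
    have h1 : (∑ j ∈ t, c j) * μ.real (E ∩ colEvent (l + 1) m n j) = c j * e := by
      rw [he, measureReal_condEvent_col hr hc hkm hkn]
      refine sum_mul_eq_mul_sum (fun j => μ.real (E ∩ colEvent (l + 1) m n j)) fun j' hj' => ?_
      rw [measureReal_colEvent hr hc, measureReal_colEvent hr hc, Finset.mul_sum, Finset.mul_sum]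
      exact Finset.sum_congr rfl fun i _ => hcol i j hj j' hj'
    rw [div_eq_div_iff hepos.ne' htpos.ne', mul_comm, h1]
  have hmems : ∀ i : Fin m, l ≤ (i : ℕ) → i ∈ s := fun i hi =>
    Finset.mem_filter.2 ⟨Finset.mem_univ _, hi⟩
  have hmemt : ∀ j : Fin n, l ≤ (j : ℕ) → j ∈ t := fun j hj =>
    Finset.mem_filter.2 ⟨Finset.mem_univ _, hj⟩
  refine ⟨?_, fun i hi => ?_, fun j hj => ?_, fun i j hi hj => ?_⟩
  · filter_upwards [cond_absolutelyContinuous.ae_le ae_rankOneMeasure_injective_sum,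
      ae_cond_mem hE] with x hx hxE
    refine ⟨exists_minAssignF hkm hkn x, fun T hT => ?_⟩
    obtain ⟨⟨i, hi, hiT⟩, j, hj, hjT⟩ := hT.exists_insert_of_mem_condEvent hx hxE
    exact ⟨i, j, (Finset.mem_filter.1 (mem_filter_le_iff_notMem_firstRows.2 hi)).2,
      (Finset.mem_filter.1 (mem_filter_le_iff_notMem_firstRows.2 hj)).2, hiT, hjT⟩
  · rw [cond_eq_ofReal hE h0, hrows i (hmems i hi)]
  · rw [cond_eq_ofReal hE h0, hcols j (hmemt j hj)]
  · rw [cond_eq_ofReal hE h0, cond_eq_ofReal hE h0, cond_eq_ofReal hE h0,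
      ← ENNReal.ofReal_mul (by positivity), hcols j (hmemt j hj)]
    congr 1
    have := hw i j (hmemt j hj)
    rw [div_mul_div_comm, div_eq_div_iff hepos.ne' (mul_pos hepos htpos).ne']
    linear_combination e * this
end
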